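/- arXiv:2402.16588 — 9 statements merged into one kernel-verified Lean document; each statement's English description precedes it below -/
import Mathlib

section
/- For every ε ∈ [0,1), the set D⁰_{2,ε} is contained in D(ε). -/
/-- The map `τ_{r,ε}(z₁,z₂) = (z₂, -⌊r₁z₁ + r₂z₂ + ε⌋)`. -/
noncomputable def tau2 (r : ℝ × ℝ) (ε : ℝ) (z : ℤ × ℤ) : ℤ × ℤ :=
  (z.2, -⌊r.1 * (z.1 : ℝ) + r.2 * (z.2 : ℝ) + ε⌋)

/-- `D⁰_{2,ε}`: the set of `r ∈ ℝ²` such that every orbit of `τ_{r,ε}` reaches `(0,0)`. -/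
def SRS2 (ε : ℝ) : Set (ℝ × ℝ) :=
  {r | ∀ z : ℤ × ℤ, ∃ k : ℕ, (tau2 r ε)^[k] z = (0, 0)}

/-- The set `D(ε)`. -/
def Dset (ε : ℝ) : Set (ℝ × ℝ) :=
  {q | (ε < 1/2 ∧ -q.1 - ε ≤ q.2 ∧ q.2 < q.1 + 1 - ε ∧
          -ε ≤ q.1 ∧ q.1 < 1 - ε) ∨
       (1/2 ≤ ε ∧ -q.1 - 1 + ε < q.2 ∧ q.2 ≤ q.1 + ε ∧
          -(1 - ε) < q.1 ∧ q.1 ≤ ε)}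

lemma srs_inv {r : ℝ × ℝ} {ε : ℝ} (hr : r ∈ SRS2 ε) (P : ℤ × ℤ → Prop)
    (hP : ∀ a b c : ℤ, P (a, b) → 0 ≤ r.1 * a + r.2 * b + c + ε →
      r.1 * a + r.2 * b + c + ε < 1 → P (b, c))
    (h0 : ¬ P (0, 0)) (z : ℤ × ℤ) (hz : P z) : False := by
  obtain ⟨k, hk⟩ := hr z
  have key : ∀ n : ℕ, P ((tau2 r ε)^[n] z) := by
    intro n
    induction n with
    | zero => simpa using hz
    | succ n ih =>
      rw [Function.iterate_succ_apply']
      generalize (tau2 r ε)^[n] z = w at ih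
      obtain ⟨a, b⟩ := w
      apply hP a b _ ih
      · have := Int.floor_le (r.1 * (a : ℝ) + r.2 * (b : ℝ) + ε)
        push_cast
        linarith
      · have := Int.lt_floor_add_one (r.1 * (a : ℝ) + r.2 * (b : ℝ) + ε)
        push_cast
        linarith
  exact h0 (hk ▸ key k)

lemma int_eq_of {c m : ℤ} (h1 : (c : ℝ) < m + 1) (h2 : (m : ℝ) - 1 < c) : c = m := by
  have h1' : c < m + 1 := by exact_mod_cast h1
  have h2' : m - 1 < c := by exact_mod_cast h2
  omega

lemma int_le_of {c m : ℤ} (h2 : (m : ℝ) - 1 < c) : m ≤ c := by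
  have h2' : m - 1 < c := by exact_mod_cast h2
  omega

lemma no_pre {x y ε : ℝ} (hε0 : 0 ≤ ε) (hε1 : ε < 1) (hr : (x, y) ∈ SRS2 ε)
    (h : (1 - ε ≤ x ∧ ε < x) ∨ x ≤ -1) : False := by
  refine srs_inv hr (fun z => z ≠ (0, 0)) ?_ (by simp) (1, 0) (by simp)
  intro a b c hab h1 h2 hbc
  simp only [Prod.mk.injEq] at hbc
  obtain ⟨rfl, rfl⟩ := hbc
  simp only [Int.cast_zero, mul_zero, add_zero] at h1 h2
  have ha : a ≠ 0 := by
    rintro rfl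
    exact hab rfl
  rcases lt_or_gt_of_ne ha with ha | ha
  · have ha' : (a : ℝ) ≤ -1 := by exact_mod_cast (by omega : a ≤ -1)
    rcases h with ⟨h, h'⟩ | h <;> nlinarith
  · have ha' : (1 : ℝ) ≤ a := by exact_mod_cast (by omega : 1 ≤ a)
    rcases h with ⟨h, h'⟩ | h <;> nlinarith

lemma sum_big {x y ε : ℝ} (hε0 : 0 ≤ ε) (hε1 : ε < 1) (hr : (x, y) ∈ SRS2 ε)
    (hx : -1 < x) (h : x + y ≤ -1) : False := by
  rcases le_or_gt 0 x with h0 | h0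
  · refine srs_inv hr (fun z => 1 ≤ z.2 ∧ z.1 ≤ z.2) ?_ (by simp) (1, 1) (by simp)
    rintro a b c ⟨hb, hab⟩ h1 h2
    simp only at hb hab h1 h2 ⊢
    have hb' : (1 : ℝ) ≤ b := by exact_mod_cast hb
    have hab' : (a : ℝ) ≤ b := by exact_mod_cast hab
    have : b ≤ c := int_le_of (by nlinarith)
    omega
  · refine srs_inv hr (fun z => 1 ≤ z.1 ∧ 1 ≤ z.2) ?_ (by simp) (1, 1) (by simp)
    rintro a b c ⟨ha, hb⟩ h1 h2
    simp only at ha hb h1 h2 ⊢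
    have hb' : (1 : ℝ) ≤ b := by exact_mod_cast hb
    have ha' : (1 : ℝ) ≤ a := by exact_mod_cast ha
    have : 1 ≤ c := int_le_of (by push_cast; nlinarith)
    omega

lemma diff_big {x y ε : ℝ} (hε0 : 0 ≤ ε) (hε1 : ε < 1) (hr : (x, y) ∈ SRS2 ε)
    (hx : -1 < x) (h : 1 ≤ y - x) : False := by
  rcases le_or_gt 0 x with h0 | h0
  · refine srs_inv hr (fun z => (1 ≤ z.2 ∧ -z.1 ≤ z.2) ∨ (1 ≤ -z.2 ∧ z.1 ≤ -z.2)) ?_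
      (by simp) (-1, 1) (by simp)
    rintro a b c hab h1 h2
    simp only at hab h1 h2 ⊢
    rcases hab with ⟨hb, hab⟩ | ⟨hb, hab⟩
    · have hb' : (1 : ℝ) ≤ b := by exact_mod_cast hb
      have hab' : -(a : ℝ) ≤ b := by exact_mod_cast hab
      have : b ≤ -c := int_le_of (by push_cast; nlinarith)
      omega
    · have hb' : (1 : ℝ) ≤ -b := by exact_mod_cast hb
      have hab' : (a : ℝ) ≤ -b := by exact_mod_cast hab
      have : -b ≤ c := int_le_of (by push_cast; nlinarith)
      omega
  · refine srs_inv hr (fun z => (1 ≤ z.2 ∧ 1 ≤ -z.1) ∨ (1 ≤ -z.2 ∧ 1 ≤ z.1)) ?_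
      (by simp) (-1, 1) (by simp)
    rintro a b c hab h1 h2
    simp only at hab h1 h2 ⊢
    rcases hab with ⟨hb, hab⟩ | ⟨hb, hab⟩
    · have hb' : (1 : ℝ) ≤ b := by exact_mod_cast hb
      have hab' : 1 ≤ -(a : ℝ) := by exact_mod_cast hab
      have : 1 ≤ -c := int_le_of (by push_cast; nlinarith)
      omega
    · have hb' : (1 : ℝ) ≤ -b := by exact_mod_cast hb
      have hab' : 1 ≤ (a : ℝ) := by exact_mod_cast hab
      have : 1 ≤ c := int_le_of (by push_cast; nlinarith)
      omega

/-- A cycle `(p,q) → (q,p) → (p,q)` avoiding the origin cannot exist. -/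
lemma two_cycle {x y ε : ℝ} (hr : (x, y) ∈ SRS2 ε) (p q : ℤ) (hpq : p ≠ 0 ∨ q ≠ 0)
    (h1 : 0 ≤ x * p + y * q + p + ε) (h2 : x * p + y * q + p + ε < 1)
    (h3 : 0 ≤ x * q + y * p + q + ε) (h4 : x * q + y * p + q + ε < 1) : False := by
  refine srs_inv hr (fun z => z = (p, q) ∨ z = (q, p)) ?_ ?_ (p, q) (Or.inl rfl)
  · rintro a b c hab g1 g2
    simp only [Prod.mk.injEq] at hab g1 g2 ⊢
    rcases hab with ⟨rfl, rfl⟩ | ⟨rfl, rfl⟩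
    · exact Or.inr ⟨rfl, int_eq_of (by linarith) (by linarith)⟩
    · exact Or.inl ⟨rfl, int_eq_of (by linarith) (by linarith)⟩
  · simp only [Prod.mk.injEq]
    omega

theorem stmt_7 (ε : ℝ) (hε0 : 0 ≤ ε) (hε1 : ε < 1) : SRS2 ε ⊆ Dset ε := by
  rintro ⟨x, y⟩ hr
  have hx1 : -1 < x := by
    by_contra h
    exact no_pre hε0 hε1 hr (Or.inr (not_lt.mp h))
  have hs : -1 < x + y := by
    by_contra h
    exact sum_big hε0 hε1 hr hx1 (not_lt.mp h)
  have hd : y - x < 1 := by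
    by_contra h
    exact diff_big hε0 hε1 hr hx1 (not_lt.mp h)
  simp only [Dset, Set.mem_setOf_eq]
  rcases lt_or_ge ε (1/2) with he | he
  · left
    have a1 : -x - ε ≤ y := by
      by_contra h
      push Not at h
      apply two_cycle hr 1 1 (by simp) <;> push_cast <;> linarith
    have a2 : y < x + 1 - ε := by
      by_contra h
      push Not at h
      apply two_cycle hr 1 (-1) (by simp) <;> push_cast <;> linarith
    refine ⟨he, a1, a2, ?_, ?_⟩
    · by_contra h
      push Not at h
      apply two_cycle hr 1 0 (by simp) <;> push_cast <;> linarith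
    · by_contra h
      push Not at h
      exact no_pre hε0 hε1 hr (Or.inl ⟨h, by linarith⟩)
  · right
    have a1 : -x - 1 + ε < y := by
      by_contra h
      push Not at h
      apply two_cycle hr (-1) (-1) (by simp) <;> push_cast <;> linarith
    have a2 : y ≤ x + ε := by
      by_contra h
      push Not at h
      apply two_cycle hr 1 (-1) (by simp) <;> push_cast <;> linarith
    refine ⟨he, a1, a2, ?_, ?_⟩
    · by_contra h
      push Not at h
      apply two_cycle hr (-1) 0 (by simp) <;> push_cast <;> linarith
    · by_contra h
      push Not at h
      exact no_pre hε0 hε1 hr (Or.inl ⟨by linarith, h⟩)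
end

section
/- Let ε ∈ (0,1/2) and let Δ₁ be the closed triangle in ℝ² with vertices A = (-1/2, 1/2-ε), B = (-ε, 0), C = (-ε, 1-2ε). Then Δ₁ ∩ D⁰_{2,ε} = {(-ε, y) ∈ ℝ² : 0 ≤ y < 1-2ε}. -/
lemma aux_step (ε y : ℝ) (h0 : 0 < ε) (hy : 0 ≤ y) (hy1 : y < 1 - 2*ε) (M : ℤ) (hM : 1 ≤ M)
    (a b : ℤ) (ha : -M ≤ a) (ha' : a ≤ M) (hb : -M ≤ b) (hb' : b ≤ M) :
    -(M-1) ≤ -⌊(-ε) * (a:ℝ) + y * (b:ℝ) + ε⌋ ∧ -⌊(-ε) * (a:ℝ) + y * (b:ℝ) + ε⌋ ≤ M := by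
  have h1 : (1:ℝ) ≤ M := by exact_mod_cast hM
  have h2 : -(M:ℝ) ≤ a := by exact_mod_cast ha
  have h3 : (a:ℝ) ≤ M := by exact_mod_cast ha'
  have h4 : -(M:ℝ) ≤ b := by exact_mod_cast hb
  have h5 : (b:ℝ) ≤ M := by exact_mod_cast hb'
  have e1 : ε * a ≤ ε * M := by gcongr
  have e2 : ε * (-M) ≤ ε * a := by gcongr
  have e3 : y * b ≤ y * M := by gcongr
  have e4 : y * (-M) ≤ y * b := by gcongr
  have e5 : 0 < (1 - 2*ε - y) * M := by apply mul_pos <;> linarith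
  have e6 : ε * 1 ≤ ε * M := by gcongr
  constructor
  · have : ⌊(-ε) * (a:ℝ) + y * (b:ℝ) + ε⌋ < M := by
      rw [Int.floor_lt]; linarith
    omega
  · have : -M ≤ ⌊(-ε) * (a:ℝ) + y * (b:ℝ) + ε⌋ := by
      rw [Int.le_floor]; push_cast; linarith
    omega

lemma aux_step2 (ε y : ℝ) (h0 : 0 < ε) (hy : 0 ≤ y) (hy1 : y < 1 - 2*ε) (M : ℤ) (hM : 1 ≤ M)
    (a b : ℤ) (ha' : a ≤ M) (hb : -(M-1) ≤ b) :
    -⌊(-ε) * (a:ℝ) + y * (b:ℝ) + ε⌋ ≤ M - 1 := by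
  have h1 : (1:ℝ) ≤ M := by exact_mod_cast hM
  have h3 : (a:ℝ) ≤ M := by exact_mod_cast ha'
  have h4 : -((M:ℝ)-1) ≤ b := by exact_mod_cast hb
  have e1 : ε * a ≤ ε * M := by gcongr
  have e4 : y * (-(M-1)) ≤ y * b := by gcongr
  have e5 : 0 ≤ (1 - 2*ε - y) * (M-1) := by apply mul_nonneg <;> linarith
  have e6 : ε * 1 ≤ ε * M := by gcongr
  have : -(M-1) ≤ ⌊(-ε) * (a:ℝ) + y * (b:ℝ) + ε⌋ := by
    rw [Int.le_floor]; push_cast; linarith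
  omega

lemma aux_reach (ε y : ℝ) (h0 : 0 < ε) (hy : 0 ≤ y) (hy1 : y < 1 - 2*ε) (n : ℕ) :
    ∀ a b : ℤ, -(n:ℤ) ≤ a → a ≤ n → -(n:ℤ) ≤ b → b ≤ n →
      ∃ k : ℕ, (tau2 (-ε, y) ε)^[k] (a, b) = (0, 0) := by
  induction n with
  | zero =>
    intro a b h1 h2 h3 h4
    refine ⟨0, ?_⟩
    simp only [Function.iterate_zero, id]
    ext <;> simp <;> omega
  | succ n ih =>
    intro a b h1 h2 h3 h4
    push_cast at h1 h2 h3 h4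
    have hM : (1:ℤ) ≤ n + 1 := by omega
    obtain ⟨c, hc⟩ : ∃ c, c = -⌊(-ε) * (a:ℝ) + y * (b:ℝ) + ε⌋ := ⟨_, rfl⟩
    obtain ⟨d, hd⟩ : ∃ d, d = -⌊(-ε) * (b:ℝ) + y * (c:ℝ) + ε⌋ := ⟨_, rfl⟩
    obtain ⟨e, he⟩ : ∃ e, e = -⌊(-ε) * (c:ℝ) + y * (d:ℝ) + ε⌋ := ⟨_, rfl⟩
    obtain ⟨f, hf⟩ : ∃ f, f = -⌊(-ε) * (d:ℝ) + y * (e:ℝ) + ε⌋ := ⟨_, rfl⟩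
    have s1 := aux_step ε y h0 hy hy1 (n+1) hM a b h1 h2 h3 h4
    rw [← hc] at s1
    have s2 := aux_step ε y h0 hy hy1 (n+1) hM b c h3 h4 (by omega) (by omega)
    rw [← hd] at s2
    have s3 := aux_step ε y h0 hy hy1 (n+1) hM c d (by omega) (by omega) (by omega) (by omega)
    have t3 := aux_step2 ε y h0 hy hy1 (n+1) hM c d (by omega) (by omega)
    rw [← he] at s3 t3
    have s4 := aux_step ε y h0 hy hy1 (n+1) hM d e (by omega) (by omega) (by omega) (by omega)
    have t4 := aux_step2 ε y h0 hy hy1 (n+1) hM d e (by omega) (by omega)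
    rw [← hf] at s4 t4
    obtain ⟨k, hk⟩ := ih e f (by omega) (by omega) (by omega) (by omega)
    refine ⟨k + 4, ?_⟩
    rw [Function.iterate_add_apply]
    have : (tau2 (-ε, y) ε)^[4] (a, b) = (e, f) := by
      simp only [Function.iterate_succ, Function.iterate_zero, Function.comp, id, tau2,
        ← hc, ← hd, ← he, ← hf]
    rw [this, hk]

lemma aux_cycle (r : ℝ × ℝ) (ε : ℝ) (p q : ℤ × ℤ) (hp : p ≠ (0,0)) (hq : q ≠ (0,0))
    (h1 : tau2 r ε p = q) (h2 : tau2 r ε q = p) : r ∉ SRS2 ε := by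
  intro h
  obtain ⟨k, hk⟩ := h p
  have : ∀ k : ℕ, (tau2 r ε)^[k] p = p ∨ (tau2 r ε)^[k] p = q := by
    intro k
    induction k with
    | zero => simp
    | succ k ih =>
      rw [Function.iterate_succ_apply']
      rcases ih with h | h <;> rw [h] <;> simp [h1, h2]
  rcases this k with h | h <;> rw [hk] at h
  · exact hp h.symm
  · exact hq h.symm

theorem stmt_8 (ε : ℝ) (hε0 : 0 < ε) (hε1 : ε < 1/2) :
    convexHull ℝ ({(-1/2, 1/2 - ε), (-ε, 0), (-ε, 1 - 2*ε)} : Set (ℝ × ℝ)) ∩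
        SRS2 ε =
      {q : ℝ × ℝ | q.1 = -ε ∧ 0 ≤ q.2 ∧ q.2 < 1 - 2*ε} := by
  ext ⟨x, y⟩
  simp only [Set.mem_inter_iff, Set.mem_ofPred_eq]
  constructor
  · rintro ⟨hc, hs⟩
    have hsub : convexHull ℝ ({(-1/2, 1/2 - ε), (-ε, 0), (-ε, 1 - 2*ε)} : Set (ℝ × ℝ)) ⊆
        {q : ℝ × ℝ | q.1 ≤ -ε ∧ -q.1 - ε ≤ q.2 ∧ q.2 ≤ q.1 + 1 - ε} := by
      apply convexHull_min
      · rintro q (rfl | rfl | rfl) <;> refine ⟨?_, ?_, ?_⟩ <;> simp <;> linarith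
      · rintro p ⟨p1, p2, p3⟩ q ⟨q1, q2, q3⟩ a b ha hb hab
        obtain rfl : b = 1 - a := by linarith
        refine ⟨?_, ?_, ?_⟩ <;> simp <;> nlinarith
    obtain ⟨h1, h2, h3⟩ := hsub hc
    simp only at h1 h2 h3
    have hx : x = -ε := by
      by_contra hne
      have hlt : x < -ε := lt_of_le_of_ne h1 hne
      refine aux_cycle (x, y) ε (1, 0) (0, 1) (by simp) (by simp) ?_ ?_ hs
      · have : ⌊x + ε⌋ = -1 := by
          rw [Int.floor_eq_iff]; push_cast; constructor <;> linarith
        simp [tau2, this]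
      · have : ⌊y + ε⌋ = 0 := by
          rw [Int.floor_eq_iff]; push_cast; constructor <;> linarith
        simp only [tau2]
        simp [this]
    subst hx
    refine ⟨rfl, by linarith, ?_⟩
    by_contra hge
    obtain rfl : y = 1 - 2*ε := by linarith
    refine aux_cycle (-ε, 1 - 2*ε) ε (1, -1) (-1, 1) (by simp) (by simp) ?_ ?_ hs
    · have : ⌊(-ε) * ((1:ℤ):ℝ) + (1 - 2*ε) * ((-1:ℤ):ℝ) + ε⌋ = -1 := by
        rw [Int.floor_eq_iff]; push_cast; constructor <;> linarith
      simp only [tau2, this]; rfl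
    · have : ⌊(-ε) * ((-1:ℤ):ℝ) + (1 - 2*ε) * ((1:ℤ):ℝ) + ε⌋ = 1 := by
        rw [Int.floor_eq_iff]; push_cast; constructor <;> linarith
      simp only [tau2, this]
  · rintro ⟨rfl, hy, hy1⟩
    constructor
    · have hseg : segment ℝ ((-ε, 0) : ℝ × ℝ) (-ε, 1 - 2*ε) ⊆
          convexHull ℝ ({(-1/2, 1/2 - ε), (-ε, 0), (-ε, 1 - 2*ε)} : Set (ℝ × ℝ)) :=
        (convex_convexHull ℝ _).segment_subset (subset_convexHull ℝ _ (by simp))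
          (subset_convexHull ℝ _ (by simp))
      apply hseg
      have hp : 0 < 1 - 2*ε := by linarith
      refine ⟨1 - y/(1-2*ε), y/(1-2*ε), ?_, by positivity, by ring, ?_⟩
      · rw [sub_nonneg, div_le_one hp]; exact hy1.le
      · ext
        · simp; ring
        · simp; field_simp
    · rintro ⟨a, b⟩
      refine aux_reach ε y hε0 hy hy1 (a.natAbs + b.natAbs) a b ?_ ?_ ?_ ?_ <;> omega
end

section
/- Let ε ∈ (0,1/2). Define the points B = (-ε,0), D = (2/3-ε,0), E = (1/3-ε,-1/3), F = (2/3-ε,-1/3), G = (1/2-ε,-1/2), H = (2/3-ε,-2/3), I = (2/3-ε,1/2-ε), K = (1/3-ε,1/2-ε), U = (1/2-ε, 3/4-(3/2)ε), J = (2/3-ε,1-2ε), L = (1/3-ε,1-2ε), N = (1/2-ε,1-2ε), O = (2/3-ε, 7/6-2ε), M = (1/6-ε,1-2ε), P = (2/3-ε, 4/3-2ε), R = (1/2-ε, 4/3-2ε), S = (2/3-ε, 3/2-2ε). Then each of the following convex hulls is contained in D⁰_{2,ε}: conv(B,D,F,E), conv(E,F,G), conv(G,F,H), conv(D,I,K),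 conv(I,K,U), conv(I,J,U), conv(J,K,L), conv(J,N,O), conv(M,N,O,P,R), and conv(P,R,S). -/
namespace Aux

def Reach (r : ℝ × ℝ) (ε : ℝ) (z : ℤ × ℤ) : Prop := ∃ k : ℕ, (tau2 r ε)^[k] z = (0, 0)

lemma reach_zero (r : ℝ × ℝ) (ε : ℝ) : Reach r ε (0, 0) := ⟨0, rfl⟩

lemma reach_step {r : ℝ × ℝ} {ε : ℝ} {z : ℤ × ℤ} (h : Reach r ε (tau2 r ε z)) :
    Reach r ε z := by
  obtain ⟨k, hk⟩ := h
  exact ⟨k + 1, by rw [Function.iterate_succ_apply]; exact hk⟩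

/-- One step splits additively up to rounding down or up. -/
lemma tau_add (r : ℝ × ℝ) (ε : ℝ) (z w : ℤ × ℤ) :
    tau2 r ε (z + w) = tau2 r ε z + (w.2, -⌊r.1 * w.1 + r.2 * w.2⌋) ∨
    tau2 r ε (z + w) = tau2 r ε z + (w.2, ⌊-(r.1 * w.1 + r.2 * w.2)⌋) := by
  have e : r.1 * ((z + w).1 : ℝ) + r.2 * ((z + w).2 : ℝ) + ε
      = (r.1 * z.1 + r.2 * z.2 + ε) + (r.1 * w.1 + r.2 * w.2) := by
    simp only [Prod.fst_add, Prod.snd_add]; push_cast; ring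
  simp only [tau2, e]
  generalize r.1 * (z.1 : ℝ) + r.2 * z.2 + ε = a
  generalize r.1 * (w.1 : ℝ) + r.2 * w.2 = b
  have h1 := Int.floor_le a
  have h2 := Int.lt_floor_add_one a
  have h3 := Int.floor_le b
  have h4 := Int.lt_floor_add_one b
  have h5 := Int.floor_le (a + b)
  have h6 := Int.lt_floor_add_one (a + b)
  have h7 := Int.floor_le (-b)
  have h8 := Int.lt_floor_add_one (-b)
  have k1 : ⌊a⌋ + ⌊b⌋ < ⌊a + b⌋ + 1 := by
    have : ((⌊a⌋ + ⌊b⌋ : ℤ) : ℝ) < ((⌊a + b⌋ + 1 : ℤ) : ℝ) := by push_cast; linarith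
    exact_mod_cast this
  have k2 : ⌊a + b⌋ < ⌊a⌋ + 1 - ⌊-b⌋ := by
    have : ((⌊a + b⌋ : ℤ) : ℝ) < ((⌊a⌋ + 1 - ⌊-b⌋ : ℤ) : ℝ) := by push_cast; linarith
    exact_mod_cast this
  have k3 : -⌊-b⌋ < ⌊b⌋ + 2 := by
    have : ((-⌊-b⌋ : ℤ) : ℝ) < ((⌊b⌋ + 2 : ℤ) : ℝ) := by push_cast; linarith
    exact_mod_cast this
  have k4 : ⌊b⌋ + ⌊-b⌋ < 1 := by
    have : ((⌊b⌋ + ⌊-b⌋ : ℤ) : ℝ) < ((1 : ℤ) : ℝ) := by push_cast; linarith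
    exact_mod_cast this
  by_cases h : ⌊a + b⌋ = ⌊a⌋ + ⌊b⌋
  · left; ext
    · simp
    · simp; omega
  · right; ext
    · simp
    · simp; omega

lemma iter_add {r : ℝ × ℝ} {ε : ℝ} {W : Set (ℤ × ℤ)}
    (h1 : ∀ w ∈ W, (w.2, -⌊r.1 * w.1 + r.2 * w.2⌋) ∈ W)
    (h2 : ∀ w ∈ W, (w.2, ⌊-(r.1 * w.1 + r.2 * w.2)⌋) ∈ W) (k : ℕ) :
    ∀ z, ∀ w ∈ W, ∃ w' ∈ W, (tau2 r ε)^[k] (z + w) = (tau2 r ε)^[k] z + w' := by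
  induction k with
  | zero => intro z w hw; exact ⟨w, hw, rfl⟩
  | succ k ih =>
    intro z w hw
    simp only [Function.iterate_succ_apply]
    rcases tau_add r ε z w with h | h <;> rw [h]
    · exact ih _ _ (h1 w hw)
    · exact ih _ _ (h2 w hw)

lemma brunotte {r : ℝ × ℝ} {ε : ℝ} {W : Set (ℤ × ℤ)}
    (h1 : ∀ w ∈ W, (w.2, -⌊r.1 * w.1 + r.2 * w.2⌋) ∈ W)
    (h2 : ∀ w ∈ W, (w.2, ⌊-(r.1 * w.1 + r.2 * w.2)⌋) ∈ W)
    (g1 : ((1, 0) : ℤ × ℤ) ∈ W) (g2 : ((-1, 0) : ℤ × ℤ) ∈ W)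
    (g3 : ((0, 1) : ℤ × ℤ) ∈ W) (g4 : ((0, -1) : ℤ × ℤ) ∈ W)
    (hW : ∀ w ∈ W, Reach r ε w) : r ∈ SRS2 ε := by
  have key : ∀ z, Reach r ε z → ∀ w ∈ W, Reach r ε (z + w) := by
    rintro z ⟨k, hk⟩ w hw
    obtain ⟨w', hw', e⟩ := iter_add (ε := ε) h1 h2 k z w hw
    obtain ⟨m, hm⟩ := hW w' hw'
    refine ⟨m + k, ?_⟩
    rw [Function.iterate_add_apply, e, hk]
    have : ((0, 0) : ℤ × ℤ) + w' = w' := by ext <;> simp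
    rw [this, hm]
  have col : ∀ a : ℤ, Reach r ε (a, 0) := by
    intro a
    induction a using Int.induction_on with
    | zero => exact reach_zero r ε
    | succ i ih => simpa using key _ ih _ g1
    | pred i ih => simpa [sub_eq_add_neg] using key _ ih _ g2
  rintro ⟨a, b⟩
  change Reach r ε (a, b)
  induction b using Int.induction_on with
  | zero => exact col a
  | succ i ih => simpa using key _ ih _ g3
  | pred i ih => simpa [sub_eq_add_neg] using key _ ih _ g4

/-! ### Vertex data (units `1/12`; values at `ε = 0` and `ε = 1/2`) -/

structure Vx where
  x0 : ℤ
  y0 : ℤ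
  x1 : ℤ
  y1 : ℤ

noncomputable def pt (ε : ℝ) (v : Vx) : ℝ × ℝ :=
  (((1 - 2 * ε) * v.x0 + 2 * ε * v.x1) / 12, ((1 - 2 * ε) * v.y0 + 2 * ε * v.y1) / 12)

def hullOf (ε : ℝ) (l : List Vx) : Set (ℝ × ℝ) := convexHull ℝ {p | ∃ v ∈ l, p = pt ε v}

def sup1 (a b c : ℤ) (v : Vx) : ℤ :=
  if a * v.x0 + b * v.y0 = a * v.x1 + b * v.y1 + 6 * c then (a * v.x0 + b * v.y0) / 12
  else (max (a * v.x0 + b * v.y0) (a * v.x1 + b * v.y1 + 6 * c) - 1) / 12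

def inf1 (a b c : ℤ) (v : Vx) : ℤ :=
  min (a * v.x0 + b * v.y0) (a * v.x1 + b * v.y1 + 6 * c) / 12

def hiB (l : List Vx) (a b c : ℤ) : ℤ := l.foldr (fun v m => max (sup1 a b c v) m) (-50)
def loB (l : List Vx) (a b c : ℤ) : ℤ := l.foldr (fun v m => min (inf1 a b c v) m) 50

lemma le_hiB (l : List Vx) (a b c : ℤ) : ∀ v ∈ l, sup1 a b c v ≤ hiB l a b c := by
  induction l with
  | nil => simp
  | cons u l ih =>
    intro v hv
    simp only [hiB, List.foldr_cons] at ih ⊢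
    rcases List.mem_cons.1 hv with rfl | h
    · exact le_max_left _ _
    · exact (ih v h).trans (le_max_right _ _)

lemma loB_le (l : List Vx) (a b c : ℤ) : ∀ v ∈ l, loB l a b c ≤ inf1 a b c v := by
  induction l with
  | nil => simp
  | cons u l ih =>
    intro v hv
    simp only [loB, List.foldr_cons] at ih ⊢
    rcases List.mem_cons.1 hv with rfl | h
    · exact min_le_left _ _
    · exact (min_le_right _ _).trans (ih v h)

lemma hull_lt {S : Set (ℝ × ℝ)} {a b c : ℝ} (h : ∀ p ∈ S, a * p.1 + b * p.2 < c) :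
    ∀ p ∈ convexHull ℝ S, a * p.1 + b * p.2 < c := by
  have hc : Convex ℝ {p : ℝ × ℝ | a * p.1 + b * p.2 < c} := by
    apply convex_halfSpace_lt
    constructor
    · intro x y; simp only [Prod.fst_add, Prod.snd_add]; ring
    · intro t x; simp only [Prod.smul_fst, Prod.smul_snd, smul_eq_mul]; ring
  exact fun p hp => convexHull_min h hc hp

lemma hull_le {S : Set (ℝ × ℝ)} {a b c : ℝ} (h : ∀ p ∈ S, a * p.1 + b * p.2 ≤ c) :
    ∀ p ∈ convexHull ℝ S, a * p.1 + b * p.2 ≤ c := by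
  have hc : Convex ℝ {p : ℝ × ℝ | a * p.1 + b * p.2 ≤ c} := by
    apply convex_halfSpace_le
    constructor
    · intro x y; simp only [Prod.fst_add, Prod.snd_add]; ring
    · intro t x; simp only [Prod.smul_fst, Prod.smul_snd, smul_eq_mul]; ring
  exact fun p hp => convexHull_min h hc hp

lemma floor_le_hi {ε : ℝ} (h0 : 0 < ε) (h1 : ε < 1 / 2) {l : List Vx} {r : ℝ × ℝ}
    (hr : r ∈ hullOf ε l) (a b c : ℤ) : ⌊r.1 * a + r.2 * b + ε * c⌋ ≤ hiB l a b c := by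
  have : (a : ℝ) * r.1 + b * r.2 < hiB l a b c + 1 - ε * c := by
    refine hull_lt ?_ r hr
    rintro p ⟨v, hv, rfl⟩
    have h := le_hiB l a b c v hv
    generalize hiB l a b c = m at h ⊢
    have e : (a : ℝ) * (pt ε v).1 + b * (pt ε v).2 + ε * c =
        ((1 - 2 * ε) * ((a * v.x0 + b * v.y0 : ℤ) : ℝ)
          + 2 * ε * ((a * v.x1 + b * v.y1 + 6 * c : ℤ) : ℝ)) / 12 := by
      simp only [pt]; push_cast; ring
    suffices ((1 - 2 * ε) * ((a * v.x0 + b * v.y0 : ℤ) : ℝ)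
          + 2 * ε * ((a * v.x1 + b * v.y1 + 6 * c : ℤ) : ℝ)) / 12 < m + 1 by linarith
    simp only [sup1] at h
    generalize a * v.x0 + b * v.y0 = f at h ⊢
    generalize a * v.x1 + b * v.y1 + 6 * c = g at h ⊢
    split_ifs at h with hfg
    · subst hfg
      have : f + 1 ≤ 12 * m + 12 := by omega
      have : (f : ℝ) + 1 ≤ 12 * m + 12 := by exact_mod_cast this
      linarith
    · have k1 : f ≤ 12 * m + 12 := by omega
      have k2 : g ≤ 12 * m + 12 := by omega
      have k3 : f + 1 ≤ 12 * m + 12 ∨ g + 1 ≤ 12 * m + 12 := by omega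
      have k1 : (f : ℝ) ≤ 12 * m + 12 := by exact_mod_cast k1
      have k2 : (g : ℝ) ≤ 12 * m + 12 := by exact_mod_cast k2
      have k3 : (f : ℝ) + 1 ≤ 12 * m + 12 ∨ (g : ℝ) + 1 ≤ 12 * m + 12 := by exact_mod_cast k3
      have e1 : 0 < 1 - 2 * ε := by linarith
      rcases k3 with k3 | k3 <;> nlinarith
  have h2 := Int.floor_le (r.1 * a + r.2 * b + ε * c)
  have : ((⌊r.1 * a + r.2 * b + ε * c⌋ : ℤ) : ℝ) < ((hiB l a b c + 1 : ℤ) : ℝ) := by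
    push_cast; linarith
  have := Int.cast_lt.1 this
  omega

lemma lo_le_floor {ε : ℝ} (h0 : 0 < ε) (h1 : ε < 1 / 2) {l : List Vx} {r : ℝ × ℝ}
    (hr : r ∈ hullOf ε l) (a b c : ℤ) : loB l a b c ≤ ⌊r.1 * a + r.2 * b + ε * c⌋ := by
  have : (-a : ℝ) * r.1 + (-b) * r.2 ≤ -(loB l a b c) + ε * c := by
    refine hull_le ?_ r hr
    rintro p ⟨v, hv, rfl⟩
    have h := loB_le l a b c v hv
    generalize loB l a b c = m at h ⊢
    have e : (a : ℝ) * (pt ε v).1 + b * (pt ε v).2 + ε * c =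
        ((1 - 2 * ε) * ((a * v.x0 + b * v.y0 : ℤ) : ℝ)
          + 2 * ε * ((a * v.x1 + b * v.y1 + 6 * c : ℤ) : ℝ)) / 12 := by
      simp only [pt]; push_cast; ring
    suffices (m : ℝ) ≤ ((1 - 2 * ε) * ((a * v.x0 + b * v.y0 : ℤ) : ℝ)
          + 2 * ε * ((a * v.x1 + b * v.y1 + 6 * c : ℤ) : ℝ)) / 12 by linarith
    simp only [inf1] at h
    generalize a * v.x0 + b * v.y0 = f at h ⊢
    generalize a * v.x1 + b * v.y1 + 6 * c = g at h ⊢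
    have k1 : 12 * m ≤ f := by omega
    have k2 : 12 * m ≤ g := by omega
    have k1 : 12 * (m : ℝ) ≤ f := by exact_mod_cast k1
    have k2 : 12 * (m : ℝ) ≤ g := by exact_mod_cast k2
    nlinarith
  rw [Int.le_floor]
  linarith

/-! ### Finite sets of lattice points as bit masks -/

def idx (a b : ℤ) : ℕ := ((a + 16) * 32 + (b + 16)).toNat

def dec (i : ℕ) : ℤ × ℤ := (((i / 32 : ℕ) : ℤ) - 16, ((i % 32 : ℕ) : ℤ) - 16)

def inbox (a b : ℤ) : Bool := decide (-16 ≤ a) && decide (a < 16) && decide (-16 ≤ b) && decide (b < 16)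

lemma dec_idx {a b : ℤ} (h : inbox a b = true) : dec (idx a b) = (a, b) := by
  simp only [inbox, Bool.and_eq_true, decide_eq_true_eq] at h
  simp only [dec, idx]
  ext <;> simp only <;> omega

/-- Evaluate `K` to a numeral before continuing. -/
def force {α : Type} (K : ℕ) (f : ℕ → α) : α :=
  match K with
  | 0 => f 0
  | n + 1 => f (n + 1)

lemma force_eq {α : Type} (K : ℕ) (f : ℕ → α) : force K f = f K := by cases K <;> rfl

/-- The mask of the interval `[st, st + n)`. -/
def seg (st n : ℕ) : ℕ := ((1 <<< n) - 1) <<< st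

lemma testBit_seg {st n j : ℕ} (h1 : st ≤ j) (h2 : j < st + n) : (seg st n).testBit j = true := by
  simp only [seg, Nat.testBit_shiftLeft, Nat.one_shiftLeft, Nat.testBit_two_pow_sub_one]
  simp; omega

lemma testBit_of_sub {K s j : ℕ} (h : K &&& s = s) (hj : s.testBit j = true) :
    K.testBit j = true := by
  rw [← h, Nat.testBit_and, Bool.and_eq_true] at hj
  exact hj.1

lemma testBit_ins {K i j : ℕ} (h : (K ||| (1 <<< i)).testBit j = true) :
    K.testBit j = true ∨ j = i := by
  rw [Nat.testBit_or, Bool.or_eq_true, Nat.one_shiftLeft, Nat.testBit_two_pow] at h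
  rcases h with h | h
  · exact Or.inl h
  · right; have : i = j := by simpa using h
    exact this.symm

/-- A point (encoded) with the interval of its possible successors. -/
structure Row where
  i : ℕ
  st : ℕ
  n : ℕ

/-- An edge between encoded points. -/
structure Ed where
  i : ℕ
  j : ℕ

def rmask (i : ℕ) : List Ed → ℕ
  | [] => 0
  | e :: rem => if e.i = i then rmask i rem ||| (1 <<< e.j) else rmask i rem

def step (rem : List Ed) (w : Row) (K : ℕ) : ℕ :=
  if (K ||| rmask w.i rem) &&& seg w.st w.n = seg w.st w.n then K ||| (1 <<< w.i) else K

def pass (rem : List Ed) : List Row → ℕ → ℕ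
  | [], K => K
  | w :: t, K => force (step rem w K) fun K' => pass rem t K'

def grow (rem : List Ed) (t : List Row) : ℕ → ℕ → ℕ
  | 0, K => K
  | n + 1, K => force (pass rem t K) fun K' => if K' = K then K else grow rem t n K'

def andAll : List ℕ → ℕ
  | [] => 0
  | [x] => x
  | x :: y :: L => x &&& andAll (y :: L)

lemma andAll_spec {L : List ℕ} {j : ℕ} (h : (andAll L).testBit j = true) :
    ∀ x ∈ L, x.testBit j = true := by
  induction L with
  | nil => simp
  | cons x L ih =>
    cases L with
    | nil => simpa [andAll] using h
    | cons y L =>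
      rw [andAll, Nat.testBit_and, Bool.and_eq_true] at h
      intro z hz
      rcases List.mem_cons.1 hz with rfl | hz
      · exact h.1
      · exact ih h.2 z hz

/-- In each list of edges at least one edge is not taken: intersect over all choices. -/
def stage (t : List Row) (n K : ℕ) : List (List Ed) → List Ed → ℕ
  | [], rem => grow rem t n K
  | p :: ps, rem => andAll (p.map fun e => stage t n K ps (e :: rem))

def stages (t : List Row) (n : ℕ) : List (List (List Ed)) → ℕ → ℕ
  | [], K => K
  | s :: ss, K => force (stage t n K s []) fun K' => stages t n ss K'

def mask : List Row → ℕ → ℕ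
  | [], K => K
  | w :: t, K => force (K ||| (1 <<< w.i)) fun K' => mask t K'

lemma mem_mask {t : List Row} : ∀ {K j : ℕ}, (mask t K).testBit j = true →
    K.testBit j = true ∨ ∃ w ∈ t, w.i = j := by
  induction t with
  | nil => intro K j h; exact Or.inl h
  | cons w t ih =>
    intro K j h
    rw [mask, force_eq] at h
    rcases ih h with h | ⟨v, hv, e⟩
    · rcases testBit_ins h with h | h
      · exact Or.inl h
      · exact Or.inr ⟨w, List.mem_cons_self, h.symm⟩
    · exact Or.inr ⟨v, List.mem_cons_of_mem _ hv, e⟩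

/-- The encoded points `(b,c)`, `lo ≤ c ≤ hi` all lie in the interval `[st, st + n)`. -/
def within (b lo hi : ℤ) (st n : ℕ) : Bool :=
  inbox b lo && inbox b hi && decide (st ≤ idx b lo) && decide (idx b hi < st + n)

lemma within_spec {b lo hi : ℤ} {st n : ℕ} (h : within b lo hi st n = true) {c : ℤ}
    (h1 : lo ≤ c) (h2 : c ≤ hi) : ∃ j, st ≤ j ∧ j < st + n ∧ dec j = (b, c) := by
  simp only [within, Bool.and_eq_true, decide_eq_true_eq] at h
  obtain ⟨⟨⟨k1, k2⟩, k3⟩, k4⟩ := h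
  simp only [inbox, Bool.and_eq_true, decide_eq_true_eq] at k1 k2
  refine ⟨idx b c, ?_, ?_, dec_idx ?_⟩
  · simp only [idx] at k3 ⊢; omega
  · simp only [idx] at k4 ⊢; omega
  · simp only [inbox, Bool.and_eq_true, decide_eq_true_eq]; omega

def inMask (M : ℕ) (b lo hi : ℤ) : Bool :=
  within b lo hi (idx b lo) ((hi - lo).toNat + 1) &&
    decide (M &&& seg (idx b lo) ((hi - lo).toNat + 1) = seg (idx b lo) ((hi - lo).toNat + 1))

lemma inMask_spec {M : ℕ} {b lo hi : ℤ} (h : inMask M b lo hi = true) {c : ℤ}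
    (h1 : lo ≤ c) (h2 : c ≤ hi) : ∃ j, M.testBit j = true ∧ dec j = (b, c) := by
  simp only [inMask, Bool.and_eq_true, decide_eq_true_eq] at h
  obtain ⟨j, k1, k2, k3⟩ := within_spec h.1 h1 h2
  exact ⟨j, testBit_of_sub h.2 (testBit_seg k1 k2), k3⟩

def rowOK (l : List Vx) (M : ℕ) (w : Row) : Bool :=
  within (dec w.i).2 (-hiB l (dec w.i).1 (dec w.i).2 1) (-loB l (dec w.i).1 (dec w.i).2 1) w.st w.n &&
  inMask M (dec w.i).2 (-hiB l (dec w.i).1 (dec w.i).2 0) (-loB l (dec w.i).1 (dec w.i).2 0) &&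
  inMask M (dec w.i).2 (loB l (-(dec w.i).1) (-(dec w.i).2) 0)
    (hiB l (-(dec w.i).1) (-(dec w.i).2) 0)

def check (l : List Vx) (t : List Row) (ss : List (List (List Ed))) : Bool :=
  force (mask t 0) fun M =>
    t.all (rowOK l M) && (M.testBit 560 && M.testBit 496 && M.testBit 529 && M.testBit 527) &&
    decide (stages t 60 ss (1 <<< 528) &&& M = M)

def Taken (r : ℝ × ℝ) (ε : ℝ) (e : Ed) : Prop :=
  ⌊r.1 * (dec e.i).1 + r.2 * (dec e.i).2 + ε⌋ = -(dec e.j).2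

def Good (r : ℝ × ℝ) (ε : ℝ) (K : ℕ) : Prop := ∀ j, K.testBit j = true → Reach r ε (dec j)

def RowsOK (r : ℝ × ℝ) (ε : ℝ) (t : List Row) : Prop :=
  ∀ w ∈ t, ∃ j, w.st ≤ j ∧ j < w.st + w.n ∧ dec j = tau2 r ε (dec w.i)

lemma mem_rmask {i : ℕ} {rem : List Ed} {j : ℕ} (h : (rmask i rem).testBit j = true) :
    ∃ e ∈ rem, e.i = i ∧ e.j = j := by
  induction rem with
  | nil => simp [rmask] at h
  | cons e rem ih =>
    rw [rmask] at h
    split_ifs at h with he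
    · rcases testBit_ins h with h | h
      · obtain ⟨e', h1, h2⟩ := ih h
        exact ⟨e', List.mem_cons_of_mem _ h1, h2⟩
      · exact ⟨e, List.mem_cons_self, he, h.symm⟩
    · obtain ⟨e', h1, h2⟩ := ih h
      exact ⟨e', List.mem_cons_of_mem _ h1, h2⟩

lemma good_pass {r : ℝ × ℝ} {ε : ℝ} {rem : List Ed} (hrem : ∀ e ∈ rem, ¬ Taken r ε e)
    {t : List Row} (ht : RowsOK r ε t) : ∀ {K : ℕ}, Good r ε K →
    Good r ε (pass rem t K) := by
  induction t with
  | nil => intro K hK; exact hK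
  | cons w t ih =>
    intro K hK
    rw [pass, force_eq]
    refine ih (fun v hv => ht v (List.mem_cons_of_mem _ hv)) ?_
    unfold step
    split_ifs with h
    · intro j hj
      rcases testBit_ins hj with hj | rfl
      · exact hK j hj
      · obtain ⟨m, h1, h2, h3⟩ := ht w List.mem_cons_self
        have h4 := testBit_of_sub h (testBit_seg h1 h2)
        rw [Nat.testBit_or, Bool.or_eq_true] at h4
        rcases h4 with h4 | h4
        · exact reach_step (h3 ▸ hK _ h4)
        · obtain ⟨e, he, e1, e2⟩ := mem_rmask h4
          refine absurd ?_ (hrem e he)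
          rw [Taken, e1, e2, h3]
          simp [tau2]
    · exact hK

lemma good_grow {r : ℝ × ℝ} {ε : ℝ} {rem : List Ed} (hrem : ∀ e ∈ rem, ¬ Taken r ε e)
    {t : List Row} (ht : RowsOK r ε t) (n : ℕ) : ∀ {K : ℕ}, Good r ε K →
    Good r ε (grow rem t n K) := by
  induction n with
  | zero => intro K hK; exact hK
  | succ n ih =>
    intro K hK
    rw [grow, force_eq]
    split_ifs
    · exact hK
    · exact ih (good_pass hrem ht hK)

lemma good_stage {r : ℝ × ℝ} {ε : ℝ} {t : List Row} (ht : RowsOK r ε t) (n : ℕ) {K : ℕ}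
    (hK : Good r ε K) (ps : List (List Ed)) :
    ∀ rem : List Ed, (∀ e ∈ rem, ¬ Taken r ε e) →
    (∀ p ∈ ps, ¬ ∀ e ∈ p, Taken r ε e) → Good r ε (stage t n K ps rem) := by
  induction ps with
  | nil => intro rem hrem _; exact good_grow hrem ht n hK
  | cons p ps ih =>
    intro rem hrem hps j hj
    rw [stage] at hj
    have hp := hps p List.mem_cons_self
    push Not at hp
    obtain ⟨e, he, hne⟩ := hp
    refine ih (e :: rem) ?_ (fun q hq => hps q (List.mem_cons_of_mem _ hq)) j
      (andAll_spec hj _ (List.mem_map_of_mem he))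
    intro e' he'
    rcases List.mem_cons.1 he' with rfl | he'
    · exact hne
    · exact hrem e' he'

lemma good_stages {r : ℝ × ℝ} {ε : ℝ} {t : List Row} (ht : RowsOK r ε t) (n : ℕ)
    (ss : List (List (List Ed))) : ∀ {K : ℕ}, Good r ε K →
    (∀ s ∈ ss, ∀ p ∈ s, ¬ ∀ e ∈ p, Taken r ε e) → Good r ε (stages t n ss K) := by
  induction ss with
  | nil => intro K hK _; exact hK
  | cons s ss ih =>
    intro K hK h
    rw [stages, force_eq]
    exact ih (good_stage ht n hK s [] (by simp) (h s List.mem_cons_self))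
      (fun s' hs' => h s' (List.mem_cons_of_mem _ hs'))

set_option exponentiation.threshold 600 in
theorem main {ε : ℝ} (h0 : 0 < ε) (h1 : ε < 1 / 2) (l : List Vx) (t : List Row)
    (ss : List (List (List Ed))) (hc : check l t ss = true) {r : ℝ × ℝ}
    (hr : r ∈ hullOf ε l)
    (hss : ∀ s ∈ ss, ∀ p ∈ s, ¬ ∀ e ∈ p, Taken r ε e) : r ∈ SRS2 ε := by
  rw [check, force_eq] at hc
  simp only [Bool.and_eq_true, decide_eq_true_eq, List.all_eq_true] at hc
  obtain ⟨⟨c1, ⟨⟨g1, g2⟩, g3⟩, g4⟩, c3⟩ := hc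
  have cl : ∀ j, (mask t 0).testBit j = true → ∃ w ∈ t, w.i = j := by
    intro j hj
    rcases mem_mask hj with h | h
    · simp at h
    · exact h
  have ht : RowsOK r ε t := by
    intro w hw
    have hw1 := c1 w hw
    simp only [rowOK, Bool.and_eq_true] at hw1
    have k1 := lo_le_floor h0 h1 hr (dec w.i).1 (dec w.i).2 1
    have k2 := floor_le_hi h0 h1 hr (dec w.i).1 (dec w.i).2 1
    simp only [Int.cast_one, mul_one] at k1 k2
    exact within_spec hw1.1.1 (neg_le_neg k2) (neg_le_neg k1)
  have hz : Good r ε (1 <<< 528) := by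
    intro j hj
    rw [Nat.one_shiftLeft, Nat.testBit_two_pow] at hj
    have : 528 = j := by simpa using hj
    subst this
    exact reach_zero r ε
  have hG := good_stages ht 60 ss hz hss
  refine brunotte (W := {z | ∃ j, (mask t 0).testBit j = true ∧ dec j = z}) ?_ ?_ ⟨_, g1, rfl⟩
    ⟨_, g2, rfl⟩ ⟨_, g3, rfl⟩ ⟨_, g4, rfl⟩ ?_
  · rintro _ ⟨j, hj, rfl⟩
    obtain ⟨w, hw, rfl⟩ := cl j hj
    have hw1 := c1 w hw
    simp only [rowOK, Bool.and_eq_true] at hw1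
    have k1 := lo_le_floor h0 h1 hr (dec w.i).1 (dec w.i).2 0
    have k2 := floor_le_hi h0 h1 hr (dec w.i).1 (dec w.i).2 0
    simp only [Int.cast_zero, mul_zero, add_zero] at k1 k2
    exact inMask_spec hw1.1.2 (neg_le_neg k2) (neg_le_neg k1)
  · rintro _ ⟨j, hj, rfl⟩
    obtain ⟨w, hw, rfl⟩ := cl j hj
    have hw1 := c1 w hw
    simp only [rowOK, Bool.and_eq_true] at hw1
    have k1 := lo_le_floor h0 h1 hr (-(dec w.i).1) (-(dec w.i).2) 0
    have k2 := floor_le_hi h0 h1 hr (-(dec w.i).1) (-(dec w.i).2) 0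
    have e : r.1 * ((-(dec w.i).1 : ℤ) : ℝ) + r.2 * ((-(dec w.i).2 : ℤ) : ℝ) + ε * ((0 : ℤ) : ℝ)
        = -(r.1 * (dec w.i).1 + r.2 * (dec w.i).2) := by push_cast; ring
    rw [e] at k1 k2
    exact inMask_spec hw1.2 k1 k2
  · rintro _ ⟨j, hj, rfl⟩
    exact hG j (testBit_of_sub c3 hj)

def l3 : List Vx := [⟨0, 0, -6, 0⟩, ⟨8, 0, 2, 0⟩, ⟨8, -4, 2, -4⟩, ⟨4, -4, -2, -4⟩]
def t3 : List Row := [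
  ⟨528, 528, 1⟩, ⟨560, 528, 1⟩, ⟨561, 560, 1⟩, ⟨529, 560, 2⟩, ⟨497, 560, 2⟩, ⟨496, 528, 2⟩,
  ⟨527, 496, 1⟩, ⟨495, 496, 2⟩, ⟨559, 495, 2⟩]
def s3 : List (List (List Ed)) := [[]]
lemma c3 : check l3 t3 s3 = true := by decide +kernel

def l4 : List Vx := [⟨4, -4, -2, -4⟩, ⟨8, -4, 2, -4⟩, ⟨6, -6, 0, -6⟩]
def t4 : List Row := [
  ⟨528, 528, 1⟩, ⟨560, 528, 1⟩, ⟨561, 560, 1⟩, ⟨529, 560, 2⟩, ⟨497, 560, 2⟩, ⟨496, 528, 2⟩,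
  ⟨527, 496, 1⟩, ⟨495, 496, 2⟩, ⟨559, 495, 2⟩]
def s4 : List (List (List Ed)) := [[]]
lemma c4 : check l4 t4 s4 = true := by decide +kernel

def l5 : List Vx := [⟨6, -6, 0, -6⟩, ⟨8, -4, 2, -4⟩, ⟨8, -8, 2, -8⟩]
def t5 : List Row := [
  ⟨528, 528, 1⟩, ⟨560, 528, 1⟩, ⟨561, 560, 1⟩, ⟨593, 560, 1⟩, ⟨529, 560, 2⟩, ⟨497, 561, 2⟩,
  ⟨496, 528, 2⟩, ⟨495, 496, 2⟩, ⟨559, 495, 1⟩, ⟨463, 496, 2⟩, ⟨591, 495, 1⟩, ⟨527, 495, 2⟩,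
  ⟨592, 527, 2⟩, ⟨562, 592, 2⟩, ⟨594, 592, 2⟩, ⟨530, 593, 2⟩, ⟨465, 561, 2⟩, ⟨464, 528, 3⟩,
  ⟨526, 463, 2⟩, ⟨494, 463, 2⟩, ⟨462, 463, 3⟩]
def s5 : List (List (List Ed)) := [[[⟨497, 562⟩, ⟨562, 592⟩]]]
lemma c5 : check l5 t5 s5 = true := by decide +kernel

def l6 : List Vx := [⟨8, 0, 2, 0⟩, ⟨8, 6, 2, 0⟩, ⟨4, 6, -2, 0⟩]
def t6 : List Row := [
  ⟨528, 528, 1⟩, ⟨560, 528, 1⟩, ⟨497, 560, 2⟩, ⟨529, 560, 1⟩, ⟨496, 528, 2⟩, ⟨527, 496, 2⟩,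
  ⟨559, 496, 2⟩, ⟨561, 559, 2⟩, ⟨592, 527, 2⟩, ⟨593, 559, 2⟩, ⟨624, 527, 2⟩, ⟨530, 592, 1⟩,
  ⟨432, 528, 3⟩, ⟨498, 592, 2⟩, ⟨464, 528, 3⟩, ⟨495, 496, 3⟩, ⟨463, 496, 3⟩, ⟨591, 495, 2⟩,
  ⟨623, 495, 2⟩, ⟨622, 463, 2⟩, ⟨562, 591, 2⟩, ⟨433, 560, 3⟩, ⟨465, 560, 3⟩, ⟨558, 464, 2⟩,
  ⟨590, 463, 3⟩, ⟨594, 590, 3⟩, ⟨625, 558, 3⟩, ⟨434, 592, 3⟩, ⟨626, 590, 3⟩, ⟨526, 464, 2⟩,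
  ⟨466, 592, 3⟩, ⟨499, 623, 3⟩, ⟨557, 432, 3⟩, ⟨467, 624, 3⟩, ⟨494, 464, 3⟩, ⟨431, 496, 4⟩,
  ⟨462, 464, 4⟩, ⟨430, 464, 4⟩, ⟨589, 431, 3⟩]
def s6 : List (List (List Ed)) := [[[⟨497, 561⟩, ⟨559, 497⟩]]]
lemma c6 : check l6 t6 s6 = true := by decide +kernel

def l7 : List Vx := [⟨8, 6, 2, 0⟩, ⟨4, 6, -2, 0⟩, ⟨6, 9, 0, 0⟩]
def t7 : List Row := [
  ⟨528, 528, 1⟩, ⟨560, 528, 1⟩, ⟨497, 560, 2⟩, ⟨529, 560, 1⟩, ⟨496, 528, 2⟩, ⟨527, 496, 2⟩,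
  ⟨559, 496, 2⟩, ⟨561, 559, 2⟩, ⟨592, 527, 2⟩, ⟨465, 560, 2⟩, ⟨498, 592, 1⟩, ⟨591, 496, 1⟩,
  ⟨593, 559, 2⟩, ⟨466, 592, 2⟩, ⟨495, 496, 3⟩, ⟨530, 591, 2⟩, ⟨463, 496, 3⟩, ⟨464, 528, 3⟩,
  ⟨526, 464, 3⟩, ⟨558, 464, 2⟩, ⟨590, 464, 2⟩]
def s7 : List (List (List Ed)) := [[[⟨497, 561⟩, ⟨559, 497⟩]]]
lemma c7 : check l7 t7 s7 = true := by decide +kernel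

def l8 : List Vx := [⟨8, 6, 2, 0⟩, ⟨8, 12, 2, 0⟩, ⟨6, 9, 0, 0⟩]
def t8 : List Row := [
  ⟨528, 528, 1⟩, ⟨560, 528, 1⟩, ⟨497, 560, 2⟩, ⟨529, 560, 1⟩, ⟨496, 528, 2⟩, ⟨527, 496, 2⟩,
  ⟨559, 496, 2⟩, ⟨561, 559, 2⟩, ⟨592, 527, 2⟩, ⟨465, 560, 2⟩, ⟨591, 496, 1⟩, ⟨624, 527, 2⟩,
  ⟨466, 592, 2⟩, ⟨530, 591, 2⟩, ⟨432, 528, 3⟩, ⟨498, 591, 2⟩, ⟨464, 528, 3⟩, ⟨495, 496, 3⟩,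
  ⟨526, 464, 3⟩, ⟨558, 464, 3⟩, ⟨593, 558, 3⟩, ⟨590, 464, 2⟩, ⟨623, 495, 2⟩, ⟨625, 558, 3⟩,
  ⟨434, 592, 2⟩, ⟨467, 623, 2⟩, ⟨435, 624, 2⟩, ⟨494, 464, 4⟩, ⟨562, 590, 3⟩, ⟨433, 560, 3⟩,
  ⟨499, 622, 3⟩, ⟨557, 432, 4⟩, ⟨589, 432, 3⟩, ⟨621, 432, 2⟩, ⟨463, 496, 4⟩, ⟨431, 496, 4⟩,
  ⟨622, 463, 2⟩]
def s8 : List (List (List Ed)) := [[[⟨497, 561⟩, ⟨559, 497⟩]], [[⟨499, 622⟩, ⟨622, 463⟩]], [[⟨466, 593⟩, ⟨558, 466⟩]]]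
lemma c8 : check l8 t8 s8 = true := by decide +kernel

def l9 : List Vx := [⟨8, 12, 2, 0⟩, ⟨4, 6, -2, 0⟩, ⟨4, 12, -2, 0⟩]
def t9 : List Row := [
  ⟨528, 528, 1⟩, ⟨560, 528, 1⟩, ⟨497, 560, 1⟩, ⟨529, 560, 1⟩, ⟨496, 528, 2⟩, ⟨527, 496, 2⟩,
  ⟨559, 496, 2⟩, ⟨561, 559, 2⟩, ⟨592, 527, 2⟩, ⟨465, 560, 2⟩, ⟨591, 496, 2⟩, ⟨624, 527, 2⟩,
  ⟨433, 560, 2⟩, ⟨466, 591, 2⟩, ⟨434, 591, 2⟩, ⟨530, 591, 2⟩, ⟨432, 528, 3⟩, ⟨498, 591, 2⟩,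
  ⟨621, 432, 3⟩, ⟨464, 528, 3⟩, ⟨495, 496, 3⟩, ⟨526, 464, 3⟩, ⟨558, 464, 3⟩, ⟨593, 558, 3⟩,
  ⟨590, 464, 3⟩, ⟨623, 495, 2⟩, ⟨625, 558, 3⟩, ⟨622, 464, 2⟩, ⟨435, 623, 2⟩, ⟨499, 622, 3⟩,
  ⟨557, 432, 4⟩, ⟨463, 496, 4⟩, ⟨431, 496, 4⟩]
def s9 : List (List (List Ed)) := [[]]
lemma c9 : check l9 t9 s9 = true := by decide +kernel

def l11 : List Vx := [⟨8, 12, 2, 0⟩, ⟨6, 12, 0, 0⟩, ⟨8, 14, 2, 2⟩]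
def t11 : List Row := [
  ⟨528, 528, 1⟩, ⟨560, 528, 1⟩, ⟨497, 560, 1⟩, ⟨529, 559, 2⟩, ⟨464, 528, 3⟩, ⟨496, 528, 2⟩,
  ⟨559, 496, 2⟩, ⟨561, 559, 2⟩, ⟨465, 560, 2⟩, ⟨591, 496, 1⟩, ⟨433, 560, 2⟩, ⟨590, 464, 2⟩,
  ⟨622, 464, 2⟩, ⟨498, 591, 2⟩, ⟨527, 496, 3⟩, ⟨495, 496, 3⟩, ⟨592, 527, 2⟩, ⟨562, 590, 3⟩,
  ⟨624, 527, 2⟩, ⟨466, 592, 1⟩, ⟨623, 495, 2⟩, ⟨401, 560, 3⟩, ⟨434, 592, 1⟩, ⟨467, 622, 3⟩,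
  ⟨655, 495, 2⟩, ⟨435, 623, 2⟩, ⟨526, 464, 4⟩, ⟨530, 590, 3⟩, ⟨432, 528, 3⟩, ⟨494, 464, 4⟩,
  ⟨558, 464, 3⟩, ⟨593, 558, 3⟩, ⟨499, 622, 3⟩, ⟨557, 432, 4⟩, ⟨625, 557, 4⟩, ⟨656, 526, 3⟩,
  ⟨589, 432, 4⟩, ⟨657, 557, 4⟩, ⟨402, 592, 2⟩, ⟨621, 432, 3⟩, ⟨403, 624, 2⟩, ⟨404, 655, 3⟩,
  ⟨463, 496, 4⟩, ⟨531, 621, 4⟩, ⟨400, 528, 4⟩, ⟨556, 400, 5⟩, ⟨654, 463, 2⟩, ⟨436, 654, 3⟩,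
  ⟨620, 400, 4⟩, ⟨525, 432, 5⟩, ⟨500, 653, 4⟩, ⟨431, 496, 5⟩, ⟨399, 496, 5⟩, ⟨653, 431, 3⟩,
  ⟨652, 399, 4⟩]
def s11 : List (List (List Ed)) := [[[⟨529, 559⟩, ⟨559, 496⟩]], [[⟨498, 592⟩, ⟨527, 498⟩]], [[⟨464, 530⟩, ⟨590, 464⟩]], [[⟨500, 653⟩, ⟨653, 431⟩]]]
lemma c11 : check l11 t11 s11 = true := by decide +kernel

def l12 : List Vx := [⟨2, 12, -4, 0⟩, ⟨6, 12, 0, 0⟩, ⟨8, 14, 2, 2⟩, ⟨8, 16, 2, 4⟩, ⟨6, 16, 0, 4⟩]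
def t12 : List Row := [
  ⟨528, 528, 1⟩, ⟨560, 528, 1⟩, ⟨497, 560, 1⟩, ⟨529, 559, 2⟩, ⟨496, 528, 2⟩, ⟨559, 496, 2⟩,
  ⟨561, 559, 2⟩, ⟨465, 559, 3⟩, ⟨591, 496, 2⟩, ⟨433, 559, 3⟩, ⟨466, 591, 2⟩, ⟨623, 496, 2⟩,
  ⟨498, 590, 3⟩, ⟨527, 496, 3⟩, ⟨495, 496, 3⟩, ⟨592, 527, 3⟩, ⟨624, 527, 3⟩, ⟨434, 591, 2⟩,
  ⟨655, 495, 3⟩, ⟨530, 590, 3⟩, ⟨432, 527, 4⟩, ⟨717, 432, 3⟩, ⟨464, 527, 4⟩, ⟨590, 464, 3⟩,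
  ⟨622, 464, 3⟩, ⟨435, 622, 3⟩, ⟨621, 432, 4⟩, ⟨654, 464, 3⟩, ⟨403, 622, 3⟩, ⟨653, 432, 4⟩,
  ⟨371, 622, 3⟩, ⟨685, 432, 4⟩, ⟨531, 621, 4⟩, ⟨400, 527, 5⟩, ⟨499, 621, 4⟩, ⟨467, 622, 3⟩,
  ⟨589, 432, 4⟩, ⟨526, 464, 4⟩, ⟨463, 495, 5⟩, ⟨558, 464, 4⟩, ⟨562, 589, 4⟩, ⟨593, 558, 4⟩,
  ⟨594, 589, 5⟩, ⟨656, 526, 4⟩, ⟨401, 559, 4⟩, ⟨402, 591, 3⟩, ⟨370, 590, 4⟩, ⟨436, 653, 4⟩,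
  ⟨686, 463, 4⟩, ⟨338, 590, 5⟩, ⟨404, 653, 4⟩, ⟨652, 400, 5⟩, ⟨718, 463, 4⟩, ⟨372, 653, 4⟩,
  ⟨684, 400, 5⟩, ⟨340, 654, 3⟩, ⟨716, 400, 4⟩, ⟨308, 654, 3⟩, ⟨748, 400, 4⟩, ⟨525, 432, 5⟩,
  ⟨532, 651, 6⟩, ⟨557, 432, 5⟩, ⟨625, 557, 5⟩, ⟨368, 526, 7⟩, ⟨500, 652, 5⟩, ⟨657, 557, 5⟩,
  ⟨688, 525, 6⟩, ⟨336, 526, 7⟩, ⟨468, 652, 5⟩, ⟨720, 525, 6⟩, ⟨620, 400, 5⟩, ⟨339, 622, 4⟩,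
  ⟨276, 653, 5⟩, ⟨494, 464, 5⟩, ⟨431, 495, 6⟩, ⟨462, 463, 6⟩, ⟨563, 620, 5⟩, ⟨399, 495, 6⟩,
  ⟨369, 558, 6⟩, ⟨687, 494, 5⟩, ⟨337, 558, 6⟩, ⟨719, 494, 5⟩, ⟨405, 684, 5⟩, ⟨750, 462, 5⟩,
  ⟨373, 684, 5⟩, ⟨683, 368, 6⟩, ⟨749, 431, 4⟩, ⟨782, 462, 6⟩, ⟨341, 685, 4⟩, ⟨715, 368, 5⟩,
  ⟨781, 431, 5⟩, ⟨309, 685, 4⟩, ⟨342, 716, 5⟩, ⟨714, 336, 6⟩, ⟨747, 368, 5⟩, ⟨780, 399, 5⟩,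
  ⟨277, 685, 4⟩, ⟨310, 716, 5⟩, ⟨746, 336, 6⟩, ⟨779, 368, 5⟩, ⟨812, 399, 5⟩, ⟨278, 716, 5⟩,
  ⟨778, 336, 6⟩, ⟨246, 716, 5⟩, ⟨810, 336, 6⟩, ⟨556, 400, 6⟩, ⟨588, 400, 6⟩, ⟨689, 556, 7⟩,
  ⟨469, 683, 6⟩, ⟨437, 683, 6⟩, ⟨470, 714, 7⟩, ⟨438, 714, 7⟩, ⟨651, 368, 6⟩, ⟨406, 715, 6⟩,
  ⟨650, 336, 7⟩, ⟨374, 715, 6⟩, ⟨682, 336, 7⟩, ⟨245, 685, 5⟩, ⟨493, 432, 6⟩, ⟨524, 400, 7⟩,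
  ⟨430, 463, 7⟩, ⟨461, 431, 8⟩, ⟨492, 400, 7⟩, ⟨533, 682, 7⟩, ⟨564, 651, 6⟩, ⟨626, 588, 6⟩,
  ⟨398, 463, 8⟩, ⟨429, 431, 8⟩, ⟨501, 682, 7⟩, ⟨596, 650, 8⟩, ⟨304, 526, 8⟩, ⟨587, 368, 7⟩,
  ⟨752, 524, 7⟩, ⟨305, 558, 7⟩, ⟨619, 368, 7⟩, ⟨751, 493, 6⟩, ⟨783, 492, 8⟩, ⟨307, 622, 5⟩,
  ⟨815, 492, 8⟩, ⟨275, 621, 6⟩, ⟨814, 461, 7⟩, ⟨375, 746, 7⟩, ⟨813, 430, 6⟩, ⟨343, 746, 7⟩,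
  ⟨311, 747, 6⟩, ⟨279, 747, 6⟩, ⟨247, 747, 6⟩, ⟨523, 368, 8⟩, ⟨595, 619, 7⟩, ⟨367, 494, 8⟩,
  ⟨555, 368, 8⟩, ⟨627, 619, 7⟩, ⟨658, 587, 7⟩, ⟨721, 555, 8⟩, ⟨586, 336, 8⟩, ⟨753, 555, 8⟩,
  ⟨784, 523, 9⟩, ⟨306, 590, 6⟩, ⟨618, 336, 8⟩, ⟨816, 523, 9⟩, ⟨274, 589, 7⟩, ⟨242, 589, 8⟩,
  ⟨243, 621, 7⟩, ⟨681, 304, 8⟩, ⟨244, 653, 6⟩, ⟨713, 304, 8⟩, ⟨745, 304, 7⟩, ⟨811, 367, 6⟩,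
  ⟨777, 304, 7⟩, ⟨280, 778, 7⟩, ⟨809, 304, 7⟩, ⟨248, 778, 7⟩, ⟨281, 809, 8⟩, ⟨249, 809, 8⟩,
  ⟨534, 713, 8⟩, ⟨565, 681, 8⟩, ⟨502, 713, 8⟩, ⟨272, 525, 10⟩, ⟨303, 494, 9⟩, ⟨240, 525, 10⟩,
  ⟨273, 557, 9⟩, ⟨241, 557, 9⟩, ⟨407, 745, 8⟩, ⟨680, 272, 10⟩, ⟨344, 777, 8⟩, ⟨712, 272, 9⟩,
  ⟨312, 777, 8⟩, ⟨744, 272, 9⟩, ⟨743, 240, 10⟩, ⟨776, 272, 8⟩, ⟨775, 240, 9⟩, ⟨808, 272, 8⟩,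
  ⟨807, 240, 9⟩, ⟨460, 399, 9⟩, ⟨522, 336, 9⟩, ⟨335, 494, 9⟩, ⟨554, 336, 9⟩, ⟨503, 744, 9⟩,
  ⟨271, 493, 11⟩, ⟨785, 554, 10⟩, ⟨649, 304, 9⟩, ⟨376, 776, 9⟩, ⟨313, 808, 9⟩, ⟨491, 368, 9⟩,
  ⟨553, 304, 10⟩]
def s12 : List (List (List Ed)) := [[[⟨529, 559⟩, ⟨559, 496⟩, ⟨496, 529⟩]], [[⟨498, 592⟩, ⟨527, 498⟩], [⟨530, 590⟩, ⟨590, 464⟩], [⟨466, 592⟩, ⟨590, 466⟩], [⟨498, 590⟩, ⟨590, 464⟩]], [[⟨532, 651⟩, ⟨651, 368⟩]]]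
lemma c12 : check l12 t12 s12 = true := by decide +kernel

def l13 : List Vx := [⟨8, 16, 2, 4⟩, ⟨6, 16, 0, 4⟩, ⟨8, 18, 2, 6⟩]
def t13 : List Row := [
  ⟨528, 528, 1⟩, ⟨496, 528, 2⟩, ⟨560, 528, 1⟩, ⟨497, 560, 1⟩, ⟨559, 496, 2⟩, ⟨465, 560, 1⟩,
  ⟨591, 496, 2⟩, ⟨466, 591, 2⟩, ⟨623, 496, 1⟩, ⟨529, 559, 2⟩, ⟨464, 528, 3⟩, ⟨558, 465, 3⟩,
  ⟨593, 558, 3⟩, ⟨590, 464, 3⟩, ⟨622, 464, 3⟩, ⟨435, 622, 2⟩, ⟨654, 464, 2⟩, ⟨686, 464, 2⟩,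
  ⟨530, 590, 2⟩, ⟨561, 558, 3⟩, ⟨432, 528, 3⟩, ⟨498, 590, 2⟩, ⟨433, 560, 2⟩, ⟨717, 432, 2⟩,
  ⟨749, 432, 2⟩, ⟨527, 496, 3⟩, ⟨592, 527, 2⟩, ⟨624, 527, 2⟩, ⟨434, 591, 2⟩, ⟨402, 591, 2⟩,
  ⟨621, 433, 3⟩, ⟨370, 591, 3⟩, ⟨403, 623, 2⟩, ⟨653, 432, 3⟩, ⟨371, 623, 2⟩, ⟨685, 432, 3⟩,
  ⟨339, 623, 2⟩, ⟨499, 621, 3⟩, ⟨467, 621, 3⟩, ⟨495, 496, 4⟩, ⟨526, 465, 3⟩, ⟨463, 496, 4⟩,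
  ⟨656, 526, 3⟩, ⟨655, 495, 2⟩, ⟨687, 495, 2⟩, ⟨436, 653, 3⟩, ⟨404, 653, 3⟩, ⟨718, 463, 3⟩,
  ⟨372, 654, 2⟩, ⟨750, 463, 3⟩, ⟨340, 654, 3⟩, ⟨308, 655, 2⟩, ⟨341, 685, 3⟩, ⟨276, 655, 2⟩,
  ⟨309, 685, 3⟩, ⟨557, 433, 4⟩, ⟨625, 557, 4⟩, ⟨589, 433, 4⟩, ⟨307, 623, 3⟩, ⟨562, 589, 3⟩,
  ⟨401, 560, 3⟩, ⟨369, 560, 3⟩, ⟨620, 401, 4⟩, ⟨652, 401, 4⟩, ⟨684, 401, 3⟩, ⟨373, 684, 4⟩,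
  ⟨683, 369, 5⟩, ⟨715, 369, 4⟩, ⟨747, 369, 4⟩, ⟨531, 620, 4⟩, ⟨400, 528, 4⟩, ⟨468, 652, 4⟩,
  ⟨437, 683, 5⟩, ⟨405, 684, 4⟩, ⟨651, 369, 5⟩, ⟨716, 400, 4⟩, ⟨748, 400, 3⟩, ⟨780, 400, 3⟩,
  ⟨494, 465, 4⟩, ⟨525, 433, 5⟩, ⟨532, 651, 5⟩, ⟨368, 528, 5⟩, ⟨500, 651, 5⟩, ⟨688, 525, 4⟩,
  ⟨336, 528, 5⟩, ⟨588, 401, 5⟩, ⟨720, 525, 4⟩, ⟨719, 494, 3⟩, ⟨374, 715, 5⟩, ⟨342, 716, 4⟩,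
  ⟨277, 686, 3⟩, ⟨310, 716, 4⟩, ⟨779, 368, 4⟩, ⟨278, 717, 3⟩, ⟨431, 496, 5⟩, ⟨594, 588, 4⟩,
  ⟨626, 588, 4⟩, ⟨338, 591, 4⟩, ⟨619, 369, 6⟩, ⟨306, 591, 4⟩, ⟨275, 623, 4⟩, ⟨781, 431, 3⟩,
  ⟨563, 619, 5⟩, ⟨595, 619, 5⟩, ⟨337, 560, 4⟩, ⟨274, 591, 5⟩, ⟨682, 337, 6⟩, ⟨714, 337, 5⟩,
  ⟨746, 337, 5⟩, ⟨778, 337, 4⟩, ⟨469, 682, 6⟩, ⟨438, 714, 5⟩, ⟨406, 714, 6⟩, ⟨462, 465, 5⟩,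
  ⟨493, 433, 6⟩, ⟨524, 401, 6⟩, ⟨430, 465, 5⟩, ⟨461, 433, 6⟩, ⟨556, 401, 6⟩, ⟨751, 493, 4⟩,
  ⟨783, 493, 4⟩, ⟨782, 462, 4⟩, ⟨343, 746, 6⟩, ⟨311, 747, 5⟩, ⟨279, 747, 5⟩, ⟨280, 778, 6⟩,
  ⟨618, 338, 6⟩, ⟨650, 337, 7⟩, ⟨744, 274, 7⟩, ⟨564, 650, 6⟩, ⟨305, 560, 5⟩, ⟨273, 560, 5⟩,
  ⟨713, 305, 7⟩, ⟨745, 305, 6⟩, ⟨777, 305, 6⟩, ⟨776, 273, 7⟩, ⟨407, 745, 6⟩, ⟨375, 745, 6⟩,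
  ⟨312, 777, 6⟩, ⟨492, 401, 7⟩, ⟨587, 369, 7⟩, ⟨649, 306, 7⟩, ⟨681, 306, 7⟩]
def s13 : List (List (List Ed)) := [[[⟨496, 529⟩, ⟨559, 496⟩]], [[⟨464, 530⟩, ⟨590, 464⟩], [⟨466, 592⟩, ⟨590, 466⟩]], [[⟨558, 467⟩, ⟨621, 433⟩]]]
lemma c13 : check l13 t13 s13 = true := by decide +kernel

lemma taken_bd {r : ℝ × ℝ} {ε : ℝ} {i j : ℕ} (h : Taken r ε ⟨i, j⟩) :
    -(((dec j).2 : ℤ) : ℝ) ≤ r.1 * (dec i).1 + r.2 * (dec i).2 + ε ∧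
    r.1 * (dec i).1 + r.2 * (dec i).2 + ε < -(((dec j).2 : ℤ) : ℝ) + 1 := by
  have := Int.floor_eq_iff.1 h
  push_cast at this
  exact this

lemma hull_mono {ε : ℝ} {S : Set (ℝ × ℝ)} {l : List Vx} (h : ∀ p ∈ S, ∃ v ∈ l, p = pt ε v)
    {r : ℝ × ℝ} (hr : r ∈ convexHull ℝ S) : r ∈ hullOf ε l :=
  convexHull_mono (fun p hp => h p hp) hr

end Aux

set_option linter.unusedTactic false
set_option linter.unreachableTactic false

open Aux in
theorem stmt_9 (ε : ℝ) (hε0 : 0 < ε) (hε1 : ε < 1/2) :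
    -- Δ₃ = conv(B, D, F, E)
    convexHull ℝ ({(-ε, 0), (2/3 - ε, 0), (2/3 - ε, -(1/3)), (1/3 - ε, -(1/3))} :
        Set (ℝ × ℝ)) ⊆ SRS2 ε ∧
    -- Δ₄ = conv(E, F, G)
    convexHull ℝ ({(1/3 - ε, -(1/3)), (2/3 - ε, -(1/3)), (1/2 - ε, -(1/2))} :
        Set (ℝ × ℝ)) ⊆ SRS2 ε ∧
    -- Δ₅ = conv(G, F, H)
    convexHull ℝ ({(1/2 - ε, -(1/2)), (2/3 - ε, -(1/3)), (2/3 - ε, -(2/3))} :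
        Set (ℝ × ℝ)) ⊆ SRS2 ε ∧
    -- Δ₆ = conv(D, I, K)
    convexHull ℝ ({(2/3 - ε, 0), (2/3 - ε, 1/2 - ε), (1/3 - ε, 1/2 - ε)} :
        Set (ℝ × ℝ)) ⊆ SRS2 ε ∧
    -- Δ₇ = conv(I, K, U)
    convexHull ℝ ({(2/3 - ε, 1/2 - ε), (1/3 - ε, 1/2 - ε),
        (1/2 - ε, 3/4 - 3/2 * ε)} : Set (ℝ × ℝ)) ⊆ SRS2 ε ∧
    -- Δ₈ = conv(I, J, U)
    convexHull ℝ ({(2/3 - ε, 1/2 - ε), (2/3 - ε, 1 - 2*ε),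
        (1/2 - ε, 3/4 - 3/2 * ε)} : Set (ℝ × ℝ)) ⊆ SRS2 ε ∧
    -- Δ₉ = conv(J, K, L)
    convexHull ℝ ({(2/3 - ε, 1 - 2*ε), (1/3 - ε, 1/2 - ε), (1/3 - ε, 1 - 2*ε)} :
        Set (ℝ × ℝ)) ⊆ SRS2 ε ∧
    -- Δ₁₁ = conv(J, N, O)
    convexHull ℝ ({(2/3 - ε, 1 - 2*ε), (1/2 - ε, 1 - 2*ε),
        (2/3 - ε, 7/6 - 2*ε)} : Set (ℝ × ℝ)) ⊆ SRS2 ε ∧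
    -- Δ₁₂ = conv(M, N, O, P, R)
    convexHull ℝ ({(1/6 - ε, 1 - 2*ε), (1/2 - ε, 1 - 2*ε), (2/3 - ε, 7/6 - 2*ε),
        (2/3 - ε, 4/3 - 2*ε), (1/2 - ε, 4/3 - 2*ε)} : Set (ℝ × ℝ)) ⊆ SRS2 ε ∧
    -- Δ₁₃ = conv(P, R, S)
    convexHull ℝ ({(2/3 - ε, 4/3 - 2*ε), (1/2 - ε, 4/3 - 2*ε),
        (2/3 - ε, 3/2 - 2*ε)} : Set (ℝ × ℝ)) ⊆ SRS2 ε := by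
  refine ⟨?_, ?_, ?_, ?_, ?_, ?_, ?_, ?_, ?_, ?_⟩
  · intro r hr
    refine main hε0 hε1 l3 t3 s3 c3 (hull_mono ?_ hr) ?_
    · simp only [Set.mem_insert_iff, Set.mem_singleton_iff]
      rintro p (rfl | rfl | rfl | rfl)
      · exact ⟨l3[0], by simp [l3], by simp [l3, pt]; first | (constructor <;> ring) | ring⟩
      · exact ⟨l3[1], by simp [l3], by simp [l3, pt]; first | (constructor <;> ring) | ring⟩
      · exact ⟨l3[2], by simp [l3], by simp [l3, pt]; first | (constructor <;> ring) | ring⟩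
      · exact ⟨l3[3], by simp [l3], by simp [l3, pt]; first | (constructor <;> ring) | ring⟩
    · simp [s3]
  · intro r hr
    refine main hε0 hε1 l4 t4 s4 c4 (hull_mono ?_ hr) ?_
    · simp only [Set.mem_insert_iff, Set.mem_singleton_iff]
      rintro p (rfl | rfl | rfl)
      · exact ⟨l4[0], by simp [l4], by simp [l4, pt]; first | (constructor <;> ring) | ring⟩
      · exact ⟨l4[1], by simp [l4], by simp [l4, pt]; first | (constructor <;> ring) | ring⟩
      · exact ⟨l4[2], by simp [l4], by simp [l4, pt]; first | (constructor <;> ring) | ring⟩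
    · simp [s4]
  · intro r hr
    have f_x : (1 : ℝ) * r.1 + (0) * r.2 ≤ 2 / 3 - ε := by
      refine hull_le ?_ r hr
      simp only [Set.mem_insert_iff, Set.mem_singleton_iff]
      rintro p (rfl | rfl | rfl) <;> dsimp only <;> linarith
    refine main hε0 hε1 l5 t5 s5 c5 (hull_mono ?_ hr) ?_
    · simp only [Set.mem_insert_iff, Set.mem_singleton_iff]
      rintro p (rfl | rfl | rfl)
      · exact ⟨l5[0], by simp [l5], by simp [l5, pt]; first | (constructor <;> ring) | ring⟩
      · exact ⟨l5[1], by simp [l5], by simp [l5, pt]; first | (constructor <;> ring) | ring⟩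
      · exact ⟨l5[2], by simp [l5], by simp [l5, pt]; first | (constructor <;> ring) | ring⟩
    · unfold s5
      simp only [List.forall_mem_cons (p := fun p : List Ed => ¬ ∀ e ∈ p, Taken r ε e),
        List.forall_mem_cons (p := fun s : List (List Ed) => ∀ p ∈ s, ¬ ∀ e ∈ p, Taken r ε e),
        List.not_mem_nil, false_imp_iff, implies_true, and_true]
      repeat' apply And.intro
      all_goals
        intro h
        have b1 := taken_bd (h _ (.head _))
        have b2 := taken_bd (h _ (.tail _ (.head _)))
        first
          | have b5 := taken_bd (h _ (.tail _ (.tail _ (.head _))))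
            norm_num [dec] at b1 b2 b5
            linarith [b1.1, b1.2, b2.1, b2.2, b5.1, b5.2]
          | norm_num [dec] at b1 b2
            linarith [b1.1, b1.2, b2.1, b2.2]
  · intro r hr
    have f_x : (1 : ℝ) * r.1 + (0) * r.2 ≤ 2 / 3 - ε := by
      refine hull_le ?_ r hr
      simp only [Set.mem_insert_iff, Set.mem_singleton_iff]
      rintro p (rfl | rfl | rfl) <;> dsimp only <;> linarith
    refine main hε0 hε1 l6 t6 s6 c6 (hull_mono ?_ hr) ?_
    · simp only [Set.mem_insert_iff, Set.mem_singleton_iff]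
      rintro p (rfl | rfl | rfl)
      · exact ⟨l6[0], by simp [l6], by simp [l6, pt]; first | (constructor <;> ring) | ring⟩
      · exact ⟨l6[1], by simp [l6], by simp [l6, pt]; first | (constructor <;> ring) | ring⟩
      · exact ⟨l6[2], by simp [l6], by simp [l6, pt]; first | (constructor <;> ring) | ring⟩
    · unfold s6
      simp only [List.forall_mem_cons (p := fun p : List Ed => ¬ ∀ e ∈ p, Taken r ε e),
        List.forall_mem_cons (p := fun s : List (List Ed) => ∀ p ∈ s, ¬ ∀ e ∈ p, Taken r ε e),
        List.not_mem_nil, false_imp_iff, implies_true, and_true]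
      repeat' apply And.intro
      all_goals
        intro h
        have b1 := taken_bd (h _ (.head _))
        have b2 := taken_bd (h _ (.tail _ (.head _)))
        first
          | have b5 := taken_bd (h _ (.tail _ (.tail _ (.head _))))
            norm_num [dec] at b1 b2 b5
            linarith [b1.1, b1.2, b2.1, b2.2, b5.1, b5.2]
          | norm_num [dec] at b1 b2
            linarith [b1.1, b1.2, b2.1, b2.2]
  · intro r hr
    have f_x : (1 : ℝ) * r.1 + (0) * r.2 ≤ 2 / 3 - ε := by
      refine hull_le ?_ r hr
      simp only [Set.mem_insert_iff, Set.mem_singleton_iff]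
      rintro p (rfl | rfl | rfl) <;> dsimp only <;> linarith
    refine main hε0 hε1 l7 t7 s7 c7 (hull_mono ?_ hr) ?_
    · simp only [Set.mem_insert_iff, Set.mem_singleton_iff]
      rintro p (rfl | rfl | rfl)
      · exact ⟨l7[0], by simp [l7], by simp [l7, pt]; first | (constructor <;> ring) | ring⟩
      · exact ⟨l7[1], by simp [l7], by simp [l7, pt]; first | (constructor <;> ring) | ring⟩
      · exact ⟨l7[2], by simp [l7], by simp [l7, pt]; first | (constructor <;> ring) | ring⟩
    · unfold s7
      simp only [List.forall_mem_cons (p := fun p : List Ed => ¬ ∀ e ∈ p, Taken r ε e),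
        List.forall_mem_cons (p := fun s : List (List Ed) => ∀ p ∈ s, ¬ ∀ e ∈ p, Taken r ε e),
        List.not_mem_nil, false_imp_iff, implies_true, and_true]
      repeat' apply And.intro
      all_goals
        intro h
        have b1 := taken_bd (h _ (.head _))
        have b2 := taken_bd (h _ (.tail _ (.head _)))
        first
          | have b5 := taken_bd (h _ (.tail _ (.tail _ (.head _))))
            norm_num [dec] at b1 b2 b5
            linarith [b1.1, b1.2, b2.1, b2.2, b5.1, b5.2]
          | norm_num [dec] at b1 b2
            linarith [b1.1, b1.2, b2.1, b2.2]
  · intro r hr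
    have f_x : (1 : ℝ) * r.1 + (0) * r.2 ≤ 2 / 3 - ε := by
      refine hull_le ?_ r hr
      simp only [Set.mem_insert_iff, Set.mem_singleton_iff]
      rintro p (rfl | rfl | rfl) <;> dsimp only <;> linarith
    refine main hε0 hε1 l8 t8 s8 c8 (hull_mono ?_ hr) ?_
    · simp only [Set.mem_insert_iff, Set.mem_singleton_iff]
      rintro p (rfl | rfl | rfl)
      · exact ⟨l8[0], by simp [l8], by simp [l8, pt]; first | (constructor <;> ring) | ring⟩
      · exact ⟨l8[1], by simp [l8], by simp [l8, pt]; first | (constructor <;> ring) | ring⟩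
      · exact ⟨l8[2], by simp [l8], by simp [l8, pt]; first | (constructor <;> ring) | ring⟩
    · unfold s8
      simp only [List.forall_mem_cons (p := fun p : List Ed => ¬ ∀ e ∈ p, Taken r ε e),
        List.forall_mem_cons (p := fun s : List (List Ed) => ∀ p ∈ s, ¬ ∀ e ∈ p, Taken r ε e),
        List.not_mem_nil, false_imp_iff, implies_true, and_true]
      repeat' apply And.intro
      all_goals
        intro h
        have b1 := taken_bd (h _ (.head _))
        have b2 := taken_bd (h _ (.tail _ (.head _)))
        first
          | have b5 := taken_bd (h _ (.tail _ (.tail _ (.head _))))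
            norm_num [dec] at b1 b2 b5
            linarith [b1.1, b1.2, b2.1, b2.2, b5.1, b5.2]
          | norm_num [dec] at b1 b2
            linarith [b1.1, b1.2, b2.1, b2.2]
  · intro r hr
    refine main hε0 hε1 l9 t9 s9 c9 (hull_mono ?_ hr) ?_
    · simp only [Set.mem_insert_iff, Set.mem_singleton_iff]
      rintro p (rfl | rfl | rfl)
      · exact ⟨l9[0], by simp [l9], by simp [l9, pt]; first | (constructor <;> ring) | ring⟩
      · exact ⟨l9[1], by simp [l9], by simp [l9, pt]; first | (constructor <;> ring) | ring⟩
      · exact ⟨l9[2], by simp [l9], by simp [l9, pt]; first | (constructor <;> ring) | ring⟩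
    · simp [s9]
  · intro r hr
    have f_x : (1 : ℝ) * r.1 + (0) * r.2 ≤ 2 / 3 - ε := by
      refine hull_le ?_ r hr
      simp only [Set.mem_insert_iff, Set.mem_singleton_iff]
      rintro p (rfl | rfl | rfl) <;> dsimp only <;> linarith
    have f_l1 : (0 : ℝ) * r.1 + (-1) * r.2 ≤ -(1 - 2 * ε) := by
      refine hull_le ?_ r hr
      simp only [Set.mem_insert_iff, Set.mem_singleton_iff]
      rintro p (rfl | rfl | rfl) <;> dsimp only <;> linarith
    have f_d1 : (-1 : ℝ) * r.1 + (1) * r.2 ≤ 1 / 2 - ε := by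
      refine hull_le ?_ r hr
      simp only [Set.mem_insert_iff, Set.mem_singleton_iff]
      rintro p (rfl | rfl | rfl) <;> dsimp only <;> linarith
    refine main hε0 hε1 l11 t11 s11 c11 (hull_mono ?_ hr) ?_
    · simp only [Set.mem_insert_iff, Set.mem_singleton_iff]
      rintro p (rfl | rfl | rfl)
      · exact ⟨l11[0], by simp [l11], by simp [l11, pt]; first | (constructor <;> ring) | ring⟩
      · exact ⟨l11[1], by simp [l11], by simp [l11, pt]; first | (constructor <;> ring) | ring⟩
      · exact ⟨l11[2], by simp [l11], by simp [l11, pt]; first | (constructor <;> ring) | ring⟩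
    · unfold s11
      simp only [List.forall_mem_cons (p := fun p : List Ed => ¬ ∀ e ∈ p, Taken r ε e),
        List.forall_mem_cons (p := fun s : List (List Ed) => ∀ p ∈ s, ¬ ∀ e ∈ p, Taken r ε e),
        List.not_mem_nil, false_imp_iff, implies_true, and_true]
      repeat' apply And.intro
      all_goals
        intro h
        have b1 := taken_bd (h _ (.head _))
        have b2 := taken_bd (h _ (.tail _ (.head _)))
        first
          | have b5 := taken_bd (h _ (.tail _ (.tail _ (.head _))))
            norm_num [dec] at b1 b2 b5
            linarith [b1.1, b1.2, b2.1, b2.2, b5.1, b5.2]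
          | norm_num [dec] at b1 b2
            linarith [b1.1, b1.2, b2.1, b2.2]
  · intro r hr
    have f_x : (1 : ℝ) * r.1 + (0) * r.2 ≤ 2 / 3 - ε := by
      refine hull_le ?_ r hr
      simp only [Set.mem_insert_iff, Set.mem_singleton_iff]
      rintro p (rfl | rfl | rfl | rfl | rfl) <;> dsimp only <;> linarith
    have f_l1 : (0 : ℝ) * r.1 + (-1) * r.2 ≤ -(1 - 2 * ε) := by
      refine hull_le ?_ r hr
      simp only [Set.mem_insert_iff, Set.mem_singleton_iff]
      rintro p (rfl | rfl | rfl | rfl | rfl) <;> dsimp only <;> linarith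
    have f_u1 : (0 : ℝ) * r.1 + (1) * r.2 ≤ 4 / 3 - 2 * ε := by
      refine hull_le ?_ r hr
      simp only [Set.mem_insert_iff, Set.mem_singleton_iff]
      rintro p (rfl | rfl | rfl | rfl | rfl) <;> dsimp only <;> linarith
    have f_d2 : (1 : ℝ) * r.1 + (-1) * r.2 ≤ -(1 / 2 - ε) := by
      refine hull_le ?_ r hr
      simp only [Set.mem_insert_iff, Set.mem_singleton_iff]
      rintro p (rfl | rfl | rfl | rfl | rfl) <;> dsimp only <;> linarith
    have f_e1 : (-1 : ℝ) * r.1 + (1) * r.2 ≤ 5 / 6 - ε := by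
      refine hull_le ?_ r hr
      simp only [Set.mem_insert_iff, Set.mem_singleton_iff]
      rintro p (rfl | rfl | rfl | rfl | rfl) <;> dsimp only <;> linarith
    refine main hε0 hε1 l12 t12 s12 c12 (hull_mono ?_ hr) ?_
    · simp only [Set.mem_insert_iff, Set.mem_singleton_iff]
      rintro p (rfl | rfl | rfl | rfl | rfl)
      · exact ⟨l12[0], by simp [l12], by simp [l12, pt]; first | (constructor <;> ring) | ring⟩
      · exact ⟨l12[1], by simp [l12], by simp [l12, pt]; first | (constructor <;> ring) | ring⟩
      · exact ⟨l12[2], by simp [l12], by simp [l12, pt]; first | (constructor <;> ring) | ring⟩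
      · exact ⟨l12[3], by simp [l12], by simp [l12, pt]; first | (constructor <;> ring) | ring⟩
      · exact ⟨l12[4], by simp [l12], by simp [l12, pt]; first | (constructor <;> ring) | ring⟩
    · unfold s12
      simp only [List.forall_mem_cons (p := fun p : List Ed => ¬ ∀ e ∈ p, Taken r ε e),
        List.forall_mem_cons (p := fun s : List (List Ed) => ∀ p ∈ s, ¬ ∀ e ∈ p, Taken r ε e),
        List.not_mem_nil, false_imp_iff, implies_true, and_true]
      repeat' apply And.intro
      all_goals
        intro h
        have b1 := taken_bd (h _ (.head _))
        have b2 := taken_bd (h _ (.tail _ (.head _)))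
        first
          | have b5 := taken_bd (h _ (.tail _ (.tail _ (.head _))))
            norm_num [dec] at b1 b2 b5
            linarith [b1.1, b1.2, b2.1, b2.2, b5.1, b5.2]
          | norm_num [dec] at b1 b2
            linarith [b1.1, b1.2, b2.1, b2.2]
  · intro r hr
    have f_x : (1 : ℝ) * r.1 + (0) * r.2 ≤ 2 / 3 - ε := by
      refine hull_le ?_ r hr
      simp only [Set.mem_insert_iff, Set.mem_singleton_iff]
      rintro p (rfl | rfl | rfl) <;> dsimp only <;> linarith
    have f_l2 : (0 : ℝ) * r.1 + (-1) * r.2 ≤ -(4 / 3 - 2 * ε) := by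
      refine hull_le ?_ r hr
      simp only [Set.mem_insert_iff, Set.mem_singleton_iff]
      rintro p (rfl | rfl | rfl) <;> dsimp only <;> linarith
    have f_e1 : (-1 : ℝ) * r.1 + (1) * r.2 ≤ 5 / 6 - ε := by
      refine hull_le ?_ r hr
      simp only [Set.mem_insert_iff, Set.mem_singleton_iff]
      rintro p (rfl | rfl | rfl) <;> dsimp only <;> linarith
    refine main hε0 hε1 l13 t13 s13 c13 (hull_mono ?_ hr) ?_
    · simp only [Set.mem_insert_iff, Set.mem_singleton_iff]
      rintro p (rfl | rfl | rfl)
      · exact ⟨l13[0], by simp [l13], by simp [l13, pt]; first | (constructor <;> ring) | ring⟩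
      · exact ⟨l13[1], by simp [l13], by simp [l13, pt]; first | (constructor <;> ring) | ring⟩
      · exact ⟨l13[2], by simp [l13], by simp [l13, pt]; first | (constructor <;> ring) | ring⟩
    · unfold s13
      simp only [List.forall_mem_cons (p := fun p : List Ed => ¬ ∀ e ∈ p, Taken r ε e),
        List.forall_mem_cons (p := fun s : List (List Ed) => ∀ p ∈ s, ¬ ∀ e ∈ p, Taken r ε e),
        List.not_mem_nil, false_imp_iff, implies_true, and_true]
      repeat' apply And.intro
      all_goals
        intro h
        have b1 := taken_bd (h _ (.head _))
        have b2 := taken_bd (h _ (.tail _ (.head _)))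
        first
          | have b5 := taken_bd (h _ (.tail _ (.tail _ (.head _))))
            norm_num [dec] at b1 b2 b5
            linarith [b1.1, b1.2, b2.1, b2.2, b5.1, b5.2]
          | norm_num [dec] at b1 b2
            linarith [b1.1, b1.2, b2.1, b2.2]
end

section
/- Let ε ∈ (0,1/2). Define the points B = (-ε,0), C = (-ε,1-2ε), D = (2/3-ε,0), K = (1/3-ε,1/2-ε), L = (1/3-ε,1-2ε). Let Δ₂ = conv(B,C,D) and Δ₁₀ = conv(C,K,L). Then Δ₂ ∩ D⁰_{2,ε} = Δ₂ \ {C} and Δ₁₀ ∩ D⁰_{2,ε} = Δ₁₀ \ {C}. -/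
/-- The recurrence satisfied by the orbit. -/
def Rec (x y ε : ℝ) (a : ℕ → ℤ) : Prop :=
  ∀ n, 0 ≤ x * a n + y * a (n+1) + a (n+2) + ε ∧ x * a n + y * a (n+1) + a (n+2) + ε < 1

lemma orbit_rec (x y ε : ℝ) (z : ℤ × ℤ) :
    ∃ a : ℕ → ℤ, Rec x y ε a ∧ ∀ n, (tau2 (x, y) ε)^[n] z = (a n, a (n+1)) := by
  refine ⟨fun n => ((tau2 (x, y) ε)^[n] z).1, ?_, ?_⟩
  · intro n
    simp only [Function.iterate_succ_apply']
    generalize (tau2 (x, y) ε)^[n] z = w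
    simp only [tau2]
    push_cast
    have h1 := Int.floor_le (x * (w.1:ℝ) + y * (w.2:ℝ) + ε)
    have h2 := Int.lt_floor_add_one (x * (w.1:ℝ) + y * (w.2:ℝ) + ε)
    constructor <;> linarith
  · intro n
    simp only [Function.iterate_succ_apply']
    simp [tau2]

lemma bounded_A {x y ε : ℝ} (h0 : 0 < ε) (h1 : ε < 1/2) (hx : -ε ≤ x) (hy0 : 0 ≤ y)
    (hy1 : y ≤ 1 - 2*ε) (hxy : x + y ≤ 1 - ε) {a : ℕ → ℤ} (ha : Rec x y ε a) :
    ∃ N : ℕ, ∀ n, |a n| ≤ N := by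
  refine ⟨(max |a 0| |a 1|).toNat, ?_⟩
  have hN : ((max |a 0| |a 1|).toNat : ℤ) = max |a 0| |a 1| :=
    Int.toNat_of_nonneg (le_max_of_le_left (abs_nonneg _))
  have i0 : |a 0| ≤ (max |a 0| |a 1|).toNat := by rw [hN]; exact le_max_left _ _
  have i1 : |a 1| ≤ (max |a 0| |a 1|).toNat := by rw [hN]; exact le_max_right _ _
  generalize (max |a 0| |a 1|).toNat = N at i0 i1
  have key : ∀ n, |a n| ≤ N ∧ |a (n+1)| ≤ N := by
    intro n
    induction n with
    | zero => exact ⟨i0, i1⟩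
    | succ n ih =>
      refine ⟨ih.2, ?_⟩
      obtain ⟨p, q⟩ := ih
      rw [abs_le] at p q
      obtain ⟨r1, r2⟩ := ha n
      have p1 : (-N : ℝ) ≤ a n := by exact_mod_cast p.1
      have p2 : (a n : ℝ) ≤ N := by exact_mod_cast p.2
      have q1 : (-N : ℝ) ≤ a (n+1) := by exact_mod_cast q.1
      have q2 : (a (n+1) : ℝ) ≤ N := by exact_mod_cast q.2
      have hN0 : (0:ℝ) ≤ N := Nat.cast_nonneg N
      have e1 : |x * a n + y * a (n+1)| ≤ N := by
        have : |x| + y ≤ 1 := by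
          rcases abs_cases x with h | h <;> linarith
        calc |x * a n + y * a (n+1)| ≤ |x * a n| + |y * a (n+1)| := abs_add_le _ _
          _ = |x| * |(a n:ℝ)| + y * |(a (n+1) : ℝ)| := by rw [abs_mul, abs_mul, abs_of_nonneg hy0]
          _ ≤ |x| * N + y * N := by
            gcongr
            · exact abs_le.2 ⟨p1, p2⟩
            · exact abs_le.2 ⟨q1, q2⟩
          _ ≤ N := by nlinarith
      rw [abs_le] at e1
      rw [abs_le]
      constructor
      · have : (-N - 1 : ℝ) < a (n+2) := by linarith
        have : (-N - 1 : ℤ) < a (n+2) := by exact_mod_cast this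
        show -(N:ℤ) ≤ a (n+2)
        omega
      · have : (a (n+2) : ℝ) < N + 1 := by linarith
        have : (a (n+2) : ℤ) < N + 1 := by exact_mod_cast this
        show a (n+2) ≤ (N:ℤ)
        omega
  exact fun n => (key n).1

lemma bounded_B {x y ε : ℝ} (h0 : 0 < ε) (h1 : ε < 1/2) (hx : 0 ≤ x) (hy0 : 0 ≤ y)
    (hy1 : y ≤ 1 - 2*ε) (hP : x ≤ y^2) {a : ℕ → ℤ} (ha : Rec x y ε a) :
    ∃ N : ℕ, ∀ n, |a n| ≤ N := by
  obtain ⟨N, i0, i1, i2⟩ : ∃ N : ℕ, |a 0| ≤ N ∧ |a 1| ≤ N ∧ |a 2| ≤ N := by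
    refine ⟨(a 0).natAbs + (a 1).natAbs + (a 2).natAbs, ?_, ?_, ?_⟩ <;> push_cast <;>
    linarith [abs_nonneg (a 0), abs_nonneg (a 1), abs_nonneg (a 2)]
  refine ⟨N, ?_⟩
  have key : ∀ n, |a n| ≤ N ∧ |a (n+1)| ≤ N ∧ |a (n+2)| ≤ N := by
    intro n
    induction n with
    | zero => exact ⟨i0, i1, i2⟩
    | succ n ih =>
      refine ⟨ih.2.1, ih.2.2, ?_⟩
      obtain ⟨p, q, -⟩ := ih
      rw [abs_le] at p q
      obtain ⟨r1, r2⟩ := ha n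
      obtain ⟨s1, s2⟩ := ha (n+1)
      have p1 : (-N : ℝ) ≤ a n := by exact_mod_cast p.1
      have p2 : (a n : ℝ) ≤ N := by exact_mod_cast p.2
      have q1 : (-N : ℝ) ≤ a (n+1) := by exact_mod_cast q.1
      have q2 : (a (n+1) : ℝ) ≤ N := by exact_mod_cast q.2
      have hN0 : (0:ℝ) ≤ N := Nat.cast_nonneg N
      have hQ : 0 ≤ x * y := mul_nonneg hx hy0
      have hc : (x*y + (y^2 - x)) * N ≤ N := by
        have : x*y + (y^2 - x) ≤ 1 := by nlinarith
        nlinarith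
      have A1 := mul_le_mul_of_nonneg_left p1 hQ
      have A2 := mul_le_mul_of_nonneg_left p2 hQ
      have B1 := mul_le_mul_of_nonneg_left q1 (sub_nonneg.2 hP)
      have B2 := mul_le_mul_of_nonneg_left q2 (sub_nonneg.2 hP)
      have C1 := mul_nonneg hy0 r1
      have C2 := mul_le_mul_of_nonneg_left r2.le hy0
      have E : y * ε ≤ ε := by nlinarith
      have E' : y * (1-ε) < 1 - ε := by nlinarith
      rw [abs_le]
      simp only [show n + 1 + 1 = n + 2 from rfl, show n + 1 + 2 = n + 3 from rfl] at *
      constructor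
      · have : (-N - 1 : ℝ) < a (n+3) := by nlinarith
        have : (-N - 1 : ℤ) < a (n+3) := by exact_mod_cast this
        omega
      · have : (a (n+3) : ℝ) < N + 1 := by nlinarith
        have : (a (n+3) : ℤ) < N + 1 := by exact_mod_cast this
        omega
  exact fun n => (key n).1

lemma descend_A {x y ε : ℝ} (h0 : 0 < ε) (h1 : ε < 1/2) (hx : -ε ≤ x) (hy0 : 0 ≤ y)
    (hy1 : y ≤ 1 - 2*ε) (hxy : x + y ≤ 1 - ε) {a : ℕ → ℤ} (ha : Rec x y ε a)
    (N : ℕ) (hN : 1 ≤ N) (n0 : ℕ) (hb : ∀ n ≥ n0, |a n| ≤ (N+1 : ℕ)) :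
    ∃ n1, ∀ n ≥ n1, |a n| ≤ N := by
  have hN' : (1:ℝ) ≤ N := by exact_mod_cast hN
  have L : ∀ n ≥ n0 + 2, -(N:ℤ) ≤ a n := by
    intro n hn
    obtain ⟨m, rfl⟩ : ∃ m, n = m + 2 := ⟨n - 2, by omega⟩
    by_contra hc
    have hc' : a (m+2) ≤ -(N+1) := by omega
    have hc2 : (a (m+2) : ℝ) ≤ -(N+1) := by exact_mod_cast hc'
    obtain ⟨r1, r2⟩ := ha m
    have p := abs_le.1 (hb m (by omega))
    have q := abs_le.1 (hb (m+1) (by omega))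
    have p1 : (-(N+1) : ℝ) ≤ a m := by exact_mod_cast p.1
    have p2 : (a m : ℝ) ≤ N+1 := by exact_mod_cast p.2
    have q2 : (a (m+1) : ℝ) ≤ N+1 := by exact_mod_cast q.2
    rcases le_total 0 x with hx0 | hx0 <;> nlinarith
  refine ⟨n0 + 4, fun n hn => abs_le.2 ⟨L n (by omega), ?_⟩⟩
  obtain ⟨m, rfl⟩ : ∃ m, n = m + 2 := ⟨n - 2, by omega⟩
  by_contra hc
  have hc' : ((N:ℤ)+1) ≤ a (m+2) := by omega
  have hc2 : ((N:ℝ)+1) ≤ a (m+2) := by exact_mod_cast hc'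
  obtain ⟨r1, r2⟩ := ha m
  have p := abs_le.1 (hb m (by omega))
  have p1 : (-N : ℝ) ≤ a m := by exact_mod_cast L m (by omega)
  have p2 : (a m : ℝ) ≤ N+1 := by exact_mod_cast p.2
  have q1 : (-N : ℝ) ≤ a (m+1) := by exact_mod_cast L (m+1) (by omega)
  rcases le_total 0 x with hx0 | hx0 <;> nlinarith

lemma descend_B {x y ε : ℝ} (h0 : 0 < ε) (h1 : ε < 1/2) (hx : 0 ≤ x) (hx1 : x ≤ 1/3) (hy0 : 0 ≤ y)
    (hy1 : y ≤ 1 - 2*ε) (hP : x ≤ y^2) {a : ℕ → ℤ} (ha : Rec x y ε a)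
    (N : ℕ) (hN : 1 ≤ N) (n0 : ℕ) (hb : ∀ n ≥ n0, |a n| ≤ (N+1 : ℕ)) :
    ∃ n1, ∀ n ≥ n1, |a n| ≤ N := by
  have hN' : (1:ℝ) ≤ N := by exact_mod_cast hN
  have hQ : 0 ≤ x * y := mul_nonneg hx hy0
  have hQ1 : x * y ≤ 1/3 := by nlinarith
  have E : y * ε ≤ ε := by nlinarith
  have E' : y * (1-ε) < 1 - ε := by nlinarith
  have hQN : x * y * (N+1) ≤ N := by nlinarith
  have L : ∀ n ≥ n0 + 3, -(N:ℤ) ≤ a n := by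
    intro n hn
    obtain ⟨m, rfl⟩ : ∃ m, n = m + 3 := ⟨n - 3, by omega⟩
    by_contra hc
    have hc' : a (m+3) ≤ -(N+1) := by omega
    have hc2 : (a (m+3) : ℝ) ≤ -(N+1) := by exact_mod_cast hc'
    obtain ⟨r1, r2⟩ := ha m
    obtain ⟨s1, s2⟩ := ha (m+1)
    simp only [show m + 1 + 1 = m + 2 from rfl, show m + 1 + 2 = m + 3 from rfl] at *
    have p := abs_le.1 (hb m (by omega))
    have q := abs_le.1 (hb (m+2) (by omega))
    have p1 : (-(N+1) : ℝ) ≤ a m := by exact_mod_cast p.1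
    have q2 : (a (m+2) : ℝ) ≤ N+1 := by exact_mod_cast q.2
    rcases le_total 0 (a (m+1) : ℝ) with hs | hs
    · have A1 := mul_le_mul_of_nonneg_left p1 hQ
      have B1 := mul_nonneg (sub_nonneg.2 hP) hs
      have C2 := mul_le_mul_of_nonneg_left r2.le hy0
      nlinarith
    · have := mul_nonneg hx (neg_nonneg.2 hs)
      have := mul_le_mul_of_nonneg_left q2 hy0
      nlinarith
  refine ⟨n0 + 6, fun n hn => abs_le.2 ⟨L n (by omega), ?_⟩⟩
  obtain ⟨m, rfl⟩ : ∃ m, n = m + 3 := ⟨n - 3, by omega⟩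
  by_contra hc
  have hc' : ((N:ℤ)+1) ≤ a (m+3) := by omega
  have hc2 : ((N:ℝ)+1) ≤ a (m+3) := by exact_mod_cast hc'
  obtain ⟨r1, r2⟩ := ha m
  obtain ⟨s1, s2⟩ := ha (m+1)
  simp only [show m + 1 + 1 = m + 2 from rfl, show m + 1 + 2 = m + 3 from rfl] at *
  have p := abs_le.1 (hb m (by omega))
  have p2 : (a m : ℝ) ≤ N+1 := by exact_mod_cast p.2
  have q1 : (-N : ℝ) ≤ a (m+2) := by exact_mod_cast L (m+2) (by omega)
  rcases le_total (a (m+1) : ℝ) 0 with hs | hs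
  · have A1 := mul_le_mul_of_nonneg_left p2 hQ
    have B1 := mul_nonneg (sub_nonneg.2 hP) (neg_nonneg.2 hs)
    have C2 := mul_nonneg hy0 r1
    nlinarith
  · have := mul_nonneg hx hs
    have := mul_le_mul_of_nonneg_left q1 hy0
    nlinarith

lemma eventually_small {a : ℕ → ℤ} (hB : ∃ N : ℕ, ∀ n, |a n| ≤ N)
    (hD : ∀ N : ℕ, 1 ≤ N → ∀ n0 : ℕ, (∀ n ≥ n0, |a n| ≤ (N+1 : ℕ)) →
      ∃ n1, ∀ n ≥ n1, |a n| ≤ N) : ∃ n1, ∀ n ≥ n1, |a n| ≤ 1 := by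
  obtain ⟨N, hN⟩ := hB
  have : ∀ N : ℕ, (∃ n0, ∀ n ≥ n0, |a n| ≤ (N+1 : ℕ)) → ∃ n1, ∀ n ≥ n1, |a n| ≤ 1 := by
    intro N
    induction N with
    | zero => intro h; simpa using h
    | succ N ih =>
      rintro ⟨n0, h⟩
      exact ih (hD (N+1) (by omega) n0 h)
  exact this N ⟨0, fun n _ => (hN n).trans (by push_cast; omega)⟩

lemma reach_step {r : ℝ × ℝ} {ε : ℝ} (p q : ℤ) (t : ℤ)
    (h1 : 0 ≤ r.1 * p + r.2 * q + t + ε) (h2 : r.1 * p + r.2 * q + t + ε < 1)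
    (h : ∃ k : ℕ, (tau2 r ε)^[k] (q, t) = (0, 0)) : ∃ k : ℕ, (tau2 r ε)^[k] (p, q) = (0, 0) := by
  obtain ⟨k, hk⟩ := h
  refine ⟨k+1, ?_⟩
  rw [Function.iterate_succ_apply]
  have : tau2 r ε (p, q) = (q, t) := by
    have : ⌊r.1 * (p:ℝ) + r.2 * (q:ℝ) + ε⌋ = -t := by
      rw [Int.floor_eq_iff]; push_cast; constructor <;> linarith
    simp [tau2, this]
  rw [this, hk]

lemma reach_small {x y ε : ℝ} (h0 : 0 < ε) (h1 : ε < 1/2) (hx : -ε ≤ x) (hx1 : x ≤ 2/3 - ε)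
    (hy0 : 0 ≤ y) (hy1 : y ≤ 1 - 2*ε) (hor : x + y ≤ 1 - ε ∨ x ≤ 1/3 - ε)
    (hC : (x, y) ≠ (-ε, 1 - 2*ε)) (p q : ℤ)
    (hp : |p| ≤ 1) (hq : |q| ≤ 1) : ∃ k : ℕ, (tau2 (x, y) ε)^[k] (p, q) = (0, 0) := by
  have hC' : y < 1 - 2*ε + (x + ε) := by
    by_contra hc
    apply hC
    ext <;> simp <;> linarith
  have z00 : ∃ k : ℕ, (tau2 (x, y) ε)^[k] (0, 0) = (0, 0) := ⟨0, rfl⟩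
  have z10 : ∃ k : ℕ, (tau2 (x, y) ε)^[k] (1, 0) = (0, 0) :=
    reach_step 1 0 0 (by norm_num; linarith) (by norm_num; linarith) z00
  have z01 : ∃ k : ℕ, (tau2 (x, y) ε)^[k] (0, 1) = (0, 0) :=
    reach_step 0 1 0 (by norm_num; linarith) (by norm_num; linarith) z10
  have zm0 : ∃ k : ℕ, (tau2 (x, y) ε)^[k] (-1, 0) = (0, 0) := by
    rcases lt_or_ge (-x + ε) 0 with h | h
    · exact reach_step (-1) 0 1 (by norm_num; linarith) (by norm_num; linarith) z01
    · exact reach_step (-1) 0 0 (by norm_num; linarith) (by norm_num; linarith) z00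
  have zm1 : ∃ k : ℕ, (tau2 (x, y) ε)^[k] (-1, 1) = (0, 0) := by
    rcases lt_or_ge (-x + y + ε) 0 with h | h
    · refine reach_step (-1) 1 1 (by norm_num; linarith) (by norm_num; linarith) ?_
      rcases lt_or_ge (x + y + ε) 1 with h | h
      · exact reach_step 1 1 0 (by norm_num; linarith) (by norm_num; linarith) z10
      · refine reach_step 1 1 (-1) (by norm_num; linarith) (by norm_num; linarith) ?_
        exact reach_step 1 (-1) 0 (by norm_num; linarith) (by norm_num; linarith) zm0
    · exact reach_step (-1) 1 0 (by norm_num; linarith) (by norm_num; linarith) z10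
  have z1m : ∃ k : ℕ, (tau2 (x, y) ε)^[k] (1, -1) = (0, 0) := by
    rcases lt_or_ge (x - y + ε) 0 with h | h
    · exact reach_step 1 (-1) 1 (by norm_num; linarith) (by norm_num; linarith) zm1
    · exact reach_step 1 (-1) 0 (by norm_num; linarith) (by norm_num; linarith) zm0
  have z11 : ∃ k : ℕ, (tau2 (x, y) ε)^[k] (1, 1) = (0, 0) := by
    rcases lt_or_ge (x + y + ε) 1 with h | h
    · exact reach_step 1 1 0 (by norm_num; linarith) (by norm_num; linarith) z10
    · exact reach_step 1 1 (-1) (by norm_num; linarith) (by norm_num; linarith) z1m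
  have z0m : ∃ k : ℕ, (tau2 (x, y) ε)^[k] (0, -1) = (0, 0) := by
    rcases lt_or_ge (- y + ε) 0 with h | h
    · exact reach_step 0 (-1) 1 (by norm_num; linarith) (by norm_num; linarith) zm1
    · exact reach_step 0 (-1) 0 (by norm_num; linarith) (by norm_num; linarith) zm0
  have zmm : ∃ k : ℕ, (tau2 (x, y) ε)^[k] (-1, -1) = (0, 0) := by
    rcases lt_or_ge (-x - y + ε) 0 with h | h
    · rcases lt_or_ge (-x - y + ε) (-1) with h' | h'
      · have h3 : x ≤ 1/3 - ε := hor.resolve_left (by intro h; linarith)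
        refine reach_step (-1) (-1) 2 (by norm_num; linarith) (by norm_num; linarith) ?_
        refine reach_step (-1) 2 (-1) (by norm_num; linarith) (by norm_num; linarith) ?_
        rcases lt_or_ge (2 * x - y + ε) 0 with h | h
        · exact reach_step 2 (-1) 1 (by norm_num; linarith) (by norm_num; linarith) zm1
        · exact reach_step 2 (-1) 0 (by norm_num; linarith) (by norm_num; linarith) zm0
      exact reach_step (-1) (-1) 1 (by norm_num; linarith) (by norm_num; linarith) zm1
    · exact reach_step (-1) (-1) 0 (by norm_num; linarith) (by norm_num; linarith) zm0
  rw [abs_le] at hp hq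
  obtain ⟨p1, p2⟩ := hp
  obtain ⟨q1, q2⟩ := hq
  interval_cases p <;> interval_cases q <;> assumption

lemma mem_SRS {x y ε : ℝ} (h0 : 0 < ε) (h1 : ε < 1/2) (hx : -ε ≤ x) (hx1 : x ≤ 2/3 - ε)
    (hy0 : 0 ≤ y) (hy1 : y ≤ 1 - 2*ε) (hor : x + y ≤ 1 - ε ∨ x ≤ 1/3 - ε)
    (hC : (x, y) ≠ (-ε, 1 - 2*ε)) : (x, y) ∈ SRS2 ε := by
  intro z
  obtain ⟨a, ha, hz⟩ := orbit_rec x y ε z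
  have hs : ∃ n1, ∀ n ≥ n1, |a n| ≤ 1 := by
    by_cases hxy : x + y ≤ 1 - ε
    · exact eventually_small (bounded_A h0 h1 hx hy0 hy1 hxy ha)
        (descend_A h0 h1 hx hy0 hy1 hxy ha)
    · have h3 : x ≤ 1/3 - ε := hor.resolve_left hxy
      have hx0 : 0 ≤ x := by linarith
      have hP : x ≤ y^2 := by nlinarith
      exact eventually_small (bounded_B h0 h1 hx0 hy0 hy1 hP ha)
        (descend_B h0 h1 hx0 (by linarith) hy0 hy1 hP ha)
  obtain ⟨n, hn⟩ := hs
  obtain ⟨k, hk⟩ := reach_small h0 h1 hx hx1 hy0 hy1 hor hC (a n) (a (n+1)) (hn n le_rfl)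
    (hn (n+1) (by omega))
  exact ⟨k + n, by rw [Function.iterate_add_apply, hz n, hk]⟩

lemma C_not_mem {ε : ℝ} (h0 : 0 < ε) (h1 : ε < 1/2) : ((-ε, 1 - 2*ε) : ℝ × ℝ) ∉ SRS2 ε := by
  intro h
  obtain ⟨k, hk⟩ := h (1, -1)
  have s1 : tau2 (-ε, 1 - 2*ε) ε (1, -1) = (-1, 1) := by
    have : ⌊(-ε) * ((1:ℤ):ℝ) + (1 - 2*ε) * ((-1:ℤ):ℝ) + ε⌋ = -1 := by
      rw [Int.floor_eq_iff]; push_cast; constructor <;> linarith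
    simp only [tau2, this]; rfl
  have s2 : tau2 (-ε, 1 - 2*ε) ε (-1, 1) = (1, -1) := by
    have : ⌊(-ε) * ((-1:ℤ):ℝ) + (1 - 2*ε) * ((1:ℤ):ℝ) + ε⌋ = 1 := by
      rw [Int.floor_eq_iff]; push_cast; constructor <;> linarith
    simp only [tau2, this]
  have key : ∀ k : ℕ, (tau2 (-ε, 1 - 2*ε) ε)^[k] (1, -1) = (1, -1) ∨
      (tau2 (-ε, 1 - 2*ε) ε)^[k] (1, -1) = (-1, 1) := by
    intro k
    induction k with
    | zero => left; rfl
    | succ k ih =>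
      rw [Function.iterate_succ_apply']
      rcases ih with h | h <;> rw [h]
      · right; exact s1
      · left; exact s2
  rcases key k with h | h <;> rw [hk] at h <;> simp at h

lemma final_aux {ε : ℝ} (h0 : 0 < ε) (h1 : ε < 1/2) (S : Set (ℝ × ℝ))
    (hS : ∀ p ∈ S, p ≠ (-ε, 1 - 2*ε) → p ∈ SRS2 ε) :
    S ∩ SRS2 ε = S \ {((-ε, 1 - 2*ε) : ℝ × ℝ)} := by
  ext p
  constructor
  · rintro ⟨hp, hq⟩
    refine ⟨hp, fun h => C_not_mem h0 h1 ?_⟩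
    rw [Set.mem_singleton_iff] at h
    rwa [← h]
  · rintro ⟨hp, hq⟩
    exact ⟨hp, hS p hp hq⟩

lemma hull_le {S : Set (ℝ × ℝ)} (α β c : ℝ) (h : ∀ p ∈ S, α * p.1 + β * p.2 ≤ c)
    (p : ℝ × ℝ) (hp : p ∈ convexHull ℝ S) : α * p.1 + β * p.2 ≤ c := by
  have hc : Convex ℝ {p : ℝ × ℝ | α * p.1 + β * p.2 ≤ c} := by
    intro u hu v hv s t hs ht hst
    simp only [Set.mem_ofPred_eq, Prod.fst_add, Prod.snd_add, Prod.smul_fst, Prod.smul_snd,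
      smul_eq_mul] at *
    have e1 := mul_le_mul_of_nonneg_left hu hs
    have e2 := mul_le_mul_of_nonneg_left hv ht
    have e3 : s * c + t * c = c := by rw [← add_mul, hst, one_mul]
    linarith
  exact convexHull_min (fun q hq => h q hq) hc hp

theorem stmt_10 (ε : ℝ) (hε0 : 0 < ε) (hε1 : ε < 1/2) :
    -- Δ₂ = conv(B, C, D),  C = (-ε, 1 - 2ε)
    (convexHull ℝ ({(-ε, 0), (-ε, 1 - 2*ε), (2/3 - ε, 0)} : Set (ℝ × ℝ)) ∩
        SRS2 ε =
      convexHull ℝ ({(-ε, 0), (-ε, 1 - 2*ε), (2/3 - ε, 0)} : Set (ℝ × ℝ)) \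
        {((-ε, 1 - 2*ε) : ℝ × ℝ)}) ∧
    -- Δ₁₀ = conv(C, K, L)
    (convexHull ℝ ({(-ε, 1 - 2*ε), (1/3 - ε, 1/2 - ε), (1/3 - ε, 1 - 2*ε)} :
        Set (ℝ × ℝ)) ∩ SRS2 ε =
      convexHull ℝ ({(-ε, 1 - 2*ε), (1/3 - ε, 1/2 - ε), (1/3 - ε, 1 - 2*ε)} :
        Set (ℝ × ℝ)) \ {((-ε, 1 - 2*ε) : ℝ × ℝ)}) := by
  have tri : ∀ (P Q R : ℝ × ℝ) (α β c : ℝ), α * P.1 + β * P.2 ≤ c → α * Q.1 + β * Q.2 ≤ c →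
      α * R.1 + β * R.2 ≤ c → ∀ p ∈ convexHull ℝ ({P, Q, R} : Set (ℝ × ℝ)),
      α * p.1 + β * p.2 ≤ c := by
    intro P Q R α β c hP hQ hR p hp
    refine hull_le α β c ?_ p hp
    rintro q (rfl | rfl | rfl) <;> assumption
  constructor
  · apply final_aux hε0 hε1
    rintro ⟨x, y⟩ hp hC
    have a1 := tri _ _ _ (-1) 0 ε (by norm_num) (by norm_num) (by norm_num) _ hp
    have a2 := tri _ _ _ 1 0 (2/3 - ε) (by norm_num) (by norm_num) (by norm_num) _ hp
    have a3 := tri _ _ _ 0 (-1) 0 (by norm_num) (by norm_num; linarith) (by norm_num) _ hp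
    have a4 := tri _ _ _ 0 1 (1 - 2*ε) (by norm_num; linarith) (by norm_num)
      (by norm_num; linarith) _ hp
    have a5 := tri _ _ _ 1 1 (1 - ε) (by norm_num) (by norm_num; linarith)
      (by norm_num) _ hp
    simp only at a1 a2 a3 a4 a5
    exact mem_SRS hε0 hε1 (by linarith) (by linarith) (by linarith) (by linarith)
      (Or.inl (by linarith)) hC
  · apply final_aux hε0 hε1
    rintro ⟨x, y⟩ hp hC
    have a1 := tri _ _ _ (-1) 0 ε (by norm_num) (by norm_num) (by norm_num) _ hp
    have a2 := tri _ _ _ 1 0 (1/3 - ε) (by norm_num) (by norm_num) (by norm_num) _ hp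
    have a3 := tri _ _ _ 0 (-1) 0 (by norm_num; linarith) (by norm_num; linarith)
      (by norm_num; linarith) _ hp
    have a4 := tri _ _ _ 0 1 (1 - 2*ε) (by norm_num) (by norm_num; linarith)
      (by norm_num) _ hp
    simp only at a1 a2 a3 a4
    exact mem_SRS hε0 hε1 (by linarith) (by linarith) (by linarith) (by linarith)
      (Or.inr (by linarith)) hC
end

section
/- Let ε ∈ (0,1/2). Define the points C = (-ε,1-2ε), M = (1/6-ε,1-2ε), S = (2/3-ε, 3/2-2ε), Z = (2/3-ε, 5/3-2ε), and let Δ₁₄ = conv(C,M,S,Z). Then Δ₁₄ ∩ D⁰_{2,ε} = Δ₁₄ \ F₂, where F₂ = {(x,y) ∈ ℝ² : -ε ≤ x ≤ 2/3-ε and y = x+1-ε} is the closed segment from C to Z. -/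
structure PP (x y ε : ℝ) : Prop where
  e0 : 0 < ε
  e1 : ε < 1/2
  x0 : -ε ≤ x
  x1 : x ≤ 2/3 - ε
  y0 : 1 - 2*ε ≤ y
  y1 : x + 5/6 - ε ≤ y
  y2 : y < x + 1 - ε

def RR (x y ε : ℝ) (a b : ℤ) : Prop := ∃ k : ℕ, (tau2 (x, y) ε)^[k] (a, b) = (0, 0)

theorem RR_zero (x y ε : ℝ) : RR x y ε 0 0 := ⟨0, rfl⟩

theorem RR_step {x y ε : ℝ} {a b : ℤ}
    (h : ∀ c : ℤ, 0 ≤ x * a + y * b + ε + c → x * a + y * b + ε + c < 1 → RR x y ε b c) :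
    RR x y ε a b := by
  have h1 := Int.floor_le (x * a + y * b + ε)
  have h2 := Int.lt_floor_add_one (x * a + y * b + ε)
  obtain ⟨k, hk⟩ := h (-⌊x * a + y * b + ε⌋) (by push_cast; linarith) (by push_cast; linarith)
  exact ⟨k + 1, by rw [Function.iterate_succ_apply]; exact hk⟩

noncomputable def hh (x g : ℝ) : ℝ := if 1/2 < x then max x (2*x-1+2*g) else max x 0

theorem hh_spec (x g : ℝ) : x ≤ hh x g ∧ 0 ≤ hh x g ∧ (1/2 < x → 2*x-1+2*g ≤ hh x g) ∧
    (hh x g = x ∨ hh x g = 0 ∨ (1/2 < x ∧ hh x g = 2*x-1+2*g)) := by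
  unfold hh
  split_ifs with h
  · refine ⟨le_max_left _ _, le_trans (by linarith) (le_max_left _ _), fun _ => le_max_right _ _, ?_⟩
    rcases max_choice x (2*x-1+2*g) with h' | h'
    · exact Or.inl h'
    · exact Or.inr (Or.inr ⟨h, h'⟩)
  · refine ⟨le_max_left _ _, le_max_right _ _, fun h' => absurd h' h, ?_⟩
    rcases max_choice x 0 with h' | h'
    · exact Or.inl h'
    · exact Or.inr (Or.inl h')

/-- the closed set of witnesses; `g = 1 + x - y`, `q = g a`. -/
def VV (x g q : ℝ) (s : ℤ) : Prop :=
  (s = 0 ∧ -(hh x g + g) ≤ q ∧ q ≤ hh x g + g) ∨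
  (s = -1 ∧ -(hh x g + g) ≤ q ∧ q ≤ hh x g) ∨
  (s = 1 ∧ -(hh x g) ≤ q ∧ q ≤ hh x g + g) ∨
  (s = -2 ∧ 1/2 < x ∧ -(hh x g) ≤ q ∧ q ≤ 2*x-1) ∨
  (s = 2 ∧ 1/2 < x ∧ -(2*x-1) ≤ q ∧ q ≤ hh x g)

theorem VV_closed {x y ε q Q : ℝ} (hP : PP x y ε) {s t : ℤ} (hV : VV x (1+x-y) q s)
    (hQ : Q = (1+x-y) * s - q) (h1 : -1 < t + x * s - Q) (h2 : t + x * s - Q < 1) :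
    VV x (1+x-y) Q t := by
  obtain ⟨e0, e1, x0, x1, y0, y1, y2⟩ := hP
  unfold VV at *
  obtain ⟨hm1, hm2, hm3, hm4⟩ := hh_spec x (1+x-y)
  generalize hh x (1+x-y) = h at *
  obtain ⟨T, hT⟩ : ∃ T : ℝ, T = t := ⟨_, rfl⟩
  rw [← hT] at h1 h2
  have key : -3 < T ∧ T < 3 := by
    rcases hV with ⟨rfl, ha, hb⟩ | ⟨rfl, ha, hb⟩ | ⟨rfl, ha, hb⟩ | ⟨rfl, hx, ha, hb⟩ |
      ⟨rfl, hx, ha, hb⟩ <;>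
    push_cast at hQ h1 h2 <;>
    (try have hm3 := hm3 hx) <;>
    rcases hm4 with hm4 | hm4 | ⟨hm4, hm5⟩ <;> (try have hm3 := hm3 hm4) <;> constructor <;> linarith
  have k1 : -3 < t := by rw [hT] at key; exact_mod_cast key.1
  have k2 : t < 3 := by rw [hT] at key; exact_mod_cast key.2
  clear key
  rcases (by omega : t = -2 ∨ t = -1 ∨ t = 0 ∨ t = 1 ∨ t = 2) with rfl | rfl | rfl | rfl | rfl <;>
    push_cast at hT <;> subst hT
  · right; right; right; left
    refine ⟨rfl, ?_, ?_, ?_⟩ <;>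
    rcases hV with ⟨rfl, ha, hb⟩ | ⟨rfl, ha, hb⟩ | ⟨rfl, ha, hb⟩ | ⟨rfl, hx, ha, hb⟩ |
      ⟨rfl, hx, ha, hb⟩ <;>
    push_cast at hQ h1 h2 <;>
    (try have hm3 := hm3 hx) <;>
    rcases hm4 with hm4 | hm4 | ⟨hm4, hm5⟩ <;> (try have hm3 := hm3 hm4) <;> linarith
  · right; left
    refine ⟨rfl, ?_, ?_⟩ <;>
    rcases hV with ⟨rfl, ha, hb⟩ | ⟨rfl, ha, hb⟩ | ⟨rfl, ha, hb⟩ | ⟨rfl, hx, ha, hb⟩ |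
      ⟨rfl, hx, ha, hb⟩ <;>
    push_cast at hQ h1 h2 <;>
    (try have hm3 := hm3 hx) <;>
    rcases hm4 with hm4 | hm4 | ⟨hm4, hm5⟩ <;> (try have hm3 := hm3 hm4) <;> linarith
  · left
    refine ⟨rfl, ?_, ?_⟩ <;>
    rcases hV with ⟨rfl, ha, hb⟩ | ⟨rfl, ha, hb⟩ | ⟨rfl, ha, hb⟩ | ⟨rfl, hx, ha, hb⟩ |
      ⟨rfl, hx, ha, hb⟩ <;>
    push_cast at hQ h1 h2 <;>
    (try have hm3 := hm3 hx) <;>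
    rcases hm4 with hm4 | hm4 | ⟨hm4, hm5⟩ <;> (try have hm3 := hm3 hm4) <;> linarith
  · right; right; left
    refine ⟨rfl, ?_, ?_⟩ <;>
    rcases hV with ⟨rfl, ha, hb⟩ | ⟨rfl, ha, hb⟩ | ⟨rfl, ha, hb⟩ | ⟨rfl, hx, ha, hb⟩ |
      ⟨rfl, hx, ha, hb⟩ <;>
    push_cast at hQ h1 h2 <;>
    (try have hm3 := hm3 hx) <;>
    rcases hm4 with hm4 | hm4 | ⟨hm4, hm5⟩ <;> (try have hm3 := hm3 hm4) <;> linarith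
  · right; right; right; right
    refine ⟨rfl, ?_, ?_, ?_⟩ <;>
    rcases hV with ⟨rfl, ha, hb⟩ | ⟨rfl, ha, hb⟩ | ⟨rfl, ha, hb⟩ | ⟨rfl, hx, ha, hb⟩ |
      ⟨rfl, hx, ha, hb⟩ <;>
    push_cast at hQ h1 h2 <;>
    (try have hm3 := hm3 hx) <;>
    rcases hm4 with hm4 | hm4 | ⟨hm4, hm5⟩ <;> (try have hm3 := hm3 hm4) <;> linarith

def WW (x y : ℝ) (a b : ℤ) : Prop := VV x (1+x-y) ((1+x-y) * a) (a + b)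

theorem WW_closed {x y ε : ℝ} (hP : PP x y ε) {a b c : ℤ} (hV : WW x y a b)
    (h1 : -1 < x * a + y * b + c) (h2 : x * a + y * b + c < 1) : WW x y b c := by
  unfold WW at *
  refine VV_closed hP hV ?_ ?_ ?_
  · push_cast; ring
  · push_cast; linarith
  · push_cast; linarith

theorem WW_step {x y ε : ℝ} (hP : PP x y ε) {a b : ℤ} (hV : WW x y a b)
    (h : ∀ c : ℤ, WW x y b c → 0 ≤ x * a + y * b + ε + c → x * a + y * b + ε + c < 1 →
      RR x y ε b c) : RR x y ε a b := by
  apply RR_step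
  intro c h1 h2
  refine h c (WW_closed hP hV ?_ ?_) h1 h2
  · linarith [hP.e1]
  · linarith [hP.e0]

theorem rng {r : ℝ} {c : ℤ} (lo hi : ℤ) (h1 : 0 ≤ r + c) (h2 : r + c < 1)
    (h3 : -r ≤ hi) (h4 : (lo : ℝ) - 1 < - r) : lo ≤ c ∧ c ≤ hi := by
  constructor
  · have : (lo : ℝ) < c + 1 := by linarith
    have : lo < c + 1 := by exact_mod_cast this
    omega
  · have : (c : ℝ) < hi + 1 := by linarith
    have : c < hi + 1 := by exact_mod_cast this
    omega


theorem core1 {x y ε : ℝ} (hP : PP x y ε) :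
    RR x y ε 1 0 ∧ RR x y ε (-1) 1 ∧ RR x y ε 1 (-1) ∧ RR x y ε (-1) 0 ∧ RR x y ε 2 (-1) ∧
    RR x y ε (-2) 1 := by
  obtain ⟨e0, e1, x0, x1, y0, y1, y2⟩ := hP
  have z0 := RR_zero x y ε
  have c_1_0 : RR x y ε (1) (0) := by
    apply RR_step
    intro c h1 h2
    push_cast at h1 h2
    obtain ⟨k1, k2⟩ := rng (0) (0) h1 h2 (by push_cast; linarith) (by push_cast; linarith)
    interval_cases c <;> assumption
  have c_m1_1 : RR x y ε (-1) (1) := by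
    apply RR_step
    intro c h1 h2
    push_cast at h1 h2
    obtain ⟨k1, k2⟩ := rng (0) (0) h1 h2 (by push_cast; linarith) (by push_cast; linarith)
    interval_cases c <;> assumption
  have c_m1_0 : RR x y ε (-1) 0 := by
    apply RR_step
    intro c h1 h2
    push_cast at h1 h2
    obtain ⟨k1, k2⟩ := rng 0 1 h1 h2 (by push_cast; linarith) (by push_cast; linarith)
    interval_cases c
    · assumption
    push_cast at h1 h2
    apply RR_step
    intro c h3 h4
    push_cast at h3 h4
    obtain ⟨k1, k2⟩ := rng (-1) 0 h3 h4 (by push_cast; linarith) (by push_cast; linarith)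
    interval_cases c
    · push_cast at h3 h4
      apply RR_step
      intro c h5 h6
      push_cast at h5 h6
      obtain ⟨k1, k2⟩ := rng 1 1 h5 h6 (by push_cast; linarith) (by push_cast; linarith)
      interval_cases c
      assumption
    · assumption
  have c_1_m1 : RR x y ε (1) (-1) := by
    apply RR_step
    intro c h1 h2
    push_cast at h1 h2
    obtain ⟨k1, k2⟩ := rng (0) (1) h1 h2 (by push_cast; linarith) (by push_cast; linarith)
    interval_cases c <;> assumption
  have c_2_m1 : RR x y ε (2) (-1) := by
    apply RR_step
    intro c h1 h2
    push_cast at h1 h2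
    obtain ⟨k1, k2⟩ := rng (0) (1) h1 h2 (by push_cast; linarith) (by push_cast; linarith)
    interval_cases c <;> assumption
  have c_m2_1 : RR x y ε (-2) (1) := by
    apply RR_step
    intro c h1 h2
    push_cast at h1 h2
    obtain ⟨k1, k2⟩ := rng (-1) (0) h1 h2 (by push_cast; linarith) (by push_cast; linarith)
    interval_cases c <;> assumption
  exact ⟨c_1_0, c_m1_1, c_1_m1, c_m1_0, c_2_m1, c_m2_1⟩

theorem core2 {x y ε : ℝ} (hP : PP x y ε) (hx : 1/2 < x) :
    RR x y ε 2 0 ∧ RR x y ε (-2) 0 ∧ RR x y ε 3 (-1) ∧ RR x y ε (-3) 1 := by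
  obtain ⟨c_1_0, c_m1_1, c_1_m1, c_m1_0, c_2_m1, c_m2_1⟩ := core1 hP
  obtain ⟨e0, e1, x0, x1, y0, y1, y2⟩ := hP
  have c_0_1 : RR x y ε (0) (1) := by
    apply RR_step
    intro c h1 h2
    push_cast at h1 h2
    obtain ⟨k1, k2⟩ := rng (-1) (-1) h1 h2 (by push_cast; linarith) (by push_cast; linarith)
    interval_cases c <;> assumption
  have c_m2_2 : RR x y ε (-2) (2) := by
    apply RR_step
    intro c h1 h2
    push_cast at h1 h2
    obtain ⟨k1, k2⟩ := rng (-1) (-1) h1 h2 (by push_cast; linarith) (by push_cast; linarith)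
    interval_cases c <;> assumption
  have c_2_m2 : RR x y ε (2) (-2) := by
    apply RR_step
    intro c h1 h2
    push_cast at h1 h2
    obtain ⟨k1, k2⟩ := rng (2) (2) h1 h2 (by push_cast; linarith) (by push_cast; linarith)
    interval_cases c <;> assumption
  have c_m1_2 : RR x y ε (-1) (2) := by
    apply RR_step
    intro c h1 h2
    push_cast at h1 h2
    obtain ⟨k1, k2⟩ := rng (-2) (-2) h1 h2 (by push_cast; linarith) (by push_cast; linarith)
    interval_cases c <;> assumption
  have c_0_m1 : RR x y ε (0) (-1) := by
    apply RR_step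
    intro c h1 h2
    push_cast at h1 h2
    obtain ⟨k1, k2⟩ := rng (2) (2) h1 h2 (by push_cast; linarith) (by push_cast; linarith)
    interval_cases c <;> assumption
  have c_3_m2 : RR x y ε (3) (-2) := by
    apply RR_step
    intro c h1 h2
    push_cast at h1 h2
    obtain ⟨k1, k2⟩ := rng (1) (2) h1 h2 (by push_cast; linarith) (by push_cast; linarith)
    interval_cases c <;> assumption
  have c_m3_2 : RR x y ε (-3) (2) := by
    apply RR_step
    intro c h1 h2
    push_cast at h1 h2
    obtain ⟨k1, k2⟩ := rng (-1) (-1) h1 h2 (by push_cast; linarith) (by push_cast; linarith)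
    interval_cases c <;> assumption
  have c_m3_3 : RR x y ε (-3) (3) := by
    apply RR_step
    intro c h1 h2
    push_cast at h1 h2
    obtain ⟨k1, k2⟩ := rng (-2) (-2) h1 h2 (by push_cast; linarith) (by push_cast; linarith)
    interval_cases c <;> assumption
  have c_3_m3 : RR x y ε (3) (-3) := by
    apply RR_step
    intro c h1 h2
    push_cast at h1 h2
    obtain ⟨k1, k2⟩ := rng (2) (3) h1 h2 (by push_cast; linarith) (by push_cast; linarith)
    interval_cases c <;> assumption
  have c_4_m3 : RR x y ε (4) (-3) := by
    apply RR_step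
    intro c h1 h2
    push_cast at h1 h2
    obtain ⟨k1, k2⟩ := rng (2) (3) h1 h2 (by push_cast; linarith) (by push_cast; linarith)
    interval_cases c <;> assumption
  have c_4_m2 : RR x y ε (4) (-2) := by
    apply RR_step
    intro c h1 h2
    push_cast at h1 h2
    obtain ⟨k1, k2⟩ := rng (1) (1) h1 h2 (by push_cast; linarith) (by push_cast; linarith)
    interval_cases c <;> assumption
  have c_m4_4 : RR x y ε (-4) (4) := by
    apply RR_step
    intro c h1 h2
    push_cast at h1 h2
    obtain ⟨k1, k2⟩ := rng (-3) (-2) h1 h2 (by push_cast; linarith) (by push_cast; linarith)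
    interval_cases c <;> assumption
  have c_3_m1 : RR x y ε (3) (-1) := by
    apply RR_step
    intro c h1 h2
    push_cast at h1 h2
    obtain ⟨k1, k2⟩ := rng (0) (0) h1 h2 (by push_cast; linarith) (by push_cast; linarith)
    interval_cases c <;> assumption
  have c_m4_3 : RR x y ε (-4) (3) := by
    apply RR_step
    intro c h1 h2
    push_cast at h1 h2
    obtain ⟨k1, k2⟩ := rng (-2) (-1) h1 h2 (by push_cast; linarith) (by push_cast; linarith)
    interval_cases c <;> assumption
  have c_4_m4 : RR x y ε (4) (-4) := by
    apply RR_step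
    intro c h1 h2
    push_cast at h1 h2
    obtain ⟨k1, k2⟩ := rng (3) (4) h1 h2 (by push_cast; linarith) (by push_cast; linarith)
    interval_cases c <;> assumption
  have c_m3_4 : RR x y ε (-3) (4) := by
    apply RR_step
    intro c h1 h2
    push_cast at h1 h2
    obtain ⟨k1, k2⟩ := rng (-4) (-3) h1 h2 (by push_cast; linarith) (by push_cast; linarith)
    interval_cases c <;> assumption
  have c_2_m3 : RR x y ε (2) (-3) := by
    apply RR_step
    intro c h1 h2
    push_cast at h1 h2
    obtain ⟨k1, k2⟩ := rng (3) (4) h1 h2 (by push_cast; linarith) (by push_cast; linarith)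
    interval_cases c <;> assumption
  have c_m2_3 : RR x y ε (-2) (3) := by
    apply RR_step
    intro c h1 h2
    push_cast at h1 h2
    obtain ⟨k1, k2⟩ := rng (-3) (-2) h1 h2 (by push_cast; linarith) (by push_cast; linarith)
    interval_cases c <;> assumption
  have c_1_m2 : RR x y ε (1) (-2) := by
    apply RR_step
    intro c h1 h2
    push_cast at h1 h2
    obtain ⟨k1, k2⟩ := rng (2) (3) h1 h2 (by push_cast; linarith) (by push_cast; linarith)
    interval_cases c <;> assumption
  have c_1_1 : RR x y ε (1) (1) := by
    apply RR_step
    intro c h1 h2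
    push_cast at h1 h2
    obtain ⟨k1, k2⟩ := rng (-2) (-1) h1 h2 (by push_cast; linarith) (by push_cast; linarith)
    interval_cases c <;> assumption
  have c_0_2 : RR x y ε (0) (2) := by
    apply RR_step
    intro c h1 h2
    push_cast at h1 h2
    obtain ⟨k1, k2⟩ := rng (-3) (-2) h1 h2 (by push_cast; linarith) (by push_cast; linarith)
    interval_cases c <;> assumption
  have c_2_0 : RR x y ε (2) (0) := by
    apply RR_step
    intro c h1 h2
    push_cast at h1 h2
    obtain ⟨k1, k2⟩ := rng (-1) (-1) h1 h2 (by push_cast; linarith) (by push_cast; linarith)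
    interval_cases c <;> assumption
  have c_m2_0 : RR x y ε (-2) (0) := by
    apply RR_step
    intro c h1 h2
    push_cast at h1 h2
    obtain ⟨k1, k2⟩ := rng (1) (2) h1 h2 (by push_cast; linarith) (by push_cast; linarith)
    interval_cases c <;> assumption
  have c_m3_1 : RR x y ε (-3) (1) := by
    apply RR_step
    intro c h1 h2
    push_cast at h1 h2
    obtain ⟨k1, k2⟩ := rng (1) (1) h1 h2 (by push_cast; linarith) (by push_cast; linarith)
    interval_cases c <;> assumption
  exact ⟨c_2_0, c_m2_0, c_3_m1, c_m3_1⟩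

theorem WW_bd {x y : ℝ} {a b : ℤ} (h : WW x y a b) : -2 ≤ a + b ∧ a + b ≤ 2 := by
  unfold WW VV at h
  omega

theorem WW_two {x y : ℝ} {a b : ℤ} (h : WW x y a b) (h2 : a + b = 2 ∨ a + b = -2) : 1/2 < x := by
  unfold WW VV at h
  rcases h with h | h | h | h | h
  · omega
  · omega
  · omega
  · exact h.2.1
  · exact h.2.1

theorem lemB {x y ε : ℝ} (hP : PP x y ε) (n : ℕ) : ∀ a b : ℤ, WW x y a b →
    ((b ≤ 0 → 0 ≤ a + b → -2 * b + 1 ≤ n → RR x y ε a b) ∧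
     (0 ≤ b → a + b ≤ 0 → 2 * b ≤ n → RR x y ε a b)) := by
  induction n using Nat.strong_induction_on with
  | _ n ih =>
  intro a b hV
  have hbd := WW_bd hV
  obtain ⟨c_1_0, c_m1_1, c_1_m1, c_m1_0, c_2_m1, c_m2_1⟩ := core1 hP
  have z0 := RR_zero x y ε
  have hx := WW_two hV
  have hc := fun h => core2 hP (hx h)
  have hP' := hP
  obtain ⟨e0, e1, x0, x1, y0, y1, y2⟩ := hP'
  constructor
  · intro hb hs hn
    obtain ⟨s, hsa⟩ : ∃ s, s = a + b := ⟨_, rfl⟩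
    obtain rfl : a = s - b := by omega
    simp only [sub_add_cancel] at *
    by_cases hb2 : -1 ≤ b
    · have : s = 0 ∨ s = 1 ∨ s = 2 := by omega
      have hbb : b = 0 ∨ b = -1 := by omega
      rcases this with rfl | rfl | rfl <;> rcases hbb with rfl | rfl <;> norm_num at hc ⊢ <;>
        first | assumption | exact hc.1 | exact hc.2.2.1
    · apply WW_step hP hV
      intro c hW h1 h2
      have hbd2 := WW_bd hW
      have hb3 : (b : ℝ) ≤ -2 := by exact_mod_cast (by omega : b ≤ -2)
      have hQ : (1+x-y) * b ≤ (1+x-y) * (-2) := mul_le_mul_of_nonneg_left hb3 (by linarith)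
      have ht : b + c ≤ 0 := by
        have : ((b + c : ℤ) : ℝ) < 1 := by
          push_cast at *
          have : s = 0 ∨ s = 1 ∨ s = 2 := by omega
          rcases this with rfl | rfl | rfl
          · push_cast at *; nlinarith
          · push_cast at *; nlinarith
          · have := hx (by simp)
            push_cast at *; nlinarith
        have : b + c < 1 := by exact_mod_cast this
        omega
      exact (ih (n-1) (by omega) b c hW).2 (by omega) ht (by omega)
  · intro hb hs hn
    obtain ⟨s, hsa⟩ : ∃ s, s = a + b := ⟨_, rfl⟩
    obtain rfl : a = s - b := by omega
    simp only [sub_add_cancel] at *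
    by_cases hb2 : b ≤ 1
    · have : s = 0 ∨ s = -1 ∨ s = -2 := by omega
      have hbb : b = 0 ∨ b = 1 := by omega
      rcases this with rfl | rfl | rfl <;> rcases hbb with rfl | rfl <;> norm_num at hc ⊢ <;>
        first | assumption | exact hc.2.1 | exact hc.2.2.2
    · apply WW_step hP hV
      intro c hW h1 h2
      have hbd2 := WW_bd hW
      have hb3 : (2 : ℝ) ≤ b := by exact_mod_cast (by omega : 2 ≤ b)
      have hQ : (1+x-y) * 2 ≤ (1+x-y) * b := mul_le_mul_of_nonneg_left hb3 (by linarith)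
      have ht : 0 < b + c := by
        have : (0 : ℝ) < ((b + c : ℤ) : ℝ) := by
          push_cast at *
          have : s = 0 ∨ s = -1 ∨ s = -2 := by omega
          rcases this with rfl | rfl | rfl
          · push_cast at *; nlinarith
          · push_cast at *; nlinarith
          · have := hx (by simp)
            push_cast at *; nlinarith
        exact_mod_cast this
      exact (ih (n-1) (by omega) b c hW).1 (by omega) (by omega) (by omega)

theorem lemB1 {x y ε : ℝ} (hP : PP x y ε) {a b : ℤ} (hV : WW x y a b)
    (hb : b ≤ 0) (hs : 0 ≤ a + b) : RR x y ε a b :=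
  (lemB hP (-2 * b + 1).toNat a b hV).1 hb hs (by omega)

theorem lemB2 {x y ε : ℝ} (hP : PP x y ε) {a b : ℤ} (hV : WW x y a b)
    (hb : 0 ≤ b) (hs : a + b ≤ 0) : RR x y ε a b :=
  (lemB hP (2 * b).toNat a b hV).2 hb hs (by omega)

theorem lt_of_real {t n : ℤ} (h : (t : ℝ) < n) : t < n := by exact_mod_cast h

/-- strong phase, d = 1 -/
theorem lemA1 {x y ε : ℝ} (hP : PP x y ε) {a b : ℤ} (hV : WW x y a b)
    (hb : 0 ≤ b) (hs : a + b = 1) : RR x y ε a b := by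
  obtain rfl : a = 1 - b := by omega
  rcases eq_or_lt_of_le hb with rfl | hb1
  · simpa using (core1 hP).1
  apply WW_step hP hV
  intro c hW h1 h2
  obtain ⟨e0, e1, x0, x1, y0, y1, y2⟩ := id hP
  have hb3 : (1 : ℝ) ≤ b := by exact_mod_cast hb1
  have hQ : (1+x-y) * 1 ≤ (1+x-y) * b := mul_le_mul_of_nonneg_left hb3 (by linarith)
  have hm : hh x (1+x-y) ≤ x + ε := by
    obtain ⟨-, -, -, h | h | ⟨-, h⟩⟩ := hh_spec x (1+x-y) <;> rw [h] <;> linarith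
  have hq : -(hh x (1+x-y)) ≤ (1+x-y) * ((1 - b : ℤ) : ℝ) := by
    unfold WW VV at hV
    rcases hV with h | h | h | h | h
    · omega
    · omega
    · exact h.2.1
    · omega
    · omega
  push_cast at *
  have t1 : b + c < 2 := lt_of_real (by push_cast; nlinarith)
  have t2 : -1 < b + c := lt_of_real (by push_cast; nlinarith)
  exact lemB1 hP hW (by omega) (by omega)

/-- weak phase, d = 1 -/
theorem lemA2 {x y ε : ℝ} (hP : PP x y ε) {a b : ℤ} (hV : WW x y a b)
    (hb : b ≤ 0) (hs : a + b = -1) : RR x y ε a b := by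
  obtain rfl : a = -1 - b := by omega
  rcases eq_or_lt_of_le hb with rfl | hb1
  · simpa using (core1 hP).2.2.2.1
  apply WW_step hP hV
  intro c hW h1 h2
  obtain ⟨e0, e1, x0, x1, y0, y1, y2⟩ := id hP
  have hb3 : (b : ℝ) ≤ -1 := by exact_mod_cast (by omega : b ≤ -1)
  have hQ : (1+x-y) * b ≤ (1+x-y) * (-1) := mul_le_mul_of_nonneg_left hb3 (by linarith)
  have hm : hh x (1+x-y) ≤ x + ε := by
    obtain ⟨-, -, -, h | h | ⟨-, h⟩⟩ := hh_spec x (1+x-y) <;> rw [h] <;> linarith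
  have hq : (1+x-y) * ((-1 - b : ℤ) : ℝ) ≤ hh x (1+x-y) := by
    unfold WW VV at hV
    rcases hV with h | h | h | h | h
    · omega
    · exact h.2.2
    · omega
    · omega
    · omega
  push_cast at *
  have t1 : b + c < 2 := lt_of_real (by push_cast; nlinarith)
  have t2 : -2 < b + c := lt_of_real (by push_cast; nlinarith)
  rcases (by omega : b + c ≤ 0 ∨ b + c = 1) with h | h
  · exact lemB2 hP hW (by omega) h
  · exact lemA1 hP hW (by omega) h

/-- strong phase, d = 2 -/
theorem lemA3 {x y ε : ℝ} (hP : PP x y ε) {a b : ℤ} (hV : WW x y a b)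
    (hb : 0 ≤ b) (hs : a + b = 2) : RR x y ε a b := by
  have hx := WW_two hV (Or.inl hs)
  obtain rfl : a = 2 - b := by omega
  rcases eq_or_lt_of_le hb with rfl | hb1
  · simpa using (core2 hP hx).1
  apply WW_step hP hV
  intro c hW h1 h2
  obtain ⟨e0, e1, x0, x1, y0, y1, y2⟩ := id hP
  have hb3 : (1 : ℝ) ≤ b := by exact_mod_cast hb1
  have hQ : (1+x-y) * 1 ≤ (1+x-y) * b := mul_le_mul_of_nonneg_left hb3 (by linarith)
  have hq : -(2*x-1) ≤ (1+x-y) * ((2 - b : ℤ) : ℝ) := by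
    unfold WW VV at hV
    rcases hV with h | h | h | h | h
    · omega
    · omega
    · omega
    · omega
    · exact h.2.2.1
  push_cast at *
  have t1 : b + c < 2 := lt_of_real (by push_cast; nlinarith)
  have t2 : -2 < b + c := lt_of_real (by push_cast; nlinarith)
  rcases (by omega : 0 ≤ b + c ∨ b + c = -1) with h | h
  · exact lemB1 hP hW (by omega) h
  · exact lemA2 hP hW (by omega) h

/-- weak phase, d = 2 -/
theorem lemA4 {x y ε : ℝ} (hP : PP x y ε) {a b : ℤ} (hV : WW x y a b)
    (hb : b ≤ 0) (hs : a + b = -2) : RR x y ε a b := by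
  have hx := WW_two hV (Or.inr hs)
  obtain rfl : a = -2 - b := by omega
  rcases eq_or_lt_of_le hb with rfl | hb1
  · simpa using (core2 hP hx).2.1
  apply WW_step hP hV
  intro c hW h1 h2
  obtain ⟨e0, e1, x0, x1, y0, y1, y2⟩ := id hP
  have hb3 : (b : ℝ) ≤ -1 := by exact_mod_cast (by omega : b ≤ -1)
  have hQ : (1+x-y) * b ≤ (1+x-y) * (-1) := mul_le_mul_of_nonneg_left hb3 (by linarith)
  have hq : (1+x-y) * ((-2 - b : ℤ) : ℝ) ≤ 2*x-1 := by
    unfold WW VV at hV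
    rcases hV with h | h | h | h | h
    · omega
    · omega
    · omega
    · exact h.2.2.2
    · omega
  have hbd := WW_bd hW
  push_cast at *
  have t2 : -2 < b + c := lt_of_real (by push_cast; nlinarith)
  rcases (by omega : b + c ≤ 0 ∨ b + c = 1 ∨ b + c = 2) with h | h | h
  · exact lemB2 hP hW (by omega) h
  · exact lemA1 hP hW (by omega) h
  · exact lemA3 hP hW (by omega) h

theorem WW_RR {x y ε : ℝ} (hP : PP x y ε) {a b : ℤ} (hV : WW x y a b) : RR x y ε a b := by
  have hbd := WW_bd hV
  rcases le_total b 0 with hb | hb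
  · rcases (by omega : 0 ≤ a + b ∨ a + b = -1 ∨ a + b = -2) with h | h | h
    · exact lemB1 hP hV hb h
    · exact lemA2 hP hV hb h
    · exact lemA4 hP hV hb h
  · rcases (by omega : a + b ≤ 0 ∨ a + b = 1 ∨ a + b = 2) with h | h | h
    · exact lemB2 hP hV hb h
    · exact lemA1 hP hV hb h
    · exact lemA3 hP hV hb h

theorem brunotte {x y ε : ℝ} (hP : PP x y ε) (k : ℕ) : ∀ a b a' b' : ℤ,
    (tau2 (x, y) ε)^[k] (a, b) = (0, 0) → WW x y a' b' → RR x y ε (a + a') (b + b') := by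
  induction k with
  | zero =>
    intro a b a' b' h hW
    simp only [Function.iterate_zero, id_eq, Prod.mk.injEq] at h
    obtain ⟨rfl, rfl⟩ := h
    simpa using WW_RR hP hW
  | succ k ih =>
    intro a b a' b' h hW
    rw [Function.iterate_succ_apply] at h
    have h3 := Int.floor_le (x * a + y * b + ε)
    have h4 := Int.lt_floor_add_one (x * a + y * b + ε)
    apply RR_step
    intro c h1 h2
    have := ih b (-⌊x * a + y * b + ε⌋) b' (c + ⌊x * a + y * b + ε⌋) h
      (WW_closed hP hW (by push_cast at *; linarith) (by push_cast at *; linarith))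
    convert this using 1
    ring

theorem RR_add {x y ε : ℝ} (hP : PP x y ε) {a b a' b' : ℤ} (h : RR x y ε a b)
    (hW : WW x y a' b') : RR x y ε (a + a') (b + b') := by
  obtain ⟨k, hk⟩ := h
  exact brunotte hP k a b a' b' hk hW

theorem RR_all {x y ε : ℝ} (hP : PP x y ε) (a b : ℤ) : RR x y ε a b := by
  obtain ⟨e0, e1, x0, x1, y0, y1, y2⟩ := id hP
  have hm := (hh_spec x (1+x-y)).2.1
  have w1 : WW x y 1 0 := by
    right; right; left; refine ⟨rfl, ?_, ?_⟩ <;> push_cast <;> linarith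
  have w2 : WW x y (-1) 0 := by
    right; left; refine ⟨rfl, ?_, ?_⟩ <;> push_cast <;> linarith
  have w3 : WW x y 0 1 := by
    right; right; left; refine ⟨rfl, ?_, ?_⟩ <;> push_cast <;> linarith
  have w4 : WW x y 0 (-1) := by
    right; left; refine ⟨rfl, ?_, ?_⟩ <;> push_cast <;> linarith
  have hb : ∀ b : ℤ, RR x y ε 0 b := by
    intro b
    induction b using Int.induction_on with
    | zero => exact RR_zero x y ε
    | succ i ih => simpa using RR_add hP ih w3
    | pred i ih => simpa [sub_eq_add_neg] using RR_add hP ih w4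
  induction a using Int.induction_on with
  | zero => exact hb b
  | succ i ih => simpa using RR_add hP ih w1
  | pred i ih => simpa [sub_eq_add_neg] using RR_add hP ih w2

theorem not_RR {x y ε : ℝ} (e0 : 0 < ε) (e1 : ε < 1/2) (h : y = x + 1 - ε) :
    ¬ RR x y ε 1 (-1) := by
  have f1 : tau2 (x, y) ε (1, -1) = (-1, 1) := by
    have : ⌊x * ((1 : ℤ) : ℝ) + y * ((-1 : ℤ) : ℝ) + ε⌋ = -1 := by
      rw [Int.floor_eq_iff]; push_cast; constructor <;> linarith
    simp only [tau2, this]; rfl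
  have f2 : tau2 (x, y) ε (-1, 1) = (1, -1) := by
    have : ⌊x * ((-1 : ℤ) : ℝ) + y * ((1 : ℤ) : ℝ) + ε⌋ = 1 := by
      rw [Int.floor_eq_iff]; push_cast; constructor <;> linarith
    simp only [tau2, this]
  have key : ∀ k : ℕ, (tau2 (x, y) ε)^[k] (1, -1) = (1, -1) ∨
      (tau2 (x, y) ε)^[k] (1, -1) = (-1, 1) := by
    intro k
    induction k with
    | zero => left; rfl
    | succ k ih =>
      rw [Function.iterate_succ_apply']
      rcases ih with ih | ih
      · right; rw [ih, f1]
      · left; rw [ih, f2]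
  rintro ⟨k, hk⟩
  rcases key k with h | h <;> rw [h] at hk <;> simp at hk

theorem hull_sub (ε : ℝ) :
    convexHull ℝ ({(-ε, 1 - 2*ε), (1/6 - ε, 1 - 2*ε), (2/3 - ε, 3/2 - 2*ε),
        (2/3 - ε, 5/3 - 2*ε)} : Set (ℝ × ℝ)) ⊆
    {q : ℝ × ℝ | -ε ≤ q.1 ∧ q.1 ≤ 2/3 - ε ∧ 1 - 2*ε ≤ q.2 ∧ q.1 + 5/6 - ε ≤ q.2 ∧
      q.2 ≤ q.1 + 1 - ε} := by
  apply convexHull_min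
  · intro q hq
    simp only [Set.mem_insert_iff, Set.mem_singleton_iff] at hq
    rcases hq with rfl | rfl | rfl | rfl <;> simp only [Set.mem_ofPred_eq] <;>
      refine ⟨?_, ?_, ?_, ?_, ?_⟩ <;> linarith
  · rintro ⟨p1, p2⟩ ⟨h1, h2, h3, h4, h5⟩ ⟨q1, q2⟩ ⟨k1, k2, k3, k4, k5⟩ s t hs ht hst
    simp only at h1 h2 h3 h4 h5 k1 k2 k3 k4 k5
    obtain rfl : t = 1 - s := by linarith
    simp only [Set.mem_ofPred_eq, Prod.smul_mk, Prod.mk_add_mk, smul_eq_mul]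
    refine ⟨?_, ?_, ?_, ?_, ?_⟩
    · nlinarith [mul_le_mul_of_nonneg_left h1 hs, mul_le_mul_of_nonneg_left k1 ht]
    · nlinarith [mul_le_mul_of_nonneg_left h2 hs, mul_le_mul_of_nonneg_left k2 ht]
    · nlinarith [mul_le_mul_of_nonneg_left h3 hs, mul_le_mul_of_nonneg_left k3 ht]
    · nlinarith [mul_le_mul_of_nonneg_left h4 hs, mul_le_mul_of_nonneg_left k4 ht]
    · nlinarith [mul_le_mul_of_nonneg_left h5 hs, mul_le_mul_of_nonneg_left k5 ht]

theorem stmt_11 (ε : ℝ) (hε0 : 0 < ε) (hε1 : ε < 1/2) :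
    -- Δ₁₄ = conv(C, M, S, Z)
    convexHull ℝ ({(-ε, 1 - 2*ε), (1/6 - ε, 1 - 2*ε), (2/3 - ε, 3/2 - 2*ε),
        (2/3 - ε, 5/3 - 2*ε)} : Set (ℝ × ℝ)) ∩ SRS2 ε =
      convexHull ℝ ({(-ε, 1 - 2*ε), (1/6 - ε, 1 - 2*ε), (2/3 - ε, 3/2 - 2*ε),
        (2/3 - ε, 5/3 - 2*ε)} : Set (ℝ × ℝ)) \
        {q : ℝ × ℝ | -ε ≤ q.1 ∧ q.1 ≤ 2/3 - ε ∧ q.2 = q.1 + 1 - ε} := by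
  ext ⟨x, y⟩
  simp only [Set.mem_inter_iff, Set.mem_sdiff]
  refine and_congr_right fun hr => ?_
  obtain ⟨h1, h2, h3, h4, h5⟩ := hull_sub ε hr
  simp only at h1 h2 h3 h4 h5
  constructor
  · rintro hS ⟨_, _, hy⟩
    exact not_RR hε0 hε1 hy (hS (1, -1))
  · intro hF z
    have hlt : y < x + 1 - ε := lt_of_le_of_ne h5 fun h => hF ⟨h1, h2, h⟩
    exact RR_all ⟨hε0, hε1, h1, h2, h3, h4, hlt⟩ z.1 z.2
end

section
/- Let (p_0, p_1) ∈ ℤ² with |p_0| ≥ 2, and let ε ∈ [0,1/2), or ε = 1/2 with |p_0| odd. Set k = ⌊ε|p_0|⌋ and ε_k = k/|p_0|. Then (1/p_0, p_1/p_0) ∈ D(ε) if and only if either (p_0 ≥ 2 and -k-1 ≤ p_1 ≤ |p_0| - k) or (p_0 ≤ -3, ε ≥ 1/|p_0|, and k + 2 - |p_0| ≤ p_1 ≤ k - 1). Consequently, (1/p_0, p_1/p_0) ∈ D(ε) if and only if (1/p_0, p_1/p_0) ∈ D(ε_k). -/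
theorem aux_pos (n p1 k : ℤ) (ε : ℝ) (hn : 2 ≤ n) (h0 : 0 ≤ ε)
    (hcase : ε < 1/2 ∨ (ε = 1/2 ∧ n = 2 * k + 1))
    (h1 : (k : ℝ) ≤ ε * n) (h2 : ε * n < k + 1) :
    (1 / (n : ℝ), (p1 : ℝ) / (n : ℝ)) ∈ Dset ε ↔ (-k - 1 ≤ p1 ∧ p1 ≤ n - k) := by
  have hnR : (2 : ℝ) ≤ n := by exact_mod_cast hn
  have hpos : (0 : ℝ) < n := by linarith
  obtain ⟨x, hx⟩ : ∃ x : ℝ, x = 1 / n := ⟨_, rfl⟩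
  have hxn : x * n = 1 := by rw [hx]; field_simp
  obtain ⟨y, hy⟩ : ∃ y : ℝ, y = p1 / n := ⟨_, rfl⟩
  have hyn : y * n = p1 := by rw [hy]; field_simp
  rw [← hx, ← hy]
  simp only [Dset, Set.mem_setOf_eq]
  rcases hcase with hc | ⟨hc, hodd⟩
  · have hx2 : x ≤ 1/2 := by nlinarith
    have hx0 : 0 < x := by rw [hx]; positivity
    constructor
    · rintro (⟨-, a, b, c, d⟩ | ⟨a, -⟩)
      · have a' : ((-k - 1 : ℤ) : ℝ) < p1 + 1 := by push_cast; nlinarith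
        have b' : ((p1 : ℤ) : ℝ) < ((n - k + 1 : ℤ) : ℝ) := by push_cast; nlinarith
        have a'' : -k - 1 < p1 + 1 := by exact_mod_cast a'
        have b'' : p1 < n - k + 1 := by exact_mod_cast b'
        constructor <;> omega
      · linarith
    · rintro ⟨a, b⟩
      have a' : (-k - 1 : ℝ) ≤ p1 := by exact_mod_cast a
      have b' : (p1 : ℝ) ≤ n - k := by exact_mod_cast b
      refine Or.inl ⟨hc, ?_, ?_, by linarith, by linarith⟩
      · refine le_of_mul_le_mul_right ?_ hpos
        nlinarith
      · refine lt_of_mul_lt_mul_right ?_ hpos.le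
        nlinarith
  · subst hc
    have hnk : (n : ℝ) = 2 * k + 1 := by exact_mod_cast hodd
    have hx2 : x ≤ 1/2 := by nlinarith
    have hx0 : 0 < x := by rw [hx]; positivity
    constructor
    · rintro (⟨a, -⟩ | ⟨-, a, b, c, d⟩)
      · linarith
      · have a' : ((-k - 1 : ℤ) : ℝ) < p1 + 1 := by push_cast; nlinarith
        have b' : ((p1 : ℤ) : ℝ) < ((n - k + 1 : ℤ) : ℝ) := by push_cast; nlinarith
        have a'' : -k - 1 < p1 + 1 := by exact_mod_cast a'
        have b'' : p1 < n - k + 1 := by exact_mod_cast b'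
        constructor <;> omega
    · rintro ⟨a, b⟩
      have a' : (-k - 1 : ℝ) ≤ p1 := by exact_mod_cast a
      have b' : (p1 : ℝ) ≤ n - k := by exact_mod_cast b
      refine Or.inr ⟨le_rfl, ?_, ?_, by linarith, by linarith⟩
      · refine lt_of_mul_lt_mul_right ?_ hpos.le
        nlinarith
      · refine le_of_mul_le_mul_right ?_ hpos
        nlinarith

theorem aux_neg (n p1 k : ℤ) (ε : ℝ) (hn : 2 ≤ n) (h0 : 0 ≤ ε)
    (hcase : ε < 1/2 ∨ (ε = 1/2 ∧ n = 2 * k + 1))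
    (h1 : (k : ℝ) ≤ ε * n) (h2 : ε * n < k + 1) :
    (1 / (-n : ℝ), (p1 : ℝ) / (-n : ℝ)) ∈ Dset ε ↔
      (3 ≤ n ∧ 1 ≤ k ∧ k + 2 - n ≤ p1 ∧ p1 ≤ k - 1) := by
  have hnR : (2 : ℝ) ≤ n := by exact_mod_cast hn
  have hpos : (0 : ℝ) < n := by linarith
  obtain ⟨x, hx⟩ : ∃ x : ℝ, x = 1 / (-n) := ⟨_, rfl⟩
  have hxn : x * n = -1 := by rw [hx]; field_simp
  obtain ⟨y, hy⟩ : ∃ y : ℝ, y = p1 / (-n) := ⟨_, rfl⟩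
  have hyn : y * n = -p1 := by rw [hy]; field_simp
  rw [← hx, ← hy]
  simp only [Dset, Set.mem_setOf_eq]
  have hx2 : -(1/2) ≤ x := by nlinarith
  have hx0 : x < 0 := by nlinarith
  rcases hcase with hc | ⟨hc, hodd⟩
  · constructor
    · rintro (⟨-, a, b, c, d⟩ | ⟨a, -⟩)
      · have a' : ((k + 2 - n : ℤ) : ℝ) < p1 + 1 := by push_cast; nlinarith
        have b' : ((p1 : ℤ) : ℝ) < ((k : ℤ) : ℝ) := by nlinarith
        have c' : (0 : ℝ) < k := by nlinarith
        have d' : (2 : ℝ) < n := by nlinarith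
        have a'' : k + 2 - n < p1 + 1 := by exact_mod_cast a'
        have b'' : p1 < k := by exact_mod_cast b'
        have c'' : 0 < k := by exact_mod_cast c'
        have d'' : 2 < n := by exact_mod_cast d'
        refine ⟨?_, ?_, ?_, ?_⟩ <;> omega
      · linarith
    · rintro ⟨-, c, a, b⟩
      have a' : (k + 2 - n : ℝ) ≤ p1 := by exact_mod_cast a
      have b' : (p1 : ℝ) ≤ k - 1 := by exact_mod_cast b
      have c' : (1 : ℝ) ≤ k := by exact_mod_cast c
      refine Or.inl ⟨hc, ?_, ?_, ?_, by linarith⟩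
      · refine le_of_mul_le_mul_right ?_ hpos
        nlinarith
      · refine lt_of_mul_lt_mul_right ?_ hpos.le
        nlinarith
      · refine le_of_mul_le_mul_right ?_ hpos
        nlinarith
  · subst hc
    have hnk : (n : ℝ) = 2 * k + 1 := by exact_mod_cast hodd
    have h3 : 3 ≤ n := by omega
    have h3R : (3 : ℝ) ≤ n := by exact_mod_cast h3
    constructor
    · rintro (⟨a, -⟩ | ⟨-, a, b, c, d⟩)
      · linarith
      · have a' : ((k + 2 - n : ℤ) : ℝ) < p1 + 1 := by push_cast; nlinarith
        have b' : ((p1 : ℤ) : ℝ) < ((k : ℤ) : ℝ) := by nlinarith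
        have a'' : k + 2 - n < p1 + 1 := by exact_mod_cast a'
        have b'' : p1 < k := by exact_mod_cast b'
        refine ⟨?_, ?_, ?_, ?_⟩ <;> omega
    · rintro ⟨-, c, a, b⟩
      have a' : (k + 2 - n : ℝ) ≤ p1 := by exact_mod_cast a
      have b' : (p1 : ℝ) ≤ k - 1 := by exact_mod_cast b
      refine Or.inr ⟨le_rfl, ?_, ?_, ?_, by linarith⟩
      · refine lt_of_mul_lt_mul_right ?_ hpos.le
        nlinarith
      · refine le_of_mul_le_mul_right ?_ hpos
        nlinarith
      · refine lt_of_mul_lt_mul_right ?_ hpos.le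
        nlinarith

theorem stmt_13 (p0 p1 : ℤ) (hp : 2 ≤ |p0|) (ε : ℝ)
    (hcase : (0 ≤ ε ∧ ε < 1/2) ∨ (ε = 1/2 ∧ Odd |p0|))
    (k : ℤ) (hk : k = ⌊ε * (|p0| : ℝ)⌋) :
    ((1 / (p0 : ℝ), (p1 : ℝ) / (p0 : ℝ)) ∈ Dset ε ↔
      (2 ≤ p0 ∧ -k - 1 ≤ p1 ∧ p1 ≤ |p0| - k) ∨
      (p0 ≤ -3 ∧ 1 / (|p0| : ℝ) ≤ ε ∧ k + 2 - |p0| ≤ p1 ∧ p1 ≤ k - 1)) ∧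
    ((1 / (p0 : ℝ), (p1 : ℝ) / (p0 : ℝ)) ∈ Dset ε ↔
      (1 / (p0 : ℝ), (p1 : ℝ) / (p0 : ℝ)) ∈ Dset ((k : ℝ) / (|p0| : ℝ))) := by
  obtain ⟨n, hn⟩ : ∃ n : ℤ, n = |p0| := ⟨_, rfl⟩
  have hnc : |(p0 : ℝ)| = (n : ℝ) := by rw [hn]; push_cast; rfl
  rw [hnc] at hk ⊢
  rw [← hn] at hp hcase ⊢
  have h1 : (k : ℝ) ≤ ε * n := by rw [hk]; exact Int.floor_le _
  have h2 : ε * n < k + 1 := by rw [hk]; exact Int.lt_floor_add_one _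
  have h0 : 0 ≤ ε := by
    rcases hcase with h | h
    · exact h.1
    · rw [h.1]; norm_num
  have hnR : (2 : ℝ) ≤ n := by exact_mod_cast hp
  have hpos : (0 : ℝ) < n := by linarith
  have hcase' : ε < 1/2 ∨ (ε = 1/2 ∧ n = 2 * k + 1) := by
    rcases hcase with h | ⟨h, m, hm⟩
    · exact Or.inl h.2
    · refine Or.inr ⟨h, ?_⟩
      rw [h, hm] at h1 h2
      push_cast at h1 h2
      have e1 : (k : ℝ) < ((m + 1 : ℤ) : ℝ) := by push_cast; linarith
      have e2 : (m : ℝ) < ((k + 1 : ℤ) : ℝ) := by push_cast; linarith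
      have e1' : k < m + 1 := by exact_mod_cast e1
      have e2' : m < k + 1 := by exact_mod_cast e2
      omega
  have hk0 : 0 ≤ k := by rw [hk]; exact Int.floor_nonneg.2 (by positivity)
  have hk0R : (0 : ℝ) ≤ k := by exact_mod_cast hk0
  have g0 : (0 : ℝ) ≤ k / n := by positivity
  have g : (k : ℝ) / n * n = k := by field_simp
  have g1 : (k : ℝ) ≤ k / n * n := g.ge
  have g2 : (k : ℝ) / n * n < k + 1 := by rw [g]; linarith
  have gc : (k : ℝ) / n < 1/2 := by
    rw [div_lt_iff₀ hpos]
    rcases hcase' with h | ⟨h, h'⟩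
    · nlinarith
    · have : (n : ℝ) = 2 * k + 1 := by exact_mod_cast h'
      linarith
  have hiff : 1 / (n : ℝ) ≤ ε ↔ 1 ≤ k := by
    rw [div_le_iff₀ hpos, hk, Int.le_floor]; simp
  rcases abs_cases p0 with ⟨ha, hb⟩ | ⟨ha, hb⟩
  · have hp0 : p0 = n := by omega
    rw [hp0, aux_pos n p1 k ε hp h0 hcase' h1 h2, aux_pos n p1 k _ hp g0 (Or.inl gc) g1 g2]
    refine ⟨⟨fun h => Or.inl ⟨hp, h⟩, ?_⟩, Iff.rfl⟩
    rintro (h | h)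
    · exact h.2
    · omega
  · have hp0 : p0 = -n := by omega
    rw [hp0]
    push_cast
    rw [aux_neg n p1 k ε hp h0 hcase' h1 h2, aux_neg n p1 k _ hp g0 (Or.inl gc) g1 g2, hiff]
    refine ⟨?_, Iff.rfl⟩
    omega
end

section
/- Let (p_0, p_1) ∈ ℤ² with |p_0| ≥ 2, and let ε ∈ (1/2,1), or ε = 1/2 with |p_0| even. Set k = ⌊ε|p_0|⌋ and ε_k = k/|p_0|. Then (1/p_0, p_1/p_0) ∈ D(ε) if and only if either (p_0 ≥ 2 and -|p_0| + k ≤ p_1 ≤ k + 1) or (p_0 ≤ -3, ε < (|p_0|-1)/|p_0|, and -k + 1 ≤ p_1 ≤ -k - 2 + |p_0|). Consequently, (1/p_0, p_1/p_0) ∈ D(ε) if and only if (1/p_0, p_1/p_0) ∈ D(ε_k). -/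
lemma mem_pos (n p t : ℝ) (hn : 0 < n) :
    (1 / n, p / n) ∈ Dset (t / n) ↔
      (2 * t < n ∧ -1 - t ≤ p ∧ p < 1 + n - t ∧ -t ≤ 1 ∧ 1 < n - t) ∨
      (n ≤ 2 * t ∧ -1 - n + t < p ∧ p ≤ 1 + t ∧ -(n - t) < 1 ∧ 1 ≤ t) := by
  have e1 : -(1 / n) - t / n = (-1 - t) / n := by field_simp
  have e2 : 1 / n + 1 - t / n = (1 + n - t) / n := by field_simp
  have e3 : -(t / n) = (-t) / n := by field_simp
  have e4 : 1 - t / n = (n - t) / n := by field_simp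
  have e5 : -(1 / n) - 1 + t / n = (-1 - n + t) / n := by field_simp
  have e6 : 1 / n + t / n = (1 + t) / n := by field_simp
  have e7 : -((n - t) / n) = (-(n - t)) / n := by field_simp
  have e8 : t / n < 1 / 2 ↔ 2 * t < n := by
    rw [div_lt_div_iff₀ hn two_pos]; constructor <;> intro h <;> linarith
  have e9 : 1 / 2 ≤ t / n ↔ n ≤ 2 * t := by
    rw [div_le_div_iff₀ two_pos hn]; constructor <;> intro h <;> linarith
  simp only [Dset, Set.mem_ofPred_eq]
  rw [e8, e9, e1, e2, e3, e4, e5, e6, e7]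
  simp only [div_lt_div_iff_of_pos_right hn, div_le_div_iff_of_pos_right hn]

lemma mem_neg (n p t : ℝ) (hn : 0 < n) :
    (1 / (-n), p / (-n)) ∈ Dset (t / n) ↔
      (2 * t < n ∧ 1 - t ≤ -p ∧ -p < -1 + n - t ∧ -t ≤ -1 ∧ -1 < n - t) ∨
      (n ≤ 2 * t ∧ 1 - n + t < -p ∧ -p ≤ -1 + t ∧ -(n - t) < -1 ∧ -1 ≤ t) := by
  have a1 : 1 / (-n) = (-1) / n := by rw [div_neg, neg_div]
  have a2 : p / (-n) = (-p) / n := by rw [div_neg, neg_div]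
  rw [a1, a2]
  have e1 : -((-1) / n) - t / n = (1 - t) / n := by field_simp
  have e2 : (-1) / n + 1 - t / n = (-1 + n - t) / n := by field_simp
  have e3 : -(t / n) = (-t) / n := by field_simp
  have e4 : 1 - t / n = (n - t) / n := by field_simp
  have e5 : -((-1) / n) - 1 + t / n = (1 - n + t) / n := by field_simp
  have e6 : (-1) / n + t / n = (-1 + t) / n := by field_simp
  have e7 : -((n - t) / n) = (-(n - t)) / n := by field_simp
  have e8 : t / n < 1 / 2 ↔ 2 * t < n := by
    rw [div_lt_div_iff₀ hn two_pos]; constructor <;> intro h <;> linarith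
  have e9 : 1 / 2 ≤ t / n ↔ n ≤ 2 * t := by
    rw [div_le_div_iff₀ two_pos hn]; constructor <;> intro h <;> linarith
  simp only [Dset, Set.mem_ofPred_eq]
  rw [e8, e9, e1, e2, e3, e4, e5, e6, e7]
  simp only [div_lt_div_iff_of_pos_right hn, div_le_div_iff_of_pos_right hn]

theorem stmt_14 (p0 p1 : ℤ) (hp : 2 ≤ |p0|) (ε : ℝ)
    (hcase : (1/2 < ε ∧ ε < 1) ∨ (ε = 1/2 ∧ Even |p0|))
    (k : ℤ) (hk : k = ⌊ε * (|p0| : ℝ)⌋) :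
    ((1 / (p0 : ℝ), (p1 : ℝ) / (p0 : ℝ)) ∈ Dset ε ↔
      (2 ≤ p0 ∧ -|p0| + k ≤ p1 ∧ p1 ≤ k + 1) ∨
      (p0 ≤ -3 ∧ ε < ((|p0| : ℝ) - 1) / (|p0| : ℝ) ∧
        -k + 1 ≤ p1 ∧ p1 ≤ -k - 2 + |p0|)) ∧
    ((1 / (p0 : ℝ), (p1 : ℝ) / (p0 : ℝ)) ∈ Dset ε ↔
      (1 / (p0 : ℝ), (p1 : ℝ) / (p0 : ℝ)) ∈ Dset ((k : ℝ) / (|p0| : ℝ))) := by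
  obtain ⟨n, hn⟩ : ∃ n : ℤ, n = |p0| := ⟨_, rfl⟩
  have hnR : |(p0 : ℝ)| = (n : ℝ) := by rw [hn]; push_cast; rfl
  rw [hnR] at hk ⊢
  rw [← hn] at hp hcase ⊢
  have hnpos : (0 : ℝ) < n := by exact_mod_cast (by omega : 0 < n)
  obtain ⟨t, ht⟩ : ∃ t : ℝ, t = ε * n := ⟨_, rfl⟩
  have hε : ε = t / n := by rw [ht]; field_simp
  rw [← ht] at hk
  have hlow : (n : ℝ) ≤ 2 * t := by
    rw [ht]; rcases hcase with h | h <;> nlinarith [h.1]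
  have hhigh : t < n := by
    rw [ht]; rcases hcase with h | h
    · nlinarith [h.2]
    · nlinarith [h.1]
  -- integer comparison facts
  have key : ∀ m : ℤ, t < m ↔ k + 1 ≤ m := by
    intro m; rw [hk, ← Int.floor_lt]; omega
  have key' : ∀ m : ℤ, (m : ℝ) ≤ t ↔ m ≤ k := by
    intro m; rw [hk, Int.le_floor]
  have kn : k + 1 ≤ n := (key n).1 hhigh
  have hkl : n ≤ 2 * k + 1 := by
    have h := (key (k + 1)).2 le_rfl
    push_cast at h
    have : (n : ℝ) < ((2 * k + 2 : ℤ) : ℝ) := by push_cast; linarith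
    have := Int.cast_lt.1 this
    omega
  have h3 : ε < ((n : ℝ) - 1) / n ↔ k + 1 ≤ n - 1 := by
    rw [← key, hε, div_lt_div_iff_of_pos_right hnpos]; push_cast; rfl
  rw [h3, hε]
  have c1 := key (p1 + 1 + n)
  have c2 := key' (p1 - 1)
  have c3 := key' (1 - p1)
  have c4 := key (n - 1 - p1)
  have c5 := key (n - 1)
  have c6 := key' 1
  have c7 := key' (-1)
  have c8 := key (n + 1)
  push_cast at c1 c2 c3 c4 c5 c6 c7 c8
  have hnl : ¬ (2 * t < n) := not_lt.2 hlow
  rcases le_total 0 p0 with h0 | h0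
  · have : p0 = n := by rw [hn, abs_of_nonneg h0]
    subst this
    rw [mem_pos _ _ _ hnpos, mem_pos _ _ _ hnpos]
    have d1 : (-1 - (p0:ℝ) + t < p1) ↔ k + 1 ≤ p1 + 1 + p0 := by
      rw [← c1]; constructor <;> intro h <;> linarith
    have d2 : ((p1:ℝ) ≤ 1 + t) ↔ p1 - 1 ≤ k := by
      rw [← c2]; constructor <;> intro h <;> linarith
    have d3 : (-((p0:ℝ) - t) < 1) ↔ k + 1 ≤ p0 + 1 := by
      rw [← c8]; constructor <;> intro h <;> linarith
    rw [d1, d2, d3, c6]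
    simp only [hnl, hlow, false_and, false_or, true_and]
    norm_cast
    omega
  · have h1 : p0 = -n := by rw [hn, abs_of_nonpos h0]; ring
    have h2 : (p0 : ℝ) = -(n : ℝ) := by rw [h1]; push_cast; rfl
    rw [h2, mem_neg _ _ _ hnpos, mem_neg _ _ _ hnpos]
    have d1 : (1 - (n:ℝ) + t < -p1) ↔ k + 1 ≤ n - 1 - p1 := by
      rw [← c4]; constructor <;> intro h <;> linarith
    have d2 : (-(p1:ℝ) ≤ -1 + t) ↔ 1 - p1 ≤ k := by
      rw [← c3]; constructor <;> intro h <;> linarith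
    have d3 : (-((n:ℝ) - t) < -1) ↔ k + 1 ≤ n - 1 := by
      rw [← c5]; constructor <;> intro h <;> linarith
    rw [d1, d2, d3, c7]
    simp only [hnl, hlow, false_and, false_or, true_and]
    norm_cast
    clear hn
    omega
end

section
/- Let (p_0, p_1) ∈ ℤ² with |p_0| ≥ 2 and ε ∈ [0,1), and set k = ⌊ε|p_0|⌋ and ε_k = k/|p_0|. If (1/p_0, p_1/p_0) ∈ D(ε), and it is not the case that p_0 ∈ {2,4} and ε ∈ [1/2, 1/2 + 1/|p_0|), then (1/p_0, p_1/p_0) ∈ B(ε_k). -/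
/-- The set `B(ε)`. -/
def Bset (ε : ℝ) : Set (ℝ × ℝ) :=
  {q | (ε < 1/2 ∧ -q.1 - ε ≤ q.2 ∧ q.2 < q.1 + 1 - ε ∧
          -ε ≤ q.1 ∧ q.1 ≤ 2/3 - ε) ∨
       (1/2 ≤ ε ∧ -q.1 - 1 + ε < q.2 ∧ q.2 ≤ q.1 + ε ∧
          -(1 - ε) < q.1 ∧ q.1 ≤ 2/3 - (1 - ε))}

theorem core_aux (n a b k : ℤ) (hn : 2 ≤ n) (ha : a = 1 ∨ a = -1) (ε : ℝ) (hε0 : 0 ≤ ε)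
    (hε1 : ε < 1) (hk : k = ⌊ε * (n : ℝ)⌋)
    (hmem : ((a : ℝ) / (n : ℝ), (b : ℝ) / (n : ℝ)) ∈ Dset ε)
    (hexc : a = 1 → (n = 2 ∨ n = 4) → 1/2 ≤ ε → 1/2 + 1 / (n : ℝ) ≤ ε) :
    ((a : ℝ) / (n : ℝ), (b : ℝ) / (n : ℝ)) ∈ Bset ((k : ℝ) / (n : ℝ)) := by
  have hnR : (2 : ℝ) ≤ n := by exact_mod_cast hn
  have hn0 : (0 : ℝ) < n := by linarith
  have hk1 : (k : ℝ) ≤ ε * n := by rw [hk]; exact Int.floor_le _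
  have hk2 : ε * n < k + 1 := by rw [hk]; exact Int.lt_floor_add_one _
  have hk0 : 0 ≤ k := by rw [hk]; exact Int.floor_nonneg.2 (by positivity)
  have hkn : k < n := by
    have : (k : ℝ) < n := by nlinarith
    exact_mod_cast this
  obtain ⟨x, hx⟩ : ∃ x : ℝ, x = a / n := ⟨_, rfl⟩
  obtain ⟨y, hy⟩ : ∃ y : ℝ, y = b / n := ⟨_, rfl⟩
  obtain ⟨z, hz⟩ : ∃ z : ℝ, z = k / n := ⟨_, rfl⟩
  have hx' : x * n = a := by rw [hx]; field_simp
  have hy' : y * n = b := by rw [hy]; field_simp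
  have hz' : z * n = k := by rw [hz]; field_simp
  rw [← hx, ← hy] at hmem ⊢
  rw [← hz]
  -- integer form of the goal
  suffices H : (2 * k < n ∧ -a - k ≤ b ∧ b < a + n - k ∧ -k ≤ a ∧ 3 * a ≤ 2 * n - 3 * k) ∨
      (n ≤ 2 * k ∧ -a - n + k < b ∧ b ≤ a + k ∧ -(n - k) < a ∧ 3 * a ≤ 2 * n - 3 * (n - k)) by
    rcases H with ⟨h1, h2, h3, h4, h5⟩ | ⟨h1, h2, h3, h4, h5⟩
    · left
      rify at h1 h2 h3 h4 h5
      rw [← hx', ← hz'] at *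
      rw [← hy'] at *
      dsimp only
      refine ⟨?_, ?_, ?_, ?_, ?_⟩ <;> by_contra hc <;> push Not at hc <;> nlinarith
    · right
      rify at h1 h2 h3 h4 h5
      rw [← hx', ← hz'] at *
      rw [← hy'] at *
      dsimp only
      refine ⟨?_, ?_, ?_, ?_, ?_⟩ <;> by_contra hc <;> push Not at hc <;> nlinarith
  rcases hmem with ⟨h1, h2, h3, h4, h5⟩ | ⟨h1, h2, h3, h4, h5⟩ <;> dsimp only at h2 h3 h4 h5
  · have g1 : 2 * k < n := by
      have : (2 : ℝ) * k < n := by nlinarith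
      exact_mod_cast this
    have g2 : -a - k - 1 < b := by
      have : (-a - k - 1 : ℝ) < b := by nlinarith
      exact_mod_cast this
    have g3 : b < a + n - k := by
      have : (b : ℝ) < a + n - k := by nlinarith
      exact_mod_cast this
    have g4 : -k - 1 < a := by
      have : (-k - 1 : ℝ) < a := by nlinarith
      exact_mod_cast this
    left
    omega
  · have g1 : n < 2 * k + 2 := by
      have : (n : ℝ) < 2 * k + 2 := by nlinarith
      exact_mod_cast this
    have g2 : -a - n + k < b := by
      have : (-a - n + k : ℝ) < b := by nlinarith
      exact_mod_cast this
    have g2' : -2 * a - n < 2 * b := by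
      have : (-2 * a - n : ℝ) < 2 * b := by nlinarith
      exact_mod_cast this
    have g3 : b < a + k + 1 := by
      have : (b : ℝ) < a + k + 1 := by nlinarith
      exact_mod_cast this
    have g4 : -(n - k) < a := by
      have : (-(n - k) : ℝ) < a := by nlinarith
      exact_mod_cast this
    have hex' : a = 1 → (n = 2 ∨ n = 4) → n < 2 * k := by
      intro u v
      have h4 := mul_le_mul_of_nonneg_right (hexc u v h1) hn0.le
      have h5 : (1/2 + 1 / (n : ℝ)) * n = n / 2 + 1 := by field_simp
      have h6 : (n : ℝ) < 2 * k := by linarith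
      exact_mod_cast h6
    by_cases hc : 2 * k < n
    · left; omega
    · right
      omega

theorem stmt_16 (p0 p1 : ℤ) (hp : 2 ≤ |p0|) (ε : ℝ) (hε0 : 0 ≤ ε) (hε1 : ε < 1)
    (k : ℤ) (hk : k = ⌊ε * (|p0| : ℝ)⌋)
    (hmem : (1 / (p0 : ℝ), (p1 : ℝ) / (p0 : ℝ)) ∈ Dset ε)
    (hexc : ¬((p0 = 2 ∨ p0 = 4) ∧ 1/2 ≤ ε ∧ ε < 1/2 + 1 / (|p0| : ℝ))) :
    (1 / (p0 : ℝ), (p1 : ℝ) / (p0 : ℝ)) ∈ Bset ((k : ℝ) / (|p0| : ℝ)) := by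
  rcases le_or_gt 0 p0 with h | h
  · have hR : (0 : ℝ) ≤ p0 := by exact_mod_cast h
    rw [abs_of_nonneg h] at hp
    rw [abs_of_nonneg hR] at hk hexc ⊢
    have := core_aux p0 1 p1 k hp (Or.inl rfl) ε hε0 hε1 hk (by simpa using hmem) (by
      intro _ h2 h3
      by_contra h4
      exact hexc ⟨h2, h3, not_le.1 h4⟩)
    simpa using this
  · have hR : (p0 : ℝ) < 0 := by exact_mod_cast h
    rw [abs_of_neg h] at hp
    rw [abs_of_neg hR] at hk hexc ⊢
    have e1 : ((-1 : ℤ) : ℝ) / ((-p0 : ℤ) : ℝ) = 1 / (p0 : ℝ) := by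
      push_cast; rw [neg_div_neg_eq]
    have e2 : ((-p1 : ℤ) : ℝ) / ((-p0 : ℤ) : ℝ) = (p1 : ℝ) / (p0 : ℝ) := by
      push_cast; rw [neg_div_neg_eq]
    have := core_aux (-p0) (-1) (-p1) k hp (Or.inr rfl) ε hε0 hε1 (by push_cast; exact hk)
      (by rw [e1, e2]; exact hmem) (by intro h1; norm_num at h1)
    rw [e1, e2] at this
    push_cast at this
    exact this
end

section
/- Let p_0 ∈ {2,4}, let ε ∈ [1/2, 1/2 + 1/p_0), and set k = ⌊ε p_0⌋. Then P(x) = x² + p_1 x + p_0 is an ε-CNS polynomial if and only if -p_0 + k ≤ p_1 ≤ k + 1. -/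
open Polynomial

/-- `P` is an `ε`-CNS polynomial: every integer polynomial `a` is congruent modulo `P`
to a sum `∑ d_j x^j` whose digits `d_j` lie in `N_ε = [-ε|P(0)|, (1-ε)|P(0)|) ∩ ℤ`. -/
def IsEpsCNS (ε : ℝ) (P : Polynomial ℤ) : Prop :=
  ∀ a : Polynomial ℤ, ∃ l : ℕ, 0 < l ∧ ∃ dig : ℕ → ℤ,
    (∀ j < l, -(ε * |(P.coeff 0 : ℝ)|) ≤ (dig j : ℝ) ∧
        (dig j : ℝ) < (1 - ε) * |(P.coeff 0 : ℝ)|) ∧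
    P ∣ a - ∑ j ∈ Finset.range l, C (dig j) * X ^ j

/-- the backward division map -/
def TT (lo p0 p1 : ℤ) (a : ℤ × ℤ) : ℤ × ℤ :=
  (a.2 - p1 * ((a.1 - lo) / p0), -((a.1 - lo) / p0))

lemma TT_zero (lo p0 p1 : ℤ) (h0 : lo ≤ 0) (h1 : -lo < p0) : TT lo p0 p1 0 = 0 := by
  have : (0 - lo) / p0 = 0 := Int.ediv_eq_zero_of_lt (by omega) (by omega)
  unfold TT
  simp only [Prod.fst_zero, Prod.snd_zero, this]
  simp

lemma TT_add (lo p0 p1 : ℤ) (hp : 0 < p0) (a e : ℤ × ℤ) :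
    TT lo p0 p1 (a + e) = TT lo p0 p1 a +
      TT lo p0 p1 (e.1 + ((a.1 - lo) % p0 + lo), e.2) := by
  have h := Int.emod_add_mul_ediv (a.1 - lo) p0
  have : (a.1 + e.1 - lo) / p0 = (a.1 - lo) / p0 + (e.1 + ((a.1 - lo) % p0 + lo) - lo) / p0 := by
    have : a.1 + e.1 - lo = (e.1 + ((a.1 - lo) % p0 + lo) - lo) + p0 * ((a.1 - lo) / p0) := by
      linarith
    rw [this, Int.add_mul_ediv_left _ _ hp.ne']
    have : p0 * ((a.1 - lo) / p0) = a.1 - lo - (a.1 - lo) % p0 := by linarith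
    ring
  unfold TT
  simp only [Prod.fst_add, Prod.snd_add, this, Prod.mk_add_mk]
  ext <;> simp <;> ring

lemma reach_add (lo p0 p1 : ℤ) (hp : 0 < p0) (E : List (ℤ × ℤ)) (N : ℕ)
    (hE : ∀ e ∈ E, ∀ r ∈ Finset.Ico 0 p0, TT lo p0 p1 (e.1 + (r + lo), e.2) ∈ E)
    (hN : ∀ e ∈ E, (TT lo p0 p1)^[N] e = 0) (l : ℕ) :
    ∀ a e : ℤ × ℤ, e ∈ E → (TT lo p0 p1)^[l] a = 0 → ∃ m, (TT lo p0 p1)^[m] (a + e) = 0 := by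
  induction l with
  | zero =>
    intro a e he h
    simp only [Function.iterate_zero, id] at h
    exact ⟨N, by rw [h, zero_add]; exact hN e he⟩
  | succ l ih =>
    intro a e he h
    rw [Function.iterate_succ_apply] at h
    obtain ⟨m, hm⟩ := ih _ _ (hE e he ((a.1 - lo) % p0)
      (Finset.mem_Ico.2 ⟨Int.emod_nonneg _ hp.ne', Int.emod_lt_of_pos _ hp⟩)) h
    exact ⟨m + 1, by rw [Function.iterate_succ_apply, TT_add _ _ _ hp]; exact hm⟩

lemma reach_all (lo p0 p1 : ℤ) (hp : 0 < p0) (E : List (ℤ × ℤ)) (N : ℕ)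
    (hE : ∀ e ∈ E, ∀ r ∈ Finset.Ico 0 p0, TT lo p0 p1 (e.1 + (r + lo), e.2) ∈ E)
    (hN : ∀ e ∈ E, (TT lo p0 p1)^[N] e = 0)
    (h1 : (1, 0) ∈ E) (h2 : (-1, 0) ∈ E) (h3 : (0, 1) ∈ E) (h4 : (0, -1) ∈ E) (a : ℤ × ℤ) :
    ∃ m, (TT lo p0 p1)^[m] a = 0 := by
  have key := fun (a e : ℤ × ℤ) (he : e ∈ E) (h : ∃ l, (TT lo p0 p1)^[l] a = 0) =>
    h.elim fun l hl => reach_add lo p0 p1 hp E N hE hN l a e he hl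
  have hx : ∀ x : ℤ, ∃ m, (TT lo p0 p1)^[m] (x, 0) = 0 := by
    intro x
    induction x using Int.induction_on with
    | zero => exact ⟨0, rfl⟩
    | succ i ih => simpa using key _ _ h1 ih
    | pred i ih => simpa [sub_eq_add_neg] using key _ _ h2 ih
  obtain ⟨x, y⟩ := a
  induction y using Int.induction_on with
  | zero => exact hx x
  | succ i ih => simpa using key _ _ h3 ih
  | pred i ih => simpa [sub_eq_add_neg] using key _ _ h4 ih

lemma poly_of_reach (lo p0 p1 : ℤ) (hp : 0 < p0) (l : ℕ) : ∀ a : ℤ × ℤ,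
    (TT lo p0 p1)^[l] a = 0 → ∃ dig : ℕ → ℤ, (∀ j < l, lo ≤ dig j ∧ dig j < lo + p0) ∧
      (X ^ 2 + C p1 * X + C p0 : ℤ[X]) ∣
        C a.1 + C a.2 * X - ∑ j ∈ Finset.range l, C (dig j) * X ^ j := by
  induction l with
  | zero =>
    intro a h
    simp only [Function.iterate_zero, id] at h
    exact ⟨fun _ => 0, by simp, by simp [h]⟩
  | succ l ih =>
    intro a h
    rw [Function.iterate_succ_apply] at h
    obtain ⟨dig, hd, Q, hQ⟩ := ih _ h
    have e := Int.emod_add_mul_ediv (a.1 - lo) p0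
    have n1 := Int.emod_nonneg (a.1 - lo) hp.ne'
    have n2 := Int.emod_lt_of_pos (a.1 - lo) hp
    refine ⟨fun j => Nat.casesOn j ((a.1 - lo) % p0 + lo) dig, ?_, ?_⟩
    · intro j hj
      cases j with
      | zero => exact ⟨by simpa using n1, by simp; omega⟩
      | succ j => exact hd j (by omega)
    · refine ⟨C ((a.1 - lo) / p0) + X * Q, ?_⟩
      rw [Finset.sum_range_succ']
      simp only [pow_succ, pow_zero, mul_one]
      have s : ∑ k ∈ Finset.range l, C (dig k) * (X ^ k * X) =
          (∑ k ∈ Finset.range l, C (dig k) * X ^ k) * X := by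
        rw [Finset.sum_mul]; exact Finset.sum_congr rfl fun _ _ => by ring
      rw [s]
      have ha : a.1 = (a.1 - lo) % p0 + lo + p0 * ((a.1 - lo) / p0) := by linarith
      generalize (a.1 - lo) % p0 + lo = d at ha ⊢
      simp only [TT] at hQ
      generalize (a.1 - lo) / p0 = q at ha hQ ⊢
      rw [ha]
      simp only [C_add, C_mul, C_sub, C_neg] at hQ ⊢
      linear_combination X * hQ

lemma reach_of_poly (lo p0 p1 : ℤ) (hp : 0 < p0) (l : ℕ) : ∀ (a : ℤ × ℤ) (dig : ℕ → ℤ),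
    (∀ j < l, lo ≤ dig j ∧ dig j < lo + p0) →
      (X ^ 2 + C p1 * X + C p0 : ℤ[X]) ∣
        C a.1 + C a.2 * X - ∑ j ∈ Finset.range l, C (dig j) * X ^ j →
    (TT lo p0 p1)^[l] a = 0 := by
  induction l with
  | zero =>
    intro a dig _ h
    simp only [Finset.range_zero, Finset.sum_empty, sub_zero] at h
    have hm : (X ^ 2 + C p1 * X + C p0 : ℤ[X]).Monic := by monicity!
    have hdeg : (X ^ 2 + C p1 * X + C p0 : ℤ[X]).natDegree = 2 := by compute_degree!
    have : (C a.1 + C a.2 * X : ℤ[X]) = 0 := by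
      by_contra hne
      refine hm.not_dvd_of_natDegree_lt hne ?_ h
      rw [hdeg]
      have : (C a.1 + C a.2 * X : ℤ[X]).natDegree ≤ 1 := by compute_degree
      omega
    have c0 := congrArg (fun p => coeff p 0) this
    have c1 := congrArg (fun p => coeff p 1) this
    simp only [coeff_add, coeff_C, coeff_C_mul, coeff_X, coeff_zero] at c0 c1
    norm_num at c0 c1
    exact Prod.ext c0 c1
  | succ l ih =>
    intro a dig hd h
    obtain ⟨Q, hQ⟩ := h
    rw [Finset.sum_range_succ'] at hQ
    have s : ∑ k ∈ Finset.range l, C (dig (k+1)) * X ^ (k+1) =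
        (∑ k ∈ Finset.range l, C (dig (k+1)) * X ^ k) * X := by
      rw [Finset.sum_mul]; exact Finset.sum_congr rfl fun _ _ => by ring
    rw [s] at hQ
    have hd0 := hd 0 (by omega)
    have c0 := congrArg (fun p => eval 0 p) hQ
    simp at c0
    obtain ⟨Q', hQ'⟩ : X ∣ Q - C (eval 0 Q) := by
      rw [X_dvd_iff]; simp [coeff_zero_eq_eval_zero]
    generalize eval 0 Q = q at c0 hQ'
    have hq : (a.1 - lo) / p0 = q := by
      have : a.1 - lo = (dig 0 - lo) + p0 * q := by linarith
      rw [this, Int.add_mul_ediv_left _ _ hp.ne', Int.ediv_eq_zero_of_lt (by omega) (by omega)]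
      ring
    rw [Function.iterate_succ_apply]
    refine ih _ (fun j => dig (j+1)) (fun j hj => hd (j+1) (by omega)) ⟨Q', ?_⟩
    simp only [TT, hq]
    apply mul_left_cancel₀ (X_ne_zero (R := ℤ))
    have ha : a.1 = dig 0 + p0 * q := by linarith
    rw [ha] at hQ
    have hQ2 : Q = C q + X * Q' := by linear_combination hQ'
    rw [hQ2] at hQ
    simp only [C_add, C_mul, C_sub, C_neg, pow_zero] at hQ ⊢
    linear_combination hQ

lemma cns_iff (ε : ℝ) (lo p0 p1 : ℤ) (hp : 0 < p0) (h0 : lo ≤ 0) (h1 : -lo < p0)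
    (hD : ∀ d : ℤ, (-(ε * (p0 : ℝ)) ≤ d ∧ (d : ℝ) < (1 - ε) * p0) ↔ lo ≤ d ∧ d < lo + p0) :
    IsEpsCNS ε (X ^ 2 + C p1 * X + C p0) ↔ ∀ a, ∃ m, (TT lo p0 p1)^[m] a = 0 := by
  have hc : |(((X ^ 2 + C p1 * X + C p0 : ℤ[X]).coeff 0 : ℤ) : ℝ)| = p0 := by
    have : (X ^ 2 + C p1 * X + C p0 : ℤ[X]).coeff 0 = p0 := by simp
    rw [this, abs_of_pos (by exact_mod_cast hp)]
  unfold IsEpsCNS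
  simp only [hc, hD]
  constructor
  · intro H a
    obtain ⟨l, _, dig, hd, h⟩ := H (C a.1 + C a.2 * X)
    exact ⟨l, reach_of_poly lo p0 p1 hp l a dig hd h⟩
  · intro H a
    have hm : (X ^ 2 + C p1 * X + C p0 : ℤ[X]).Monic := by monicity!
    have hdeg : (X ^ 2 + C p1 * X + C p0 : ℤ[X]).natDegree = 2 := by compute_degree!
    set P := (X ^ 2 + C p1 * X + C p0 : ℤ[X])
    have hr : (a %ₘ P).natDegree ≤ 1 := by
      have := natDegree_modByMonic_lt a hm (by intro h; rw [h] at hdeg; simp at hdeg)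
      omega
    have hr2 := eq_X_add_C_of_natDegree_le_one hr
    obtain ⟨m, hm'⟩ := H ((a %ₘ P).coeff 0, (a %ₘ P).coeff 1)
    have hm2 : (TT lo p0 p1)^[m + 1] ((a %ₘ P).coeff 0, (a %ₘ P).coeff 1) = 0 := by
      rw [Function.iterate_succ_apply', hm', TT_zero _ _ _ h0 h1]
    obtain ⟨dig, hd, h⟩ := poly_of_reach lo p0 p1 hp _ _ hm2
    refine ⟨m + 1, by omega, dig, hd, ?_⟩
    have e := modByMonic_add_div a P
    have h' : P ∣ a %ₘ P - ∑ j ∈ Finset.range (m + 1), C (dig j) * X ^ j := by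
      rw [hr2]; convert h using 1; ring
    have : a - ∑ j ∈ Finset.range (m + 1), C (dig j) * X ^ j =
      (a %ₘ P - ∑ j ∈ Finset.range (m + 1), C (dig j) * X ^ j) + P * (a /ₘ P) := by
      linear_combination -e
    rw [this]
    exact dvd_add h' (dvd_mul_right _ _)

lemma not_reach (f : ℤ × ℤ → ℤ × ℤ) (S : ℤ × ℤ → Prop) (h0 : ¬ S 0) (hS : ∀ a, S a → S (f a))
    (a : ℤ × ℤ) (ha : S a) : ¬ ∃ m, f^[m] a = 0 := by
  rintro ⟨m, hm⟩
  have : ∀ m, S (f^[m] a) := by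
    intro m
    induction m with
    | zero => exact ha
    | succ m ih => rw [Function.iterate_succ_apply']; exact hS _ ih
  exact h0 (hm ▸ this m)

lemma big_fail (lo p0 p1 : ℤ) (hp : (p0 = 2 ∧ lo = -1) ∨ (p0 = 4 ∧ lo = -2))
    (h : p1 ≤ -(p0 + 1) ∨ p0 + 1 ≤ p1) : ¬ ∃ m, (TT lo p0 p1)^[m] (p0, 0) = 0 := by
  apply not_reach _ (fun a => |a.2| ≤ |(a.1 - lo) / p0| ∧ (a.1 - lo) / p0 ≠ 0)
  · rcases hp with ⟨rfl, rfl⟩ | ⟨rfl, rfl⟩ <;> decide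
  · rintro ⟨x, y⟩ ⟨h1, h2⟩
    simp only [TT] at *
    generalize (x - lo) / p0 = q at *
    have key : (p0 + 1) * q ≤ p1 * q ∧ 0 < q ∨ (p0 + 1) * q ≤ -(p1 * q) ∧ 0 < q ∨
        (p0 + 1) * q ≥ p1 * q ∧ q < 0 ∨ (p0 + 1) * q ≥ -(p1 * q) ∧ q < 0 := by
      rcases lt_or_gt_of_ne h2 with hq | hq <;> rcases h with h | h
      · right; right; right; exact ⟨by nlinarith, hq⟩
      · right; right; left; exact ⟨by nlinarith, hq⟩
      · right; left; exact ⟨by nlinarith, hq⟩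
      · left; exact ⟨by nlinarith, hq⟩
    generalize p1 * q = m at *
    rcases hp with ⟨rfl, rfl⟩ | ⟨rfl, rfl⟩ <;> grind
  · rcases hp with ⟨rfl, rfl⟩ | ⟨rfl, rfl⟩ <;> decide

theorem stmt_17 (p0 p1 : ℤ) (hp : p0 = 2 ∨ p0 = 4) (ε : ℝ)
    (hε0 : 1/2 ≤ ε) (hε1 : ε < 1/2 + 1 / (p0 : ℝ))
    (k : ℤ) (hk : k = ⌊ε * (p0 : ℝ)⌋) :
    IsEpsCNS ε (X ^ 2 + C p1 * X + C p0) ↔ -p0 + k ≤ p1 ∧ p1 ≤ k + 1 := by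
  rcases hp with rfl | rfl
  · have hk1 : k = 1 := by
      rw [hk, Int.floor_eq_iff]; push_cast at *; constructor <;> linarith
    subst hk1
    rw [cns_iff ε (-1) 2 p1 (by norm_num) (by norm_num) (by norm_num)]
    · constructor
      · intro H
        by_contra hcon
        by_cases h : p1 = -2
        · subst h
          refine not_reach (TT (-1) 2 (-2)) (fun a => a = (1, -1)) (by decide) ?_ (1, -1) rfl (H _)
          rintro a rfl; decide
        · exact big_fail (-1) 2 p1 (by simp) (by omega) (H _)
      · rintro ⟨h1, h2⟩
        norm_num at h1 h2
        interval_cases p1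
        · exact reach_all (-1) 2 (-1) (by norm_num) [(1, 0), (-1, 0), (0, 1), (0, -1), (0, 0), (1, -1), (-1, 1)] 5
            (by decide) (by decide) (by decide) (by decide) (by decide) (by decide)
        · exact reach_all (-1) 2 0 (by norm_num) [(1, 0), (-1, 0), (0, 1), (0, -1), (0, 0)] 4
            (by decide) (by decide) (by decide) (by decide) (by decide) (by decide)
        · exact reach_all (-1) 2 1 (by norm_num) [(1, 0), (-1, 0), (0, 1), (0, -1), (0, 0), (-1, -1), (1, 1)] 4
            (by decide) (by decide) (by decide) (by decide) (by decide) (by decide)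
        · exact reach_all (-1) 2 2 (by norm_num) [(1, 0), (-1, 0), (0, 1), (0, -1), (0, 0), (-2, -1), (2, 1), (1, 1), (-1, -1)] 6
            (by decide) (by decide) (by decide) (by decide) (by decide) (by decide)
    · intro d
      push_cast at *
      constructor
      · rintro ⟨h1, h2⟩
        have a1 : (-2 : ℝ) < d := by linarith
        have a2 : (d : ℝ) < 1 := by linarith
        have b1 : -2 < d := by exact_mod_cast a1
        have b2 : d < 1 := by exact_mod_cast a2
        omega
      · rintro ⟨h1, h2⟩
        have a1 : (-1 : ℝ) ≤ d := by exact_mod_cast h1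
        have a2 : (d : ℝ) ≤ 0 := by exact_mod_cast (by omega : d ≤ 0)
        constructor <;> linarith
  · have hk1 : k = 2 := by
      rw [hk, Int.floor_eq_iff]; push_cast at *; constructor <;> linarith
    subst hk1
    rw [cns_iff ε (-2) 4 p1 (by norm_num) (by norm_num) (by norm_num)]
    · constructor
      · intro H
        by_contra hcon
        by_cases h : p1 = -3
        · subst h
          refine not_reach (TT (-2) 4 (-3)) (fun a => a = (2, -1)) (by decide) ?_ (2, -1) rfl (H _)
          rintro a rfl; decide
        by_cases h : p1 = -4
        · subst h
          refine not_reach (TT (-2) 4 (-4)) (fun a => a = (3, -1)) (by decide) ?_ (3, -1) rfl (H _)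
          rintro a rfl; decide
        by_cases h : p1 = 4
        · subst h
          refine not_reach (TT (-2) 4 4) (fun a => a = (3, 1) ∨ a = (-3, -1)) (by decide) ?_ (3, 1)
            (Or.inl rfl) (H _)
          rintro a (rfl | rfl) <;> decide
        · exact big_fail (-2) 4 p1 (by simp) (by omega) (H _)
      · rintro ⟨h1, h2⟩
        norm_num at h1 h2
        interval_cases p1
        · exact reach_all (-2) 4 (-2) (by norm_num) [(1, 0), (-1, 0), (0, 1), (0, -1), (0, 0), (2, -1), (-2, 1), (1, -1), (-1, 1)] 3
            (by decide) (by decide) (by decide) (by decide) (by decide) (by decide)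
        · exact reach_all (-2) 4 (-1) (by norm_num) [(1, 0), (-1, 0), (0, 1), (0, -1), (0, 0), (1, -1), (-1, 1)] 3
            (by decide) (by decide) (by decide) (by decide) (by decide) (by decide)
        · exact reach_all (-2) 4 0 (by norm_num) [(1, 0), (-1, 0), (0, 1), (0, -1), (0, 0)] 3
            (by decide) (by decide) (by decide) (by decide) (by decide) (by decide)
        · exact reach_all (-2) 4 1 (by norm_num) [(1, 0), (-1, 0), (0, 1), (0, -1), (0, 0), (-1, -1), (1, 1)] 3
            (by decide) (by decide) (by decide) (by decide) (by decide) (by decide)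
        · exact reach_all (-2) 4 2 (by norm_num) [(1, 0), (-1, 0), (0, 1), (0, -1), (0, 0), (-2, -1), (2, 1), (1, 1), (-1, -1)] 3
            (by decide) (by decide) (by decide) (by decide) (by decide) (by decide)
        · exact reach_all (-2) 4 3 (by norm_num) [(1, 0), (-1, 0), (0, 1), (0, -1), (0, 0), (-3, -1), (3, 1), (2, 1), (-2, -1)] 4
            (by decide) (by decide) (by decide) (by decide) (by decide) (by decide)
    · intro d
      push_cast at *
      constructor
      · rintro ⟨h1, h2⟩
        have a1 : (-3 : ℝ) < d := by linarith
        have a2 : (d : ℝ) < 2 := by linarith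
        have b1 : -3 < d := by exact_mod_cast a1
        have b2 : d < 2 := by exact_mod_cast a2
        omega
      · rintro ⟨h1, h2⟩
        have a1 : (-2 : ℝ) ≤ d := by exact_mod_cast h1
        have a2 : (d : ℝ) ≤ 1 := by exact_mod_cast (by omega : d ≤ 1)
        constructor <;> linarith
end
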